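/- Let n ≥ 1 and α > 0. Let F : S → ℂ be a bounded smooth function with L_α F = 0, and let f : H^n → ℂ be a smooth bounded function which is the boundary value of F. Then F is pluriharmonic if and only if (ℒ² + n² T²) f = 0. -/

import Mathlib

noncomputable section
open MeasureTheory Filter Set
open scoped Topology BigOperators

/-- The Heisenberg group `H^n = ℂ^n × ℝ` as a set. -/
abbrev Hn (n : ℕ) : Type := (Fin n → ℂ) × ℝ

/-- The extension `S = H^n × (0,∞)`; we use `H^n × ℝ` and restrict to `a > 0`. -/
abbrev Sg (n : ℕ) : Type := Hn n × ℝ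

/-- Directional derivative of a complex valued function in direction `v`. -/
def dirD {E : Type} [NormedAddCommGroup E] [NormedSpace ℝ E]
    (v : E) (f : E → ℂ) (p : E) : ℂ := fderiv ℝ f p v

def eX (n : ℕ) (j : Fin n) : Hn n := (fun i => if i = j then (1 : ℂ) else 0, 0)
def eY (n : ℕ) (j : Fin n) : Hn n := (fun i => if i = j then Complex.I else 0, 0)
def eT (n : ℕ) : Hn n := (0, 1)

/-- `X_j = ∂_{x_j} + 2 y_j ∂_t` on `H^n`. -/
def XH (n : ℕ) (j : Fin n) (f : Hn n → ℂ) (p : Hn n) : ℂ :=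
  dirD (eX n j) f p + 2 * ((p.1 j).im : ℂ) * dirD (eT n) f p

/-- `Y_j = ∂_{y_j} - 2 x_j ∂_t` on `H^n`. -/
def YH (n : ℕ) (j : Fin n) (f : Hn n → ℂ) (p : Hn n) : ℂ :=
  dirD (eY n j) f p - 2 * ((p.1 j).re : ℂ) * dirD (eT n) f p

/-- `T = ∂_t` on `H^n`. -/
def TH (n : ℕ) (f : Hn n → ℂ) (p : Hn n) : ℂ := dirD (eT n) f p

/-- `ℒ_α = -(1/4) Σ (X_j² + Y_j²) + i α T` on `H^n`. -/
def LH (n : ℕ) (α : ℝ) (f : Hn n → ℂ) (p : Hn n) : ℂ :=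
  -(1/4) * ∑ j, (XH n j (XH n j f) p + YH n j (YH n j f) p) + Complex.I * (α : ℂ) * TH n f p

/-- `Z̄_j = (1/2)(X_j + i Y_j)` on `H^n`. -/
def ZbarH (n : ℕ) (j : Fin n) (f : Hn n → ℂ) (p : Hn n) : ℂ :=
  (1/2) * (XH n j f p + Complex.I * YH n j f p)

/-- A function is bounded. -/
def BddFun {X : Type} (f : X → ℂ) : Prop := ∃ C, ∀ p, ‖f p‖ ≤ C

def eXS (n : ℕ) (j : Fin n) : Sg n := (eX n j, 0)
def eYS (n : ℕ) (j : Fin n) : Sg n := (eY n j, 0)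
def eTS (n : ℕ) : Sg n := (eT n, 0)
def eA (n : ℕ) : Sg n := (0, 1)

/-- `X_j` on `S`. -/
def XS (n : ℕ) (j : Fin n) (F : Sg n → ℂ) (p : Sg n) : ℂ :=
  dirD (eXS n j) F p + 2 * ((p.1.1 j).im : ℂ) * dirD (eTS n) F p

/-- `Y_j` on `S`. -/
def YS (n : ℕ) (j : Fin n) (F : Sg n → ℂ) (p : Sg n) : ℂ :=
  dirD (eYS n j) F p - 2 * ((p.1.1 j).re : ℂ) * dirD (eTS n) F p

/-- `T = ∂_t` on `S`. -/
def TS (n : ℕ) (F : Sg n → ℂ) (p : Sg n) : ℂ := dirD (eTS n) F p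

/-- `∂_a` on `S`. -/
def DA (n : ℕ) (F : Sg n → ℂ) : Sg n → ℂ := fun p => dirD (eA n) F p

/-- `ℒ = -(1/4) Σ (X_j² + Y_j²)` acting in the `H^n`-variables on `S`. -/
def LS0 (n : ℕ) (F : Sg n → ℂ) (p : Sg n) : ℂ :=
  -(1/4) * ∑ j, (XS n j (XS n j F) p + YS n j (YS n j F) p)

/-- `L_α = -α a (ℒ + n ∂_a) + a² (∂_a² + T²)` on `S`. -/
def Lalpha (n : ℕ) (α : ℝ) (F : Sg n → ℂ) (p : Sg n) : ℂ :=
  -(α : ℂ) * (p.2 : ℂ) * (LS0 n F p + (n : ℂ) * DA n F p)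
    + (p.2 : ℂ) ^ 2 * (DA n (DA n F) p + TS n (TS n F) p)

/-- The complex space `ℂ^{n+1}` in which the Siegel upper half-plane lives. -/
abbrev Vn (n : ℕ) : Type := (Fin n → ℂ) × ℂ

/-- The Siegel upper half-plane `U^n`. -/
def Un (n : ℕ) : Set (Vn n) := {z | ∑ j, ‖z.1 j‖ ^ 2 < z.2.im}

/-- The function `F_u` on the Siegel upper half-plane corresponding to a function `F` on `S`,
via `F[ζ,t,a] = F_u(ζ, t + i|ζ|² + ia)`, i.e.
`F_u(z', z_{n+1}) = F(z', Re z_{n+1}, Im z_{n+1} - |z'|²)`. -/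
def Fu (n : ℕ) (F : Sg n → ℂ) : Vn n → ℂ :=
  fun z => F ((z.1, z.2.re), z.2.im - ∑ j, ‖z.1 j‖ ^ 2)

/-- `F` is holomorphic if `F_u` is holomorphic on `U^n`. -/
def IsHolo (n : ℕ) (F : Sg n → ℂ) : Prop := DifferentiableOn ℂ (Fu n F) (Un n)

/-- `F` is anti-holomorphic if the conjugate of `F_u` is holomorphic on `U^n`. -/
def IsAntiHolo (n : ℕ) (F : Sg n → ℂ) : Prop :=
  DifferentiableOn ℂ (fun z => (starRingEnd ℂ) (Fu n F z)) (Un n)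

/-- Wirtinger derivative `∂_z` in complex direction `v`. -/
def dzV (n : ℕ) (v : Vn n) (f : Vn n → ℂ) (p : Vn n) : ℂ :=
  (1/2) * (fderiv ℝ f p v - Complex.I * fderiv ℝ f p (Complex.I • v))

/-- Wirtinger derivative `∂_{z̄}` in complex direction `v`. -/
def dzbarV (n : ℕ) (v : Vn n) (f : Vn n → ℂ) (p : Vn n) : ℂ :=
  (1/2) * (fderiv ℝ f p v + Complex.I * fderiv ℝ f p (Complex.I • v))

/-- The standard complex basis vectors of `ℂ^{n+1} = ℂ^n × ℂ`. -/
def basisV (n : ℕ) (k : Fin (n + 1)) : Vn n :=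
  if _h : (k : ℕ) < n then (fun i => if (i : ℕ) = (k : ℕ) then (1 : ℂ) else 0, 0) else (0, 1)

/-- `F` is pluriharmonic if `∂_{z_k} ∂_{z̄_j} F_u = 0` on `U^n` for all `1 ≤ j,k ≤ n+1`. -/
def IsPluriharmonic (n : ℕ) (F : Sg n → ℂ) : Prop :=
  ∀ p ∈ Un n, ∀ j k : Fin (n + 1),
    dzV n (basisV n k) (dzbarV n (basisV n j) (Fu n F)) p = 0

/-- `f` is the boundary value of `F` : for every `φ ∈ L¹(H^n)`,
`∫ F(w,a) φ(w) dw → ∫ f(w) φ(w) dw` as `a → 0⁺`. -/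
def IsBoundaryValue (n : ℕ) (F : Sg n → ℂ) (f : Hn n → ℂ) : Prop :=
  ∀ φ : Hn n → ℂ, Integrable φ →
    Tendsto (fun a : ℝ => ∫ w : Hn n, F (w, a) * φ w) (𝓝[>] (0 : ℝ))
      (𝓝 (∫ w : Hn n, f w * φ w))

section
open scoped ContDiff

instance instHaarHn (n : ℕ) : (volume : Measure (Hn n)).IsAddHaarMeasure :=
  Measure.prod.instIsAddHaarMeasure volume volume

/-- smooth compactly supported test functions -/
def Tst {n : ℕ} (χ : Hn n → ℂ) : Prop := ContDiff ℝ ∞ χ ∧ HasCompactSupport χ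

/-- the linear form `2 Im Σ p_i conj v_i`. -/
def cof {n : ℕ} (v : Hn n) : Hn n →L[ℝ] ℝ :=
  (2:ℝ) • ∑ i, (Complex.imCLM ∘L ((ContinuousLinearMap.mul ℝ ℂ).flip ((starRingEnd ℂ) (v.1 i)))
    ∘L (ContinuousLinearMap.proj i) ∘L (ContinuousLinearMap.fst ℝ (Fin n → ℂ) ℝ))

lemma cof_apply {n : ℕ} (v p : Hn n) : cof v p = 2 * ∑ i, (p.1 i * (starRingEnd ℂ) (v.1 i)).im := by
  simp only [cof, _root_.smul_apply, _root_.sum_apply, smul_eq_mul]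
  rfl

def xi {n : ℕ} (v p : Hn n) : Hn n := v + cof v p • eT n

/-- left invariant derivative -/
def LD {n : ℕ} (v : Hn n) (f : Hn n → ℂ) (p : Hn n) : ℂ := fderiv ℝ f p (xi v p)

lemma LD_eq {n : ℕ} (v : Hn n) (f : Hn n → ℂ) (p : Hn n) :
    LD v f p = fderiv ℝ f p v + (cof v p : ℂ) * fderiv ℝ f p (eT n) := by
  simp [LD, xi, map_add, map_smul]

lemma cof_eX {n : ℕ} (j : Fin n) (p : Hn n) : cof (eX n j) p = 2 * (p.1 j).im := by
  rw [cof_apply, Finset.sum_eq_single j] <;> simp +contextual [eX]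

lemma cof_eY {n : ℕ} (j : Fin n) (p : Hn n) : cof (eY n j) p = - (2 * (p.1 j).re) := by
  rw [cof_apply, Finset.sum_eq_single j] <;> simp +contextual [eY]

lemma cof_eT {n : ℕ} (p : Hn n) : cof (eT n) p = 0 := by
  rw [cof_apply]; simp [eT]

lemma XH_eq {n : ℕ} (j : Fin n) (f : Hn n → ℂ) : XH n j f = LD (eX n j) f := by
  funext p; rw [LD_eq, cof_eX]; simp [XH, dirD]

lemma YH_eq {n : ℕ} (j : Fin n) (f : Hn n → ℂ) : YH n j f = LD (eY n j) f := by
  funext p; rw [LD_eq, cof_eY]; simp [YH, dirD, sub_eq_add_neg]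

lemma TH_eq {n : ℕ} (f : Hn n → ℂ) : TH n f = LD (eT n) f := by
  funext p; rw [LD_eq, cof_eT]; simp [TH, dirD]

lemma contDiff_xi {n : ℕ} (v : Hn n) : ContDiff ℝ ∞ (xi v) := by
  unfold xi
  exact contDiff_const.add ((cof v).contDiff.smul contDiff_const)

lemma contDiff_LD {n : ℕ} (v : Hn n) {f : Hn n → ℂ} (hf : ContDiff ℝ ∞ f) :
    ContDiff ℝ ∞ (LD v f) := by
  unfold LD
  exact (hf.fderiv_right (m := ∞) (by simp)).clm_apply (contDiff_xi v)

lemma Tst.contDiff {n : ℕ} {χ : Hn n → ℂ} (h : Tst χ) : ContDiff ℝ ∞ χ := h.1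
lemma Tst.differentiable {n : ℕ} {χ : Hn n → ℂ} (h : Tst χ) : Differentiable ℝ χ :=
  h.1.differentiable (by simp)
lemma Tst.continuous {n : ℕ} {χ : Hn n → ℂ} (h : Tst χ) : Continuous χ := h.1.continuous
lemma Tst.integrable {n : ℕ} {χ : Hn n → ℂ} (h : Tst χ) : Integrable χ :=
  h.1.continuous.integrable_of_hasCompactSupport h.2

lemma Tst.LD {n : ℕ} {χ : Hn n → ℂ} (h : Tst χ) (v : Hn n) : Tst (LD v χ) := by
  refine ⟨contDiff_LD v h.1, ?_⟩
  have : HasCompactSupport (fderiv ℝ χ) := h.2.fderiv ℝ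
  refine this.mono ?_
  intro p hp
  simp only [Function.mem_support, ne_eq] at hp ⊢
  contrapose! hp
  simp [_root_.LD, hp]

lemma Tst.fderiv {n : ℕ} {χ : Hn n → ℂ} (h : Tst χ) (v : Hn n) :
    Tst (fun p => fderiv ℝ χ p v) := by
  refine ⟨(h.1.fderiv_right (m := ∞) (by simp)).clm_apply contDiff_const, ?_⟩
  have : HasCompactSupport (_root_.fderiv ℝ χ) := h.2.fderiv ℝ
  refine this.mono ?_
  intro p hp
  simp only [Function.mem_support, ne_eq] at hp ⊢
  contrapose! hp
  simp [hp]

lemma Tst.add {n : ℕ} {χ κ : Hn n → ℂ} (h : Tst χ) (h' : Tst κ) : Tst (fun p => χ p + κ p) :=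
  ⟨h.1.add h'.1, h.2.add h'.2⟩
lemma Tst.mul_left {n : ℕ} {χ κ : Hn n → ℂ} (h : Tst χ) (hk : ContDiff ℝ ∞ κ) :
    Tst (fun p => κ p * χ p) :=
  ⟨hk.mul h.1, h.2.mul_left⟩
lemma Tst.const_mul {n : ℕ} {χ : Hn n → ℂ} (h : Tst χ) (c : ℂ) : Tst (fun p => c * χ p) :=
  h.mul_left contDiff_const
lemma Tst.neg {n : ℕ} {χ : Hn n → ℂ} (h : Tst χ) : Tst (fun p => - χ p) := by
  simpa using h.const_mul (-1)
lemma Tst.sub {n : ℕ} {χ κ : Hn n → ℂ} (h : Tst χ) (h' : Tst κ) : Tst (fun p => χ p - κ p) := by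
  simpa [sub_eq_add_neg] using h.add h'.neg
lemma Tst.zero {n : ℕ} : Tst (fun _ : Hn n => (0:ℂ)) :=
  ⟨contDiff_const, HasCompactSupport.zero⟩
lemma Tst.sum {n : ℕ} {ι : Type*} (s : Finset ι) {χ : ι → Hn n → ℂ} (h : ∀ i ∈ s, Tst (χ i)) :
    Tst (fun p => ∑ i ∈ s, χ i p) := by
  classical
  induction s using Finset.induction_on with
  | empty => simpa using Tst.zero
  | insert a s ha ih =>
    simp only [Finset.sum_insert ha]
    exact (h a (by simp)).add (ih (fun i hi => h i (by simp [hi])))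

lemma Tst.conj {n : ℕ} {χ : Hn n → ℂ} (h : Tst χ) : Tst (fun p => (starRingEnd ℂ) (χ p)) := by
  refine ⟨Complex.conjCLE.contDiff.comp h.1, ?_⟩
  exact h.2.comp_left (g := fun z => (starRingEnd ℂ) z) (by simp)

section LDalg
variable {n : ℕ} {f g : Hn n → ℂ}

lemma LD_add (v : Hn n) {p : Hn n} (hf : DifferentiableAt ℝ f p) (hg : DifferentiableAt ℝ g p) :
    LD v (fun p => f p + g p) p = LD v f p + LD v g p := by
  unfold LD; rw [fderiv_fun_add hf hg]; simp
lemma LD_sub (v : Hn n) {p : Hn n} (hf : DifferentiableAt ℝ f p) (hg : DifferentiableAt ℝ g p) :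
    LD v (fun p => f p - g p) p = LD v f p - LD v g p := by
  unfold LD; rw [fderiv_fun_sub hf hg]; simp
lemma LD_mul (v : Hn n) {p : Hn n} (hf : DifferentiableAt ℝ f p) (hg : DifferentiableAt ℝ g p) :
    LD v (fun p => f p * g p) p = f p * LD v g p + LD v f p * g p := by
  unfold LD; rw [fderiv_fun_mul hf hg]; simp; ring
lemma LD_const_mul (v : Hn n) {p : Hn n} (hf : DifferentiableAt ℝ f p) (c : ℂ) :
    LD v (fun p => c * f p) p = c * LD v f p := by
  unfold LD; rw [fderiv_const_mul hf]; simp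
lemma LD_sum {ι : Type*} (s : Finset ι) {f : ι → Hn n → ℂ} (v : Hn n) {p : Hn n}
    (hf : ∀ i ∈ s, DifferentiableAt ℝ (f i) p) :
    LD v (fun p => ∑ i ∈ s, f i p) p = ∑ i ∈ s, LD v (f i) p := by
  unfold LD; rw [fderiv_fun_sum hf]; simp
lemma LD_conj (v : Hn n) {p : Hn n} :
    LD v (fun p => (starRingEnd ℂ) (f p)) p = (starRingEnd ℂ) (LD v f p) := by
  unfold LD
  have := Complex.conjCLE.toContinuousLinearEquiv.comp_fderiv (f := f) (x := p)
  have h2 := congrArg (fun L => L (xi v p)) this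
  simp only [ContinuousLinearMap.comp_apply] at h2
  exact h2

lemma hasFDerivAt_LD (u v : Hn n) (hf : ContDiff ℝ ∞ f) (p : Hn n) :
    LD u (LD v f) p = fderiv ℝ (fderiv ℝ f) p (xi u p) (xi v p)
      + (cof v u : ℂ) * fderiv ℝ f p (eT n) := by
  have h1 : DifferentiableAt ℝ (fderiv ℝ f) p :=
    (hf.fderiv_right (m := ∞) (by simp)).differentiable (by simp) p
  have h2 : HasFDerivAt (xi v) ((cof v).smulRight (eT n)) p := by
    have := ((cof v).hasFDerivAt (x := p)).smul_const (eT n)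
    exact this.const_add v
  have h3 := h1.hasFDerivAt.clm_apply h2
  have h4 : cof v (xi u p) = cof v u := by
    simp only [xi, map_add, map_smul]
    have : cof v (eT n) = 0 := by rw [cof_apply]; simp [eT]
    simp [this]
  have h5 : HasFDerivAt (LD v f) _ p := h3
  conv_lhs => rw [LD]
  rw [h5.fderiv]
  simp [h4]
  ring

lemma LD_comm (u v : Hn n) (hf : ContDiff ℝ ∞ f) (p : Hn n) :
    LD u (LD v f) p = LD v (LD u f) p + ((cof v u - cof u v : ℝ) : ℂ) * LD (eT n) f p := by
  have hs : IsSymmSndFDerivAt ℝ f p := by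
    apply (hf.contDiffAt (x := p)).isSymmSndFDerivAt
    simp only [minSmoothness_of_isRCLikeNormedField]
    exact WithTop.coe_le_coe.2 le_top
  rw [hasFDerivAt_LD u v hf, hasFDerivAt_LD v u hf, hs.eq]
  have : LD (eT n) f p = fderiv ℝ f p (eT n) := by rw [LD_eq, cof_eT]; simp
  rw [this]; push_cast; ring

lemma LD_T_comm (v : Hn n) (hf : ContDiff ℝ ∞ f) :
    LD (eT n) (LD v f) = LD v (LD (eT n) f) := by
  funext p
  rw [LD_comm _ _ hf, cof_eT]
  have : cof v (eT n) = 0 := by rw [cof_apply]; simp [eT]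
  simp [this]

end LDalg

/-- left multiplication -/
def lmul {n : ℕ} (w u : Hn n) : Hn n := w + u + cof u w • eT n

lemma cof_antisymm {n : ℕ} (u v : Hn n) : cof u v = - cof v u := by
  rw [cof_apply, cof_apply, ← mul_neg, ← Finset.sum_neg_distrib]
  congr 1; apply Finset.sum_congr rfl; intro i _; simp; ring

lemma LD_lmul {n : ℕ} (v w : Hn n) {f : Hn n → ℂ} (hf : Differentiable ℝ f) (p : Hn n) :
    LD v (fun u => f (lmul w u)) p = LD v f (lmul w p) := by
  have h1 : HasFDerivAt (lmul w) (ContinuousLinearMap.id ℝ (Hn n) - (cof w).smulRight (eT n)) p := by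
    have : lmul w = fun u => w + u - cof w u • eT n := by
      funext u; rw [lmul, cof_antisymm u w]; simp [sub_eq_add_neg]
    rw [this]
    exact ((hasFDerivAt_id p).const_add w).sub (((cof w).hasFDerivAt (x := p)).smul_const (eT n))
  have h2 := ((hf (lmul w p)).hasFDerivAt.comp p h1).fderiv
  unfold LD
  have h3 : (fun u => f (lmul w u)) = f ∘ lmul w := rfl
  rw [h3, h2]
  simp only [ContinuousLinearMap.comp_apply]
  congr 1
  have h4 : cof w (eT n) = 0 := by rw [cof_apply]; simp [eT]
  have h5 : cof v (eT n) = 0 := by rw [cof_apply]; simp [eT]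
  simp [xi, lmul, h4, h5, cof_antisymm w v, add_smul]
  abel

lemma contDiff_lmul {n : ℕ} (w : Hn n) : ContDiff ℝ ∞ (lmul w) := by
  have : lmul w = fun u => w + u - cof w u • eT n := by
    funext u; rw [lmul, cof_antisymm u w]; simp [sub_eq_add_neg]
  rw [this]
  exact (contDiff_const.add contDiff_id).sub ((cof w).contDiff.smul contDiff_const)

section IBP
variable {n : ℕ}

lemma integral_fderiv_zero {h : Hn n → ℂ} (hh : Tst h) (v : Hn n) :
    ∫ p, fderiv ℝ h p v = 0 := by
  have := integral_mul_fderiv_eq_neg_fderiv_mul_of_integrable (μ := (volume : Measure (Hn n)))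
    (f := fun _ => (1:ℂ)) (g := h) (v := v) (𝕜 := ℂ) (by simp) (by simpa using (hh.fderiv v).integrable)
    (by simpa using hh.integrable) (by fun_prop) (fun x _ => hh.differentiable x)
  simpa using this

lemma integral_LD_zero {h : Hn n → ℂ} (hh : Tst h) (v : Hn n) :
    ∫ p, LD v h p = 0 := by
  have hc : ContDiff ℝ ∞ (fun p : Hn n => (cof v p : ℂ)) :=
    Complex.ofRealCLM.contDiff.comp (cof v).contDiff
  have e : ∀ p, LD v h p = fderiv ℝ h p v + fderiv ℝ (fun p => (cof v p : ℂ) * h p) p (eT n) := by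
    intro p
    rw [LD_eq]
    have hd : HasFDerivAt (fun p : Hn n => (cof v p : ℂ)) (Complex.ofRealCLM ∘L cof v) p :=
      (Complex.ofRealCLM.hasFDerivAt).comp p (cof v).hasFDerivAt
    rw [(hd.fun_mul (hh.differentiable p).hasFDerivAt).fderiv]
    have h5 : cof v (eT n) = 0 := by rw [cof_apply]; simp [eT]
    simp [h5]
  simp_rw [e]
  rw [integral_add (hh.fderiv v).integrable ((hh.mul_left hc).fderiv _).integrable,
    integral_fderiv_zero hh, integral_fderiv_zero (hh.mul_left hc), add_zero]

lemma ibp {g χ : Hn n → ℂ} (hg : ContDiff ℝ ∞ g) (hχ : Tst χ) (v : Hn n) :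
    ∫ p, LD v g p * χ p = - ∫ p, g p * LD v χ p := by
  have h := integral_LD_zero (hχ.mul_left hg) v
  have e : ∀ p, LD v (fun p => g p * χ p) p = g p * LD v χ p + LD v g p * χ p := fun p =>
    LD_mul v (hg.differentiable (by simp) p) (hχ.differentiable p)
  simp_rw [e] at h
  rw [integral_add ((hχ.LD v).mul_left hg).integrable (hχ.mul_left (contDiff_LD v hg)).integrable] at h
  linear_combination h

lemma fund_lemma {g : Hn n → ℂ} (hg : Continuous g) (h : ∀ χ, Tst χ → ∫ p, g p * χ p = 0) :
    ∀ p, g p = 0 := by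
  have h1 : g =ᵐ[volume] 0 := by
    apply ae_eq_zero_of_integral_contDiff_smul_eq_zero hg.locallyIntegrable
    intro φ hφ hc
    have := h (fun p => (φ p : ℂ)) ⟨Complex.ofRealCLM.contDiff.comp hφ,
      hc.comp_left (g := fun x : ℝ => (x : ℂ)) (by simp)⟩
    rw [← this]
    congr 1; funext p; simp [mul_comm]
  have := (hg.ae_eq_iff_eq volume continuous_zero).1 h1
  intro p; rw [this]; rfl

end IBP

/-- the sublaplacian in terms of LD -/
def LL {n : ℕ} (f : Hn n → ℂ) (p : Hn n) : ℂ :=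
  -(1/4) * ∑ j, (LD (eX n j) (LD (eX n j) f) p + LD (eY n j) (LD (eY n j) f) p)

lemma LH_zero_eq {n : ℕ} (f : Hn n → ℂ) : LH n 0 f = LL f := by
  funext p; simp [LH, LL, XH_eq, YH_eq]

lemma contDiff_LL {n : ℕ} {f : Hn n → ℂ} (hf : ContDiff ℝ ∞ f) : ContDiff ℝ ∞ (LL f) := by
  unfold LL
  refine contDiff_const.mul (ContDiff.sum fun j _ => ?_)
  exact (contDiff_LD _ (contDiff_LD _ hf)).add (contDiff_LD _ (contDiff_LD _ hf))

lemma Tst.LL {n : ℕ} {f : Hn n → ℂ} (hf : Tst f) : Tst (LL f) := by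
  unfold _root_.LL
  exact (Tst.sum _ fun j _ => ((hf.LD _).LD _).add ((hf.LD _).LD _)).const_mul _

lemma ibp2 {n : ℕ} {g χ : Hn n → ℂ} (hg : ContDiff ℝ ∞ g) (hχ : Tst χ) (u v : Hn n) :
    ∫ p, LD u (LD v g) p * χ p = ∫ p, g p * LD v (LD u χ) p := by
  rw [ibp (contDiff_LD v hg) hχ u, ibp hg (hχ.LD u) v, neg_neg]

lemma ibp_LL {n : ℕ} {g χ : Hn n → ℂ} (hg : ContDiff ℝ ∞ g) (hχ : Tst χ) :
    ∫ p, LL g p * χ p = ∫ p, g p * LL χ p := by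
  have hi : ∀ v, Integrable (fun p => LD v (LD v g) p * χ p) := fun v =>
    (hχ.mul_left (contDiff_LD v (contDiff_LD v hg))).integrable
  have hj : ∀ v, Integrable (fun p => g p * LD v (LD v χ) p) := fun v =>
    (((hχ.LD v).LD v).mul_left hg).integrable
  have e1 : ∀ p, LL g p * χ p = -(1/4) * ∑ j, (LD (eX n j) (LD (eX n j) g) p * χ p
      + LD (eY n j) (LD (eY n j) g) p * χ p) := by
    intro p; rw [LL, mul_assoc, Finset.sum_mul]; simp [add_mul]
  have e2 : ∀ p, g p * LL χ p = -(1/4) * ∑ j, (g p * LD (eX n j) (LD (eX n j) χ) p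
      + g p * LD (eY n j) (LD (eY n j) χ) p) := by
    intro p; rw [LL, mul_left_comm, Finset.mul_sum]; simp [mul_add]
  simp_rw [e1, e2]
  rw [integral_const_mul, integral_const_mul, integral_finsetSum, integral_finsetSum]
  · congr 1
    apply Finset.sum_congr rfl; intro j _
    rw [integral_add (hi _) (hi _), integral_add (hj _) (hj _), ibp2 hg hχ, ibp2 hg hχ]
  · intro j _; exact (hj _).add (hj _)
  · intro j _; exact (hi _).add (hi _)

def SmU {n : ℕ} (F : Sg n → ℂ) : Prop := ContDiffOn ℝ ∞ F {p : Sg n | 0 < p.2}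

lemma isOpen_U (n : ℕ) : IsOpen {p : Sg n | 0 < p.2} := isOpen_lt continuous_const continuous_snd

def LDS {n : ℕ} (v : Hn n) (F : Sg n → ℂ) (p : Sg n) : ℂ := fderiv ℝ F p (xi v p.1, 0)

lemma LDS_eq {n : ℕ} (v : Hn n) (F : Sg n → ℂ) (p : Sg n) :
    LDS v F p = fderiv ℝ F p (v, 0) + (cof v p.1 : ℂ) * fderiv ℝ F p (eT n, 0) := by
  have : ((xi v p.1, 0) : Sg n) = (v, 0) + cof v p.1 • (eT n, 0) := by
    simp [xi]
  rw [LDS, this, map_add, map_smul, Complex.real_smul]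

lemma XS_eq {n : ℕ} (j : Fin n) (F : Sg n → ℂ) : XS n j F = LDS (eX n j) F := by
  funext p; rw [LDS_eq, cof_eX]; simp [XS, dirD, eXS, eTS]
lemma YS_eq {n : ℕ} (j : Fin n) (F : Sg n → ℂ) : YS n j F = LDS (eY n j) F := by
  funext p; rw [LDS_eq, cof_eY]; simp [YS, dirD, eYS, eTS, sub_eq_add_neg]
lemma TS_eq {n : ℕ} (F : Sg n → ℂ) : TS n F = LDS (eT n) F := by
  funext p; rw [LDS_eq, cof_eT]; simp [TS, dirD, eTS]

section
variable {n : ℕ} {F : Sg n → ℂ}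

lemma SmU.contDiffAt (h : SmU F) {p : Sg n} (hp : 0 < p.2) : ContDiffAt ℝ ∞ F p :=
  ContDiffOn.contDiffAt h ((isOpen_U n).mem_nhds hp)
lemma SmU.differentiableAt (h : SmU F) {p : Sg n} (hp : 0 < p.2) : DifferentiableAt ℝ F p :=
  (h.contDiffAt hp).differentiableAt (by simp)

lemma SmU.fderiv_apply (h : SmU F) {V : Sg n → Sg n} (hV : ContDiff ℝ ∞ V) :
    SmU (fun p => fderiv ℝ F p (V p)) := by
  have h1 : ContDiffOn ℝ ∞ (fderiv ℝ F) {p : Sg n | 0 < p.2} :=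
    ContDiffOn.fderiv_of_isOpen h (isOpen_U n) (by simp)
  exact h1.clm_apply hV.contDiffOn

lemma SmU.LDS (h : SmU F) (v : Hn n) : SmU (LDS v F) := by
  apply h.fderiv_apply (V := fun p => (xi v p.1, 0))
  exact ((contDiff_xi v).comp contDiff_fst).prodMk contDiff_const
lemma SmU.DA (h : SmU F) : SmU (DA n F) := h.fderiv_apply (V := fun _ => eA n) contDiff_const
lemma SmU.add {G : Sg n → ℂ} (h : SmU F) (h' : SmU G) : SmU (fun p => F p + G p) := ContDiffOn.add h h'
lemma SmU.mul {G : Sg n → ℂ} (h : SmU F) (h' : SmU G) : SmU (fun p => F p * G p) := ContDiffOn.mul h h'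
lemma SmU.const (c : ℂ) : SmU (fun _ : Sg n => c) := contDiffOn_const
lemma SmU.const_mul (h : SmU F) (c : ℂ) : SmU (fun p => c * F p) := (SmU.const c).mul h

lemma SmU.slice (h : SmU F) {a : ℝ} (ha : 0 < a) : ContDiff ℝ ∞ (fun w : Hn n => F (w, a)) := by
  rw [contDiff_iff_contDiffAt]
  intro w
  exact (h.contDiffAt (p := (w, a)) ha).comp w (contDiffAt_id.prodMk contDiffAt_const)

lemma slice_LDS (h : SmU F) {a : ℝ} (ha : 0 < a) (v : Hn n) :
    (fun w : Hn n => LDS v F (w, a)) = LD v (fun w => F (w, a)) := by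
  funext w
  have h1 := (h.differentiableAt (p := (w, a)) ha).hasFDerivAt
  have h2 : HasFDerivAt (fun w : Hn n => (w, a)) (ContinuousLinearMap.inl ℝ (Hn n) ℝ) w := by
    exact hasFDerivAt_prodMk_left w a
  have h3 := (h1.comp w h2).fderiv
  have h4 : (fun w => F (w, a)) = F ∘ (fun w : Hn n => (w, a)) := rfl
  rw [h4, LD, h3]
  simp [LDS]

/-- pairing of a slice with a test function -/
def IF (F : Sg n → ℂ) (χ : Hn n → ℂ) (a : ℝ) : ℂ := ∫ w, F (w, a) * χ w

lemma IF_integrable (h : SmU F) {χ : Hn n → ℂ} (hχ : Tst χ) {a : ℝ} (ha : 0 < a) :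
    Integrable (fun w => F (w, a) * χ w) := (hχ.mul_left (h.slice ha)).integrable

lemma IF_LDS (h : SmU F) {χ : Hn n → ℂ} (hχ : Tst χ) {a : ℝ} (ha : 0 < a) (v : Hn n) :
    IF (LDS v F) χ a = - IF F (LD v χ) a := by
  unfold IF
  rw [← ibp (h.slice ha) hχ v, ← slice_LDS h ha v]

lemma IF_hasDerivAt (h : SmU F) {χ : Hn n → ℂ} (hχ : Tst χ) {a : ℝ} (ha : 0 < a) :
    HasDerivAt (IF F χ) (IF (DA n F) χ a) a := by
  have hD := h.DA
  have hK : IsCompact (tsupport χ ×ˢ Icc (a/2) (2*a)) := hχ.2.isCompact.prod isCompact_Icc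
  have hcont : ContinuousOn (DA n F) (tsupport χ ×ˢ Icc (a/2) (2*a)) := by
    apply (ContDiffOn.continuousOn hD).mono
    rintro ⟨w, b⟩ ⟨_, hb⟩
    simp only [mem_Icc, mem_ofPred_eq] at *
    linarith [hb.1]
  obtain ⟨C, hC⟩ := hK.exists_bound_of_continuousOn hcont
  have hs : Ioo (a/2) (2*a) ∈ 𝓝 a := Ioo_mem_nhds (by linarith) (by linarith)
  have := hasDerivAt_integral_of_dominated_loc_of_deriv_le (μ := (volume : Measure (Hn n)))
    (F := fun b w => F (w, b) * χ w) (F' := fun b w => DA n F (w, b) * χ w) (x₀ := a)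
    (bound := fun w => C * ‖χ w‖) hs ?_ (IF_integrable h hχ ha)
    (IF_integrable hD hχ ha).aestronglyMeasurable ?_ (hχ.integrable.norm.const_mul C) ?_
  · exact this.2
  · filter_upwards [hs] with b hb
    exact (IF_integrable h hχ (by linarith [hb.1])).aestronglyMeasurable
  · refine ae_of_all _ fun w b hb => ?_
    rw [norm_mul]
    by_cases hw : w ∈ tsupport χ
    · exact mul_le_mul_of_nonneg_right (hC (w, b) ⟨hw, ⟨hb.1.le, hb.2.le⟩⟩) (norm_nonneg _)
    · rw [image_eq_zero_of_notMem_tsupport hw]; simp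
  · refine ae_of_all _ fun w b hb => ?_
    have hb0 : 0 < b := by linarith [hb.1]
    have h1 := (h.differentiableAt (p := (w, b)) hb0).hasFDerivAt
    have h2 : HasDerivAt (fun b : ℝ => ((w, b) : Sg n)) (eA n) b :=
      (hasDerivAt_const b w).prodMk (hasDerivAt_id b)
    exact (h1.comp_hasDerivAt b h2).mul_const (χ w)

lemma weak_zero (h : SmU F) (h0 : ∀ χ, Tst χ → ∀ a, 0 < a → IF F χ a = 0) :
    ∀ p : Sg n, 0 < p.2 → F p = 0 := by
  rintro ⟨w, a⟩ ha
  exact fund_lemma (h.slice ha).continuous (fun χ hχ => h0 χ hχ a ha) w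

lemma IF_congr {G : Sg n → ℂ} (χ : Hn n → ℂ) {a : ℝ} (h : ∀ w, F (w, a) = G (w, a)) :
    IF F χ a = IF G χ a := by unfold IF; simp_rw [h]

lemma IF_add {G : Sg n → ℂ} (h : SmU F) (h' : SmU G) {χ : Hn n → ℂ} (hχ : Tst χ) {a : ℝ} (ha : 0 < a) :
    IF (fun p => F p + G p) χ a = IF F χ a + IF G χ a := by
  unfold IF
  rw [← integral_add (IF_integrable h hχ ha) (IF_integrable h' hχ ha)]
  congr 1; funext w; ring
lemma IF_const_mul (c : ℂ) (χ : Hn n → ℂ) (a : ℝ) :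
    IF (fun p => c * F p) χ a = c * IF F χ a := by
  unfold IF
  rw [← integral_const_mul]
  congr 1; funext w; ring

lemma IF_add_test (h : SmU F) {χ κ : Hn n → ℂ} (hχ : Tst χ) (hκ : Tst κ) {a : ℝ} (ha : 0 < a) :
    IF F (fun p => χ p + κ p) a = IF F χ a + IF F κ a := by
  unfold IF
  rw [← integral_add (IF_integrable h hχ ha) (IF_integrable h hκ ha)]
  congr 1; funext w; ring
lemma IF_const_mul_test (c : ℂ) (χ : Hn n → ℂ) (a : ℝ) :
    IF F (fun p => c * χ p) a = c * IF F χ a := by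
  unfold IF
  rw [← integral_const_mul]
  congr 1; funext w; ring

lemma slice_LS0 (h : SmU F) {a : ℝ} (ha : 0 < a) (w : Hn n) :
    LS0 n F (w, a) = LL (fun w => F (w, a)) w := by
  unfold LS0 LL
  congr 1
  apply Finset.sum_congr rfl; intro j _
  rw [XS_eq, XS_eq, YS_eq, YS_eq, ← slice_LDS h ha, ← slice_LDS h ha,
    ← slice_LDS (h.LDS _) ha, ← slice_LDS (h.LDS _) ha]

lemma IF_LS0 (h : SmU F) {χ : Hn n → ℂ} (hχ : Tst χ) {a : ℝ} (ha : 0 < a) :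
    ∫ w, LS0 n F (w, a) * χ w = IF F (LL χ) a := by
  simp_rw [slice_LS0 h ha]
  exact ibp_LL (h.slice ha) hχ

lemma IF_LDS2 (h : SmU F) {χ : Hn n → ℂ} (hχ : Tst χ) {a : ℝ} (ha : 0 < a) (u v : Hn n) :
    IF (LDS u (LDS v F)) χ a = IF F (LD v (LD u χ)) a := by
  rw [IF_LDS (h.LDS v) hχ ha, IF_LDS h (hχ.LD u) ha, neg_neg]

/-- the order of `∂_a` and `LDS v` is irrelevant -/
lemma IF_DA_LDS (h : SmU F) {χ : Hn n → ℂ} (hχ : Tst χ) {a : ℝ} (ha : 0 < a) (v : Hn n) :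
    IF (DA n (LDS v F)) χ a = - IF (DA n F) (LD v χ) a := by
  have h1 := IF_hasDerivAt (h.LDS v) hχ ha
  have h2 := (IF_hasDerivAt h (hχ.LD v) ha).neg
  refine h1.unique (h2.congr_of_eventuallyEq ?_)
  filter_upwards [lt_mem_nhds ha] with b hb
  rw [IF_LDS h hχ hb]; rfl

lemma weak_Lalpha {α : ℝ} (h : SmU F) (hF : ∀ p : Sg n, 0 < p.2 → Lalpha n α F p = 0)
    {χ : Hn n → ℂ} (hχ : Tst χ) {a : ℝ} (ha : 0 < a) :
    -(α : ℂ) * (a : ℂ) * (IF F (LL χ) a + (n : ℂ) * IF (DA n F) χ a)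
      + (a : ℂ) ^ 2 * (IF (DA n (DA n F)) χ a + IF F (LD (eT n) (LD (eT n) χ)) a) = 0 := by
  have hLS : SmU (fun p => LS0 n F p) := by
    unfold LS0
    simp_rw [XS_eq, YS_eq]
    refine ContDiffOn.mul contDiffOn_const (ContDiffOn.sum fun j _ => ?_)
    exact ((h.LDS _).LDS _).add ((h.LDS _).LDS _)
  have e1 : ∫ w, Lalpha n α F (w, a) * χ w = 0 := by
    have : ∀ w, Lalpha n α F (w, a) = 0 := fun w => hF _ ha
    simp [this]
  have e2 : ∀ w, Lalpha n α F (w, a) * χ w =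
      -(α : ℂ) * (a : ℂ) * (LS0 n F (w, a) * χ w + (n : ℂ) * (DA n F (w, a) * χ w))
      + (a : ℂ) ^ 2 * (DA n (DA n F) (w, a) * χ w + LDS (eT n) (LDS (eT n) F) (w, a) * χ w) := by
    intro w; unfold Lalpha; rw [TS_eq, TS_eq]; ring
  simp_rw [e2] at e1
  have i1 := IF_integrable hLS hχ ha
  have i2 := IF_integrable h.DA hχ ha
  have i3 := IF_integrable h.DA.DA hχ ha
  have i4 := IF_integrable ((h.LDS (eT n)).LDS (eT n)) hχ ha
  rw [integral_add (Integrable.const_mul (i1.fun_add (i2.const_mul (n:ℂ))) (-(α : ℂ) * (a : ℂ)) :)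
      (Integrable.const_mul (i3.fun_add i4) ((a : ℂ) ^ 2) :),
    integral_const_mul, integral_const_mul, integral_add i1 (i2.const_mul _),
    integral_add i3 i4, integral_const_mul, IF_LS0 h hχ ha] at e1
  have := IF_LDS2 h hχ ha (eT n) (eT n)
  rw [← this]
  exact e1

end

/-- complex combination of two left invariant fields on `Hn`. With `c = ±I`. -/
def ZC {n : ℕ} (c : ℂ) (j : Fin n) (f : Hn n → ℂ) (p : Hn n) : ℂ :=
  (1/2) * (LD (eX n j) f p + c * LD (eY n j) f p)

def ZCS {n : ℕ} (c : ℂ) (j : Fin n) (F : Sg n → ℂ) (p : Sg n) : ℂ :=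
  (1/2) * (LDS (eX n j) F p + c * LDS (eY n j) F p)

/-- `(1/2) (T + c ∂_a)`. -/
def NCS {n : ℕ} (c : ℂ) (F : Sg n → ℂ) (p : Sg n) : ℂ :=
  (1/2) * (LDS (eT n) F p + c * DA n F p)

section
variable {n : ℕ} {F : Sg n → ℂ}

lemma contDiff_ZC {f : Hn n → ℂ} (hf : ContDiff ℝ ∞ f) (c : ℂ) (j : Fin n) :
    ContDiff ℝ ∞ (ZC c j f) :=
  contDiff_const.mul ((contDiff_LD _ hf).add (contDiff_const.mul (contDiff_LD _ hf)))

lemma Tst.ZC {f : Hn n → ℂ} (hf : Tst f) (c : ℂ) (j : Fin n) : Tst (ZC c j f) :=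
  ((hf.LD _).add ((hf.LD _).const_mul c)).const_mul _

lemma SmU.ZCS (h : SmU F) (c : ℂ) (j : Fin n) : SmU (ZCS c j F) :=
  ((h.LDS _).add ((h.LDS _).const_mul c)).const_mul _

lemma SmU.NCS (h : SmU F) (c : ℂ) : SmU (NCS c F) :=
  ((h.LDS _).add (h.DA.const_mul c)).const_mul _

lemma IF_ZCS (h : SmU F) {χ : Hn n → ℂ} (hχ : Tst χ) {a : ℝ} (ha : 0 < a) (c : ℂ) (j : Fin n) :
    IF (ZCS c j F) χ a = - IF F (ZC c j χ) a := by
  unfold ZCS ZC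
  rw [IF_const_mul, IF_add (h.LDS _) ((h.LDS _).const_mul c) hχ ha, IF_const_mul,
    IF_LDS h hχ ha, IF_LDS h hχ ha, IF_const_mul_test,
    IF_add_test h (hχ.LD _) ((hχ.LD _).const_mul c) ha, IF_const_mul_test]
  ring

lemma IF_NCS (h : SmU F) {χ : Hn n → ℂ} (hχ : Tst χ) {a : ℝ} (ha : 0 < a) (c : ℂ) :
    IF (NCS c F) χ a = (1/2) * (- IF F (LD (eT n) χ) a + c * IF (DA n F) χ a) := by
  unfold NCS
  rw [IF_const_mul, IF_add (h.LDS _) (h.DA.const_mul c) hχ ha, IF_const_mul,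
    IF_LDS h hχ ha]

lemma IF_DA_ZCS (h : SmU F) {χ : Hn n → ℂ} (hχ : Tst χ) {a : ℝ} (ha : 0 < a) (c : ℂ) (j : Fin n) :
    IF (DA n (ZCS c j F)) χ a = - IF (DA n F) (ZC c j χ) a := by
  have h1 := IF_hasDerivAt (h.ZCS c j) hχ ha
  have h2 := (IF_hasDerivAt h (hχ.ZC c j) ha).neg
  refine h1.unique (h2.congr_of_eventuallyEq ?_)
  filter_upwards [lt_mem_nhds ha] with b hb
  rw [IF_ZCS h hχ hb]; rfl

lemma IF_DA_NCS (h : SmU F) {χ : Hn n → ℂ} (hχ : Tst χ) {a : ℝ} (ha : 0 < a) (c : ℂ) :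
    IF (DA n (NCS c F)) χ a = (1/2) * (- IF (DA n F) (LD (eT n) χ) a + c * IF (DA n (DA n F)) χ a) := by
  have h1 := IF_hasDerivAt (h.NCS c) hχ ha
  have h2 := ((IF_hasDerivAt h (hχ.LD (eT n)) ha).neg.add
    ((IF_hasDerivAt h.DA hχ ha).const_mul c)).const_mul (1/2)
  refine h1.unique (h2.congr_of_eventuallyEq ?_)
  filter_upwards [lt_mem_nhds ha] with b hb
  rw [IF_NCS h hχ hb]; rfl

lemma ZC_T_comm {f : Hn n → ℂ} (hf : ContDiff ℝ ∞ f) (c : ℂ) (j : Fin n) :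
    LD (eT n) (ZC c j f) = ZC c j (LD (eT n) f) := by
  funext p
  have hX := (contDiff_LD (eX n j) hf).differentiable (by simp)
  have hY := (contDiff_LD (eY n j) hf).differentiable (by simp)
  have e : ZC c j f = fun p => (1/2) * (LD (eX n j) f p + c * LD (eY n j) f p) := rfl
  rw [e, LD_const_mul (f := fun p => LD (eX n j) f p + c * LD (eY n j) f p) _
    ((hX p).fun_add ((hY p).const_mul c)), LD_add _ (hX p) ((hY p).const_mul c), LD_const_mul _ (hY p)]
  rw [LD_T_comm _ hf, LD_T_comm _ hf]; rfl

end

/-! ### the Siegel coordinates -/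

def PhiV {n : ℕ} (z : Vn n) : Sg n := ((z.1, z.2.re), z.2.im - ∑ j, ‖z.1 j‖ ^ 2)

section
variable {n : ℕ} {F : Sg n → ℂ}

lemma hasFDerivAt_PhiV (z : Vn n) : ∃ L : Vn n →L[ℝ] Sg n, HasFDerivAt (PhiV (n := n)) L z ∧
    ∀ v : Vn n, L v = ((v.1, v.2.re), v.2.im - ∑ j, 2 * (z.1 j * (starRingEnd ℂ) (v.1 j)).re) := by
  have h1 : HasFDerivAt (fun z : Vn n => z.1) (ContinuousLinearMap.fst ℝ (Fin n → ℂ) ℂ) z :=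
    hasFDerivAt_fst
  have h2 : HasFDerivAt (fun z : Vn n => z.2) (ContinuousLinearMap.snd ℝ (Fin n → ℂ) ℂ) z :=
    hasFDerivAt_snd
  have h3 : HasFDerivAt (fun z : Vn n => z.2.re) (Complex.reCLM ∘L ContinuousLinearMap.snd ℝ (Fin n → ℂ) ℂ) z :=
    Complex.reCLM.hasFDerivAt.comp z h2
  have h4 : HasFDerivAt (fun z : Vn n => z.2.im) (Complex.imCLM ∘L ContinuousLinearMap.snd ℝ (Fin n → ℂ) ℂ) z :=
    Complex.imCLM.hasFDerivAt.comp z h2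
  have h5 : ∀ j : Fin n, HasFDerivAt (fun z : Vn n => z.1 j)
      ((ContinuousLinearMap.proj (R := ℝ) (φ := fun _ : Fin n => ℂ) j) ∘L ContinuousLinearMap.fst ℝ (Fin n → ℂ) ℂ) z := fun j =>
    ((ContinuousLinearMap.proj (R := ℝ) (φ := fun _ : Fin n => ℂ) j).hasFDerivAt).comp z h1
  have h6 := fun j : Fin n => (h5 j).norm_sq
  have h7 := HasFDerivAt.fun_sum (u := Finset.univ) (fun j _ => h6 j)
  refine ⟨_, (h1.prodMk h3).prodMk (h4.sub h7), ?_⟩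
  intro v
  ext
  · simp
  · simp
  · simp [Complex.inner, sum_apply]
    apply Finset.sum_congr rfl; intro j _; ring

lemma PhiV_mem {z : Vn n} (hz : z ∈ Un n) : 0 < (PhiV z).2 := by
  have : ∑ j, ‖z.1 j‖ ^ 2 < z.2.im := hz
  simp only [PhiV]; linarith

lemma isOpen_Un : IsOpen (Un n) := by
  refine isOpen_lt ?_ (Complex.continuous_im.comp continuous_snd)
  fun_prop

lemma fderiv_Fu (h : SmU F) {z : Vn n} (hz : z ∈ Un n) (v : Vn n) :
    fderiv ℝ (Fu n F) z v = fderiv ℝ F (PhiV z)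
      ((v.1, v.2.re), v.2.im - ∑ j, 2 * (z.1 j * (starRingEnd ℂ) (v.1 j)).re) := by
  obtain ⟨L, hL, hv⟩ := hasFDerivAt_PhiV z
  have h1 := (h.differentiableAt (PhiV_mem hz)).hasFDerivAt.comp z hL
  have h2 : Fu n F = F ∘ PhiV := rfl
  rw [h2, h1.fderiv, ← hv]; rfl

/-- `dz` or `dzbar` -/
def dC (c : ℂ) (v : Vn n) (f : Vn n → ℂ) (p : Vn n) : ℂ :=
  (1/2) * (fderiv ℝ f p v + c * fderiv ℝ f p (Complex.I • v))

lemma dzV_eq (v : Vn n) (f : Vn n → ℂ) : dzV n v f = dC (-Complex.I) v f := by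
  funext p; simp [dzV, dC, sub_eq_add_neg]
lemma dzbarV_eq (v : Vn n) (f : Vn n → ℂ) : dzbarV n v f = dC Complex.I v f := by
  funext p; simp [dzbarV, dC]

lemma dC_last (h : SmU F) {z : Vn n} (hz : z ∈ Un n) (c : ℂ) :
    dC c (0, 1) (Fu n F) z = Fu n (NCS c F) z := by
  unfold dC
  rw [fderiv_Fu h hz, fderiv_Fu h hz]
  have : Fu n (NCS c F) z = NCS c F (PhiV z) := rfl
  rw [this, NCS, LDS_eq, cof_eT]
  simp [DA, dirD, eT, eA]
  left; rfl

lemma dir_split (L : Sg n →L[ℝ] ℂ) (v : Hn n) (r : ℝ) : L (v, r) = L (v, 0) + r * L (eA n) := by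
  have : ((v, r) : Sg n) = (v, 0) + r • eA n := by simp [eA]
  rw [this, map_add, map_smul, Complex.real_smul]

lemma dC_j (h : SmU F) {z : Vn n} (hz : z ∈ Un n) (c : ℂ) (hc : c * c = -1) (j : Fin n) :
    dC c (fun i => if i = j then (1:ℂ) else 0, 0) (Fu n F) z =
      Fu n (fun p => ZCS c j F p + 2 * c * ((p.1.1 j).re + c * (p.1.1 j).im) * NCS c F p) z := by
  unfold dC
  rw [fderiv_Fu h hz, fderiv_Fu h hz]
  have : ∀ G, Fu n G z = G (PhiV z) := fun G => rfl
  rw [this, NCS, ZCS, LDS_eq, LDS_eq, LDS_eq, cof_eT, cof_eX, cof_eY]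
  have e1 : ∑ i, 2 * (z.1 i * (starRingEnd ℂ) (if i = j then (1:ℂ) else 0)).re = 2 * (z.1 j).re := by
    rw [Finset.sum_eq_single j] <;> simp +contextual
  have e2 : ∑ i, 2 * (z.1 i * (starRingEnd ℂ) ((Complex.I • (fun i => if i = j then (1:ℂ) else 0)) i)).re
      = 2 * (z.1 j).im := by
    rw [Finset.sum_eq_single j] <;> simp +contextual
  simp only [Prod.smul_mk, smul_zero, Complex.zero_re, Complex.zero_im, e1, e2, zero_sub]
  have e3 : ((Complex.I • fun i => if i = j then (1:ℂ) else 0, (0:ℝ)) : Hn n) = eY n j := by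
    ext i <;> simp [eY]
  have e4 : ((fun i => if i = j then (1:ℂ) else 0, (0:ℝ)) : Hn n) = eX n j := rfl
  rw [e3, e4, dir_split, dir_split _ (eY n j)]
  have e5 : (PhiV z).1.1 = z.1 := rfl
  rw [e5]
  simp only [DA, dirD]
  push_cast
  linear_combination (-(z.1 j).re * fderiv ℝ F (PhiV z) (eA n) - (z.1 j).im * fderiv ℝ F (PhiV z) (eT n, 0) - c * (z.1 j).im * fderiv ℝ F (PhiV z) (eA n)) * hc

lemma dC_congr {f g : Vn n → ℂ} {z : Vn n} (h : f =ᶠ[𝓝 z] g) (c : ℂ) (v : Vn n) :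
    dC c v f z = dC c v g z := by
  unfold dC; rw [h.fderiv_eq]

/-- the representation of `dC` at a general basis vector -/
def OpC (c : ℂ) (k : Fin (n+1)) (F : Sg n → ℂ) : Sg n → ℂ :=
  if h : (k : ℕ) < n then
    fun p => ZCS c ⟨k, h⟩ F p + 2 * c * ((p.1.1 ⟨k, h⟩).re + c * (p.1.1 ⟨k, h⟩).im) * NCS c F p
  else NCS c F

lemma SmU.coord (c d : ℂ) (j : Fin n) :
    SmU (fun p : Sg n => d * ((p.1.1 j).re + c * (p.1.1 j).im)) := by
  have h1 : ContDiff ℝ ∞ (fun p : Sg n => p.1.1 j) :=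
    (ContinuousLinearMap.proj (R := ℝ) (φ := fun _ : Fin n => ℂ) j).contDiff.comp
      (contDiff_fst.comp contDiff_fst)
  have h2 : ContDiff ℝ ∞ (fun p : Sg n => ((p.1.1 j).re : ℂ)) :=
    (Complex.ofRealCLM.comp Complex.reCLM).contDiff.comp h1
  have h3 : ContDiff ℝ ∞ (fun p : Sg n => ((p.1.1 j).im : ℂ)) :=
    (Complex.ofRealCLM.comp Complex.imCLM).contDiff.comp h1
  exact (contDiff_const.mul (h2.add (contDiff_const.mul h3))).contDiffOn

lemma SmU.OpC (h : SmU F) (c : ℂ) (k : Fin (n+1)) : SmU (OpC c k F) := by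
  unfold _root_.OpC
  split_ifs with hk
  · exact (h.ZCS _ _).add ((SmU.coord _ _ _).mul (h.NCS _))
  · exact h.NCS _

lemma dC_basis (h : SmU F) {z : Vn n} (hz : z ∈ Un n) (c : ℂ) (hc : c * c = -1) (k : Fin (n+1)) :
    dC c (basisV n k) (Fu n F) z = Fu n (OpC c k F) z := by
  unfold basisV OpC
  split_ifs with hk
  · rw [← dC_j h hz c hc ⟨k, hk⟩]
    congr 3
    funext i; congr 1; rw [Fin.ext_iff]
  · exact dC_last h hz c

lemma pluri_iff (h : SmU F) : IsPluriharmonic n F ↔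
    ∀ j k : Fin (n+1), ∀ p : Sg n, 0 < p.2 → OpC (-Complex.I) k (OpC Complex.I j F) p = 0 := by
  have key : ∀ z ∈ Un n, ∀ j k : Fin (n+1), dzV n (basisV n k) (dzbarV n (basisV n j) (Fu n F)) z
      = OpC (-Complex.I) k (OpC Complex.I j F) (PhiV z) := by
    intro z hz j k
    rw [dzV_eq, dzbarV_eq]
    have : dC Complex.I (basisV n j) (Fu n F) =ᶠ[𝓝 z] Fu n (OpC Complex.I j F) := by
      filter_upwards [isOpen_Un.mem_nhds hz] with y hy
      exact dC_basis h hy _ (by simp) j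
    rw [dC_congr this, dC_basis (h.OpC _ _) hz _ (by simp)]; rfl
  constructor
  · intro hp j k p hp0
    have hz : ((p.1.1, (⟨p.1.2, p.2 + ∑ j, ‖p.1.1 j‖^2⟩ : ℂ)) : Vn n) ∈ Un n := by
      simp only [Un, mem_ofPred_eq]; linarith
    have := hp _ hz j k
    rw [key _ hz] at this
    convert this using 1
    simp [PhiV]
  · intro hp z hz j k
    rw [key z hz]
    exact hp j k _ (PhiV_mem hz)

end

section
variable {n : ℕ} {F : Sg n → ℂ}

lemma fderiv_add_coord {A C : Sg n → ℂ} {p : Sg n} (hA : DifferentiableAt ℝ A p)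
    (hC : DifferentiableAt ℝ C p) (j : Fin n) (V : Sg n) :
    fderiv ℝ (fun p : Sg n => A p + 2 * Complex.I * ((p.1.1 j).re + Complex.I * (p.1.1 j).im) * C p) p V
      = fderiv ℝ A p V + 2 * Complex.I * p.1.1 j * fderiv ℝ C p V
        + 2 * Complex.I * V.1.1 j * C p := by
  have e : (fun p : Sg n => A p + 2 * Complex.I * ((p.1.1 j).re + Complex.I * (p.1.1 j).im) * C p)
      = fun p => A p + 2 * Complex.I * (p.1.1 j) * C p := by
    funext p; rw [mul_comm Complex.I ((p.1.1 j).im : ℂ), Complex.re_add_im]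
  rw [e]
  let M : Sg n →L[ℝ] ℂ := (ContinuousLinearMap.proj (R := ℝ) (φ := fun _ : Fin n => ℂ) j) ∘L
    ContinuousLinearMap.fst ℝ (Fin n → ℂ) ℝ ∘L ContinuousLinearMap.fst ℝ (Hn n) ℝ
  have hM : HasFDerivAt (fun p : Sg n => p.1.1 j) M p := M.hasFDerivAt
  have h := hA.hasFDerivAt.fun_add ((hM.const_mul (2 * Complex.I)).fun_mul hC.hasFDerivAt)
  rw [h.fderiv]
  simp [M]; ring

lemma ZCS_coord {A C : Sg n → ℂ} {p : Sg n} (hA : DifferentiableAt ℝ A p)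
    (hC : DifferentiableAt ℝ C p) (j k : Fin n) :
    ZCS (-Complex.I) k (fun p : Sg n => A p + 2 * Complex.I * ((p.1.1 j).re + Complex.I * (p.1.1 j).im) * C p) p
      = ZCS (-Complex.I) k A p + 2 * Complex.I * p.1.1 j * ZCS (-Complex.I) k C p
        + (if j = k then 2 * Complex.I * C p else 0) := by
  have hI : Complex.I * Complex.I = -1 := by simp
  simp only [ZCS, LDS, fderiv_add_coord hA hC]
  have e1 : (xi (eX n k) p.1).1 j = if j = k then 1 else 0 := by simp [xi, eX, eT]
  have e2 : (xi (eY n k) p.1).1 j = if j = k then Complex.I else 0 := by simp [xi, eY, eT]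
  rw [e1, e2]
  split_ifs with hjk
  · linear_combination (-Complex.I * C p) * hI
  · ring

lemma NCS_coord {A C : Sg n → ℂ} {p : Sg n} (hA : DifferentiableAt ℝ A p)
    (hC : DifferentiableAt ℝ C p) (j : Fin n) (c : ℂ) :
    NCS c (fun p : Sg n => A p + 2 * Complex.I * ((p.1.1 j).re + Complex.I * (p.1.1 j).im) * C p) p
      = NCS c A p + 2 * Complex.I * p.1.1 j * NCS c C p := by
  simp only [NCS, LDS, DA, dirD, fderiv_add_coord hA hC]
  have e1 : (xi (eT n) p.1).1 j = 0 := by simp [xi, eT]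
  have e2 : (eA n).1.1 j = 0 := by simp [eA]
  rw [e1, e2]
  ring

lemma pluri_of_H (h : SmU F)
    (H1 : ∀ p : Sg n, 0 < p.2 → NCS (-Complex.I) (NCS Complex.I F) p = 0)
    (H2 : ∀ j, ∀ p : Sg n, 0 < p.2 → NCS (-Complex.I) (ZCS Complex.I j F) p = 0)
    (H3 : ∀ k, ∀ p : Sg n, 0 < p.2 → ZCS (-Complex.I) k (NCS Complex.I F) p = 0)
    (H4 : ∀ j k, ∀ p : Sg n, 0 < p.2 → ZCS (-Complex.I) k (ZCS Complex.I j F) p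
      + (if j = k then 2 * Complex.I * NCS Complex.I F p else 0) = 0) :
    IsPluriharmonic n F := by
  rw [pluri_iff h]
  intro j k p hp
  have hN := (h.NCS Complex.I).differentiableAt hp
  unfold OpC
  split_ifs with hk hj hj
  · have hZ := (h.ZCS Complex.I ⟨j, hj⟩).differentiableAt hp
    beta_reduce
    rw [ZCS_coord hZ hN, NCS_coord hZ hN, H2 _ p hp, H3 _ p hp, H1 p hp]
    linear_combination H4 ⟨j, hj⟩ ⟨k, hk⟩ p hp
  · beta_reduce
    rw [H3 _ p hp, H1 p hp]; simp
  · have hZ := (h.ZCS Complex.I ⟨j, hj⟩).differentiableAt hp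
    rw [NCS_coord hZ hN, H2 _ p hp, H1 p hp]; simp
  · exact H1 p hp

/-- weak form of pluriharmonicity suffices -/
lemma pluri_of_weak (h : SmU F)
    (W1 : ∀ χ, Tst χ → ∀ a, 0 < a → IF (DA n (DA n F)) χ a + IF F (LD (eT n) (LD (eT n) χ)) a = 0)
    (W2 : ∀ χ, Tst χ → ∀ a, 0 < a → ∀ j, IF F (LD (eT n) (ZC Complex.I j χ)) a
      + Complex.I * IF (DA n F) (ZC Complex.I j χ) a = 0)
    (W3 : ∀ χ, Tst χ → ∀ a, 0 < a → ∀ k, IF F (LD (eT n) (ZC (-Complex.I) k χ)) a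
      - Complex.I * IF (DA n F) (ZC (-Complex.I) k χ) a = 0)
    (W4 : ∀ χ, Tst χ → ∀ a, 0 < a → ∀ j k, IF F (ZC Complex.I j (ZC (-Complex.I) k χ)) a =
      if j = k then Complex.I * IF F (LD (eT n) χ) a + IF (DA n F) χ a else 0) :
    IsPluriharmonic n F := by
  have hI : Complex.I * Complex.I = -1 := by simp
  apply pluri_of_H h
  · apply weak_zero ((h.NCS _).NCS _)
    intro χ hχ a ha
    rw [IF_NCS (h.NCS _) hχ ha, IF_NCS h (hχ.LD _) ha, IF_DA_NCS h hχ ha]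
    linear_combination (1/4) * W1 χ hχ a ha - (1/4) * (IF (DA n (DA n F)) χ a) * hI
  · intro j
    apply weak_zero ((h.ZCS _ _).NCS _)
    intro χ hχ a ha
    rw [IF_NCS (h.ZCS _ _) hχ ha, IF_ZCS h (hχ.LD _) ha, IF_DA_ZCS h hχ ha]
    have := W2 χ hχ a ha j
    rw [ZC_T_comm hχ.1] at this
    linear_combination (1/2) * this
  · intro k
    apply weak_zero ((h.NCS _).ZCS _ _)
    intro χ hχ a ha
    rw [IF_ZCS (h.NCS _) hχ ha, IF_NCS h (hχ.ZC _ _) ha]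
    linear_combination (1/2) * W3 χ hχ a ha k
  · intro j k
    split_ifs with hjk
    · apply weak_zero (((h.ZCS _ _).ZCS _ _).add ((h.NCS _).const_mul _))
      intro χ hχ a ha
      rw [IF_add ((h.ZCS _ _).ZCS _ _) ((h.NCS _).const_mul _) hχ ha, IF_const_mul,
        IF_ZCS (h.ZCS _ _) hχ ha, IF_ZCS h (hχ.ZC _ _) ha, IF_NCS h hχ ha]
      have := W4 χ hχ a ha j k
      rw [if_pos hjk] at this
      linear_combination this + (IF (DA n F) χ a) * hI
    · simp only [add_zero]
      apply weak_zero ((h.ZCS _ _).ZCS _ _)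
      intro χ hχ a ha
      rw [IF_ZCS (h.ZCS _ _) hχ ha, IF_ZCS h (hχ.ZC _ _) ha]
      have := W4 χ hχ a ha j k
      rw [if_neg hjk] at this
      linear_combination this

/-- consequence of pluriharmonicity used in the direct implication -/
lemma pluri_weak1 (h : SmU F) (hp : IsPluriharmonic n F) {χ : Hn n → ℂ} (hχ : Tst χ) {a : ℝ}
    (ha : 0 < a) : IF (DA n (DA n F)) χ a + IF F (LD (eT n) (LD (eT n) χ)) a = 0 := by
  rw [pluri_iff h] at hp
  have h1 := hp (Fin.last n) (Fin.last n)
  have hI : Complex.I * Complex.I = -1 := by simp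
  simp only [OpC, Fin.val_last, lt_irrefl, dite_false] at h1
  have h2 : IF (NCS (-Complex.I) (NCS Complex.I F)) χ a = 0 := by
    unfold IF
    have : ∀ w, NCS (-Complex.I) (NCS Complex.I F) (w, a) = 0 := fun w => h1 _ ha
    simp [this]
  rw [IF_NCS (h.NCS _) hχ ha, IF_NCS h (hχ.LD _) ha, IF_DA_NCS h hχ ha] at h2
  linear_combination 4 * h2 + (IF (DA n (DA n F)) χ a) * hI

lemma direct {α : ℝ} (hα : 0 < α) (h : SmU F) (hF : ∀ p : Sg n, 0 < p.2 → Lalpha n α F p = 0)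
    {f : Hn n → ℂ} (hf : ContDiff ℝ ∞ f) (hbv : IsBoundaryValue n F f) (hp : IsPluriharmonic n F) :
    ∀ w : Hn n, LH n 0 (LH n 0 f) w + (n : ℂ) ^ 2 * TH n (TH n f) w = 0 := by
  have A : ∀ χ, Tst χ → ∀ a, 0 < a → IF F (LL χ) a + (n : ℂ) * IF (DA n F) χ a = 0 := by
    intro χ hχ a ha
    have h1 := weak_Lalpha h hF hχ ha
    rw [pluri_weak1 h hp hχ ha] at h1
    have hne : -(α : ℂ) * (a : ℂ) ≠ 0 := by
      have : (α : ℂ) ≠ 0 := by exact_mod_cast hα.ne'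
      have : (a : ℂ) ≠ 0 := by exact_mod_cast ha.ne'
      simp [*]
    rw [mul_zero, add_zero] at h1
    exact (mul_eq_zero.1 h1).resolve_left hne
  have B : ∀ χ, Tst χ → ∀ a, 0 < a →
      IF F (fun p => LL (LL χ) p + (n : ℂ)^2 * LD (eT n) (LD (eT n) χ) p) a = 0 := by
    intro χ hχ a ha
    rw [IF_add_test h hχ.LL.LL (((hχ.LD _).LD _).const_mul _) ha, IF_const_mul_test]
    have h1 := A _ hχ.LL a ha
    have h2 : IF (DA n F) (LL χ) a + (n : ℂ) * IF (DA n (DA n F)) χ a = 0 := by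
      have d1 := (IF_hasDerivAt h hχ.LL ha).add ((IF_hasDerivAt h.DA hχ ha).const_mul (n : ℂ))
      refine d1.unique ((hasDerivAt_const a (0:ℂ)).congr_of_eventuallyEq ?_)
      filter_upwards [lt_mem_nhds ha] with b hb
      exact A χ hχ b hb
    have h3 := pluri_weak1 h hp hχ ha
    linear_combination h1 - n * h2 + n^2 * h3
  rw [LH_zero_eq, LH_zero_eq, TH_eq, TH_eq]
  apply fund_lemma (g := fun w => LL (LL f) w + (n : ℂ) ^ 2 * LD (eT n) (LD (eT n) f) w)
  · exact ((contDiff_LL (contDiff_LL hf)).add (contDiff_const.mul (contDiff_LD _ (contDiff_LD _ hf)))).continuous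
  · intro χ hχ
    have e1 : ∀ w, (LL (LL f) w + (n : ℂ) ^ 2 * LD (eT n) (LD (eT n) f) w) * χ w
        = LL (LL f) w * χ w + (n : ℂ) ^ 2 * (LD (eT n) (LD (eT n) f) w * χ w) := by intro w; ring
    simp_rw [e1]
    have i1 := (hχ.mul_left (contDiff_LL (contDiff_LL hf))).integrable
    have i2 := (hχ.mul_left (contDiff_LD (eT n) (contDiff_LD (eT n) hf))).integrable
    rw [integral_add i1 (i2.const_mul _), integral_const_mul, ibp_LL (contDiff_LL hf) hχ,
      ibp_LL hf hχ.LL, ibp2 hf hχ]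
    have j1 := (hχ.LL.LL.mul_left hf).integrable
    have j2 := (((hχ.LD (eT n)).LD (eT n)).mul_left hf).integrable
    rw [← integral_const_mul, ← integral_add j1 (j2.const_mul _)]
    have hT := (hχ.LL.LL).add (((hχ.LD (eT n)).LD (eT n)).const_mul ((n:ℂ)^2))
    have lim := hbv _ hT.integrable
    have lim0 : Tendsto (fun a : ℝ => ∫ w : Hn n, F (w, a) * (LL (LL χ) w + (n : ℂ)^2 * LD (eT n) (LD (eT n) χ) w))
        (𝓝[>] 0) (𝓝 0) := by
      apply tendsto_const_nhds.congr'
      filter_upwards [self_mem_nhdsWithin] with a ha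
      exact (B χ hχ a ha).symm
    rw [← tendsto_nhds_unique lim lim0]
    congr 1; funext w; ring

end

/-! ### one-dimensional kernels -/

def qk (e : ℂ) (a s : ℝ) : ℂ := ((a : ℂ) + e * s)⁻¹

def EI (e : ℂ) : Prop := e = Complex.I ∨ e = -Complex.I
lemma EI_I : EI Complex.I := Or.inl rfl
lemma EI_negI : EI (-Complex.I) := Or.inr rfl

section
variable {e : ℂ}

lemma EI.normSq (he : EI e) (a s : ℝ) : Complex.normSq ((a : ℂ) + e * s) = a^2 + s^2 := by
  rcases he with rfl | rfl <;> simp [Complex.normSq_apply] <;> ring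

lemma EI.ne (he : EI e) {a : ℝ} (ha : 0 < a) (s : ℝ) : (a : ℂ) + e * s ≠ 0 := by
  rw [← Complex.normSq_pos, he.normSq]; positivity

lemma EI.sq (he : EI e) : e * e = -1 := by
  rcases he with rfl | rfl <;> simp

lemma norm_qk_sq (he : EI e) (a s : ℝ) : ‖qk e a s‖ ^ 2 = (a^2 + s^2)⁻¹ := by
  rw [qk, norm_inv, inv_pow, ← Complex.normSq_eq_norm_sq, he.normSq]

lemma norm_qk_le (he : EI e) {a : ℝ} (ha : 0 < a) (s : ℝ) : ‖qk e a s‖ ≤ a⁻¹ := by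
  have h := norm_qk_sq he a s
  apply le_of_sq_le_sq _ (by positivity)
  rw [h, inv_pow]
  exact inv_anti₀ (by positivity) (by nlinarith)

lemma norm_qk_pow_le (he : EI e) {a b : ℝ} (hb : 0 < b) (hab : b ≤ a) (s : ℝ) (m : ℕ) :
    ‖qk e a s ^ (m + 2)‖ ≤ (b⁻¹)^m * (b^2 + s^2)⁻¹ := by
  have ha : 0 < a := hb.trans_le hab
  rw [pow_add, norm_mul, norm_pow, norm_pow, norm_qk_sq he]
  apply mul_le_mul
  · exact pow_le_pow_left₀ (norm_nonneg _) ((norm_qk_le he ha s).trans (inv_anti₀ hb hab)) _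
  · exact inv_anti₀ (by positivity) (by nlinarith)
  · positivity
  · positivity

lemma continuous_qk (he : EI e) {a : ℝ} (ha : 0 < a) : Continuous (qk e a) := by
  unfold qk
  apply Continuous.inv₀ (by fun_prop) (fun s => he.ne ha s)

lemma inv_sq_eq {b : ℝ} (hb : 0 < b) (s : ℝ) :
    (b^2 + s^2)⁻¹ = b⁻¹^2 * (1 + (b⁻¹ * s)^2)⁻¹ := by
  field_simp

lemma integrable_inv_sq {b : ℝ} (hb : 0 < b) : Integrable (fun s : ℝ => (b^2 + s^2)⁻¹) := by
  simp_rw [inv_sq_eq hb]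
  exact (integrable_inv_one_add_sq.comp_mul_left' (R := b⁻¹) (by positivity)).const_mul _

lemma integral_inv_sq {b : ℝ} (hb : 0 < b) : ∫ s : ℝ, (b^2 + s^2)⁻¹ = Real.pi / b := by
  simp_rw [inv_sq_eq hb]
  rw [integral_const_mul, Measure.integral_comp_mul_left (fun u : ℝ => (1 + u^2)⁻¹) b⁻¹,
    integral_univ_inv_one_add_sq]
  simp [abs_of_pos hb]; field_simp

/-- bounded continuous functions of one variable -/
structure BC (c : ℝ → ℂ) (C : ℝ) : Prop where
  cont : Continuous c
  bd : ∀ s, ‖c s‖ ≤ C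

lemma BC.nonneg {c : ℝ → ℂ} {C : ℝ} (h : BC c C) : 0 ≤ C := (norm_nonneg _).trans (h.bd 0)

def gam (m : ℕ) (e : ℂ) (c : ℝ → ℂ) (a : ℝ) : ℂ := ∫ s : ℝ, qk e a s ^ (m + 2) * c s

variable {c : ℝ → ℂ} {C : ℝ}

lemma norm_gam_integrand_le (he : EI e) (hc : BC c C) {a b : ℝ} (hb : 0 < b) (hab : b ≤ a) (m : ℕ) (s : ℝ) :
    ‖qk e a s ^ (m + 2) * c s‖ ≤ (b⁻¹)^m * C * (b^2 + s^2)⁻¹ := by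
  rw [norm_mul]
  calc _ ≤ ((b⁻¹)^m * (b^2 + s^2)⁻¹) * C :=
        mul_le_mul (norm_qk_pow_le he hb hab s m) (hc.bd s) (norm_nonneg _) (by positivity)
    _ = _ := by ring

lemma integrable_gam (he : EI e) (hc : BC c C) {a : ℝ} (ha : 0 < a) (m : ℕ) :
    Integrable (fun s : ℝ => qk e a s ^ (m + 2) * c s) := by
  refine ((integrable_inv_sq ha).const_mul ((a⁻¹)^m * C)).mono'
    (((continuous_qk he ha).pow _).mul hc.cont).aestronglyMeasurable ?_
  exact ae_of_all _ fun s => norm_gam_integrand_le he hc ha le_rfl m s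

lemma integrable_gam0 (he : EI e) (hc : BC c C) {a : ℝ} (ha : 0 < a) :
    Integrable (fun s : ℝ => qk e a s ^ 2 * c s) := by
  have := integrable_gam he hc ha 0
  rwa [zero_add] at this

lemma gam_zero (e : ℂ) (c : ℝ → ℂ) (a : ℝ) : gam 0 e c a = ∫ s : ℝ, qk e a s ^ 2 * c s := by
  rw [gam, zero_add]

lemma norm_gam0_integrand_le (he : EI e) (hc : BC c C) {a b : ℝ} (hb : 0 < b) (hab : b ≤ a) (s : ℝ) :
    ‖qk e a s ^ 2 * c s‖ ≤ C * (b^2 + s^2)⁻¹ := by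
  have := norm_gam_integrand_le he hc hb hab 0 s
  rwa [zero_add, pow_zero, one_mul] at this

lemma norm_gam_le (he : EI e) (hc : BC c C) {a : ℝ} (ha : 0 < a) (m : ℕ) :
    ‖gam m e c a‖ ≤ C * Real.pi * (a⁻¹)^(m+1) := by
  unfold gam
  refine (norm_integral_le_of_norm_le ((integrable_inv_sq ha).const_mul ((a⁻¹)^m * C))
    (ae_of_all _ fun s => norm_gam_integrand_le he hc ha le_rfl m s)).trans ?_
  rw [integral_const_mul, integral_inv_sq ha]
  apply le_of_eq; rw [pow_succ]; field_simp

lemma hasDerivAt_qk (he : EI e) {a : ℝ} (ha : 0 < a) (s : ℝ) :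
    HasDerivAt (fun a => qk e a s) (- qk e a s ^ 2) a := by
  have h1 : HasDerivAt (fun a : ℝ => (a : ℂ) + e * s) 1 a :=
    (Complex.ofRealCLM.hasDerivAt (x := a)).add_const _
  have := h1.fun_inv (he.ne ha s)
  refine this.congr_deriv ?_
  unfold qk; field_simp

lemma hasDerivAt_qk_s (he : EI e) {a : ℝ} (ha : 0 < a) (s : ℝ) :
    HasDerivAt (fun s => qk e a s) (- e * qk e a s ^ 2) s := by
  have h1 : HasDerivAt (fun s : ℝ => (a : ℂ) + e * s) (e * 1) s :=
    ((Complex.ofRealCLM.hasDerivAt (x := s)).const_mul e).const_add _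
  have := h1.fun_inv (he.ne ha s)
  refine this.congr_deriv ?_
  unfold qk; field_simp

lemma hasDerivAt_gam (he : EI e) (hc : BC c C) {a : ℝ} (ha : 0 < a) (m : ℕ) :
    HasDerivAt (gam m e c) (-((m:ℂ)+2) * gam (m+1) e c a) a := by
  have hs : Ioo (a/2) (2*a) ∈ 𝓝 a := Ioo_mem_nhds (by linarith) (by linarith)
  have ha2 : 0 < a/2 := by linarith
  have := hasDerivAt_integral_of_dominated_loc_of_deriv_le (μ := (volume : Measure ℝ))
    (F := fun b s => qk e b s ^ (m + 2) * c s)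
    (F' := fun b s => -((m:ℂ)+2) * (qk e b s ^ (m + 1 + 2) * c s)) (x₀ := a)
    (bound := fun s => ((m:ℝ)+2) * (((a/2)⁻¹)^(m+1) * C * ((a/2)^2 + s^2)⁻¹)) hs ?_
    (integrable_gam he hc ha m) ((integrable_gam he hc ha (m+1)).const_mul _).aestronglyMeasurable ?_
    (((integrable_inv_sq ha2).const_mul _).const_mul _) ?_
  · have h2 := this.2
    rw [integral_const_mul] at h2
    exact h2
  · filter_upwards [hs] with b hb
    exact (integrable_gam he hc (by linarith [hb.1]) m).aestronglyMeasurable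
  · refine ae_of_all _ fun s b hb => ?_
    rw [norm_mul]
    have h1 : ‖-((m:ℂ)+2)‖ = (m:ℝ)+2 := by
      rw [norm_neg]
      have : ((m:ℂ)+2) = (((m:ℝ)+2 : ℝ) : ℂ) := by push_cast; ring
      rw [this, Complex.norm_real, Real.norm_of_nonneg (by positivity)]
    rw [h1]
    exact mul_le_mul_of_nonneg_left (norm_gam_integrand_le he hc ha2 hb.1.le (m+1) s) (by positivity)
  · refine ae_of_all _ fun s b hb => ?_
    have hb0 : 0 < b := by linarith [hb.1]
    have h1 := ((hasDerivAt_qk he hb0 s).fun_pow (m+2)).mul_const (c s)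
    refine h1.congr_deriv ?_
    rw [show m + 2 - 1 = m + 1 by omega]
    push_cast
    ring

lemma gam_descend (he : EI e) (hc : BC c C) (m : ℕ)
    (h : ∀ a, 0 < a → gam (m+1) e c a = 0) : ∀ a, 0 < a → gam m e c a = 0 := by
  have hd : ∀ a ∈ Ioi (0:ℝ), HasDerivAt (gam m e c) 0 a := by
    intro a ha
    have := hasDerivAt_gam he hc ha m
    rwa [h a ha, mul_zero] at this
  have hconst : ∀ a ∈ Ioi (0:ℝ), ∀ b ∈ Ioi (0:ℝ), gam m e c a = gam m e c b := by
    intro a ha b hb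
    apply (convex_Ioi (0:ℝ)).is_const_of_fderivWithin_eq_zero (𝕜 := ℝ) (f := gam m e c) _ _ ha hb
    · intro x hx; exact (hd x hx).differentiableAt.differentiableWithinAt
    · intro x hx
      have := (hd x hx).hasFDerivAt.hasFDerivWithinAt (s := Ioi 0)
      rw [this.fderivWithin (isOpen_Ioi.uniqueDiffWithinAt hx)]
      ext; simp
  intro a ha
  have lim : Tendsto (gam m e c) atTop (𝓝 0) := by
    apply squeeze_zero_norm' (a := fun a => C * Real.pi * (a⁻¹)^(m+1))
    · filter_upwards [eventually_gt_atTop 0] with b hb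
      exact norm_gam_le he hc hb m
    · have := (tendsto_inv_atTop_zero (𝕜 := ℝ)).pow (m+1)
      simpa using this.const_mul (C * Real.pi)
  have lim2 : Tendsto (gam m e c) atTop (𝓝 (gam m e c a)) := by
    apply tendsto_const_nhds.congr'
    filter_upwards [eventually_gt_atTop 0] with b hb
    exact hconst a ha b hb
  exact tendsto_nhds_unique lim2 lim

lemma gam_descend_all (he : EI e) (hc : BC c C) (m : ℕ)
    (h : ∀ a, 0 < a → gam m e c a = 0) : ∀ a, 0 < a → gam 0 e c a = 0 := by
  induction m with
  | zero => exact h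
  | succ m ih => exact ih (gam_descend he hc m h)

lemma gam_deriv (he : EI e) (hc : BC c C) {c' : ℝ → ℂ} {C' : ℝ} (hc' : BC c' C')
    (hd : ∀ s, HasDerivAt c (c' s) s) {a : ℝ} (ha : 0 < a) :
    gam 0 e c' a = 2 * e * gam 1 e c a := by
  have h := integral_mul_deriv_eq_deriv_mul_of_integrable (u := fun s => qk e a s ^ 2) (v := c)
    (u' := fun s => -2 * e * qk e a s ^ 3) (v' := c') ?_ (fun s _ => hd s) (integrable_gam0 he hc' ha) ?_
    (integrable_gam0 he hc ha)
  · rw [gam_zero, gam]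
    rw [h, ← integral_const_mul, ← integral_neg]
    congr 1; funext s; ring
  · intro s _
    have := (hasDerivAt_qk_s he ha s).fun_pow 2
    refine this.congr_deriv ?_
    simp; ring
  · have := (integrable_gam he hc ha 1).const_mul (-2 * e)
    refine this.congr (ae_of_all _ fun s => ?_)
    simp; ring

/-- Poisson kernel -/
def pk (a s : ℝ) : ℂ := qk Complex.I a s + qk (-Complex.I) a s

lemma pk_eq {a : ℝ} (ha : 0 < a) (s : ℝ) : pk a s = ((2 * a * (a^2 + s^2)⁻¹ : ℝ) : ℂ) := by
  have h1 := EI_I.ne ha s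
  have h2 := EI_negI.ne ha s
  have h3 : ((a:ℂ)^2 + (s:ℂ)^2) ≠ 0 := by
    have : a^2 + s^2 ≠ 0 := by positivity
    exact_mod_cast this
  unfold pk qk
  push_cast
  have h4 : ((a:ℂ) + Complex.I * s) * (a + -Complex.I * s) = a^2 + s^2 := by
    linear_combination (-(s:ℂ)^2) * Complex.I_sq
  rw [inv_add_inv h1 h2, h4, div_eq_mul_inv]
  ring

lemma norm_pk {a : ℝ} (ha : 0 < a) (s : ℝ) : ‖pk a s‖ = 2 * a * (a^2 + s^2)⁻¹ := by
  rw [pk_eq ha, Complex.norm_real, Real.norm_of_nonneg (by positivity)]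

def PI (c : ℝ → ℂ) (a : ℝ) : ℂ := (1 / (2 * Real.pi)) * ∫ s : ℝ, pk a s * c s

lemma continuous_pk {a : ℝ} (ha : 0 < a) : Continuous (pk a) :=
  (continuous_qk EI_I ha).add (continuous_qk EI_negI ha)

lemma norm_pk_mul_le (hc : BC c C) {a : ℝ} (ha : 0 < a) (s : ℝ) :
    ‖pk a s * c s‖ ≤ 2 * a * C * (a^2 + s^2)⁻¹ := by
  rw [norm_mul, norm_pk ha]
  calc _ ≤ 2 * a * (a^2 + s^2)⁻¹ * C := mul_le_mul_of_nonneg_left (hc.bd s) (by positivity)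
    _ = _ := by ring

lemma integrable_pk (hc : BC c C) {a : ℝ} (ha : 0 < a) : Integrable (fun s => pk a s * c s) := by
  refine ((integrable_inv_sq ha).const_mul (2 * a * C)).mono'
    ((continuous_pk ha).mul hc.cont).aestronglyMeasurable ?_
  exact ae_of_all _ (norm_pk_mul_le hc ha)

lemma norm_PI_le (hc : BC c C) {a : ℝ} (ha : 0 < a) : ‖PI c a‖ ≤ C := by
  have h : ‖∫ s : ℝ, pk a s * c s‖ ≤ 2 * Real.pi * C := by
    refine (norm_integral_le_of_norm_le ((integrable_inv_sq ha).const_mul (2 * a * C))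
      (ae_of_all _ (norm_pk_mul_le hc ha))).trans ?_
    rw [integral_const_mul, integral_inv_sq ha]
    apply le_of_eq; field_simp
  have h2 : ‖(1 / (2 * Real.pi) : ℂ)‖ = 1 / (2 * Real.pi) := by
    have : (1 / (2 * Real.pi) : ℂ) = ((1 / (2 * Real.pi) : ℝ) : ℂ) := by push_cast; ring
    rw [this, Complex.norm_real, Real.norm_of_nonneg (by positivity)]
  unfold PI
  rw [norm_mul, h2]
  calc _ ≤ 1 / (2 * Real.pi) * (2 * Real.pi * C) := mul_le_mul_of_nonneg_left h (by positivity)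
    _ = C := by field_simp

lemma hasDerivAt_PI (hc : BC c C) {a : ℝ} (ha : 0 < a) :
    HasDerivAt (PI c) (-(1 / (2 * Real.pi)) * (gam 0 Complex.I c a + gam 0 (-Complex.I) c a)) a := by
  have hs : Ioo (a/2) (2*a) ∈ 𝓝 a := Ioo_mem_nhds (by linarith) (by linarith)
  have ha2 : 0 < a/2 := by linarith
  have i1 := fun b (hb : 0 < b) => integrable_gam0 EI_I hc hb
  have i2 := fun b (hb : 0 < b) => integrable_gam0 EI_negI hc hb
  have := hasDerivAt_integral_of_dominated_loc_of_deriv_le (μ := (volume : Measure ℝ))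
    (F := fun b s => pk b s * c s)
    (F' := fun b s => - (qk Complex.I b s ^ 2 * c s + qk (-Complex.I) b s ^ 2 * c s)) (x₀ := a)
    (bound := fun s => C * ((a/2)^2 + s^2)⁻¹ + C * ((a/2)^2 + s^2)⁻¹) hs ?_
    (integrable_pk hc ha) ((i1 a ha).add (i2 a ha)).neg.aestronglyMeasurable ?_
    (((integrable_inv_sq ha2).const_mul _).add ((integrable_inv_sq ha2).const_mul _)) ?_
  · have h2 := this.2.const_mul (1 / (2 * Real.pi) : ℂ)
    rw [integral_neg, integral_add (i1 a ha) (i2 a ha)] at h2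
    refine h2.congr_deriv ?_
    rw [gam_zero, gam_zero]; ring
  · filter_upwards [hs] with b hb
    exact (integrable_pk hc (by linarith [hb.1])).aestronglyMeasurable
  · refine ae_of_all _ fun s b hb => ?_
    rw [norm_neg]
    refine (norm_add_le _ _).trans (add_le_add ?_ ?_)
    · exact norm_gam0_integrand_le EI_I hc ha2 hb.1.le s
    · exact norm_gam0_integrand_le EI_negI hc ha2 hb.1.le s
  · refine ae_of_all _ fun s b hb => ?_
    have hb0 : 0 < b := by linarith [hb.1]
    have h1 := ((hasDerivAt_qk EI_I hb0 s).fun_add (hasDerivAt_qk EI_negI hb0 s)).mul_const (c s)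
    refine h1.congr_deriv ?_
    ring

lemma PI_deriv (hc : BC c C) {c' : ℝ → ℂ} {C' : ℝ} (hc' : BC c' C')
    (hd : ∀ s, HasDerivAt c (c' s) s) {a : ℝ} (ha : 0 < a) :
    PI c' a = Complex.I * (1 / (2 * Real.pi)) * (gam 0 Complex.I c a - gam 0 (-Complex.I) c a) := by
  have i1 := integrable_gam0 EI_I hc ha
  have i2 := integrable_gam0 EI_negI hc ha
  have h := integral_mul_deriv_eq_deriv_mul_of_integrable (u := fun s => pk a s) (v := c)
    (u' := fun s => -Complex.I * qk Complex.I a s ^ 2 + - (-Complex.I) * qk (-Complex.I) a s ^ 2)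
    (v' := c') ?_ (fun s _ => hd s) (integrable_pk hc' ha) ?_ (integrable_pk hc ha)
  · unfold PI
    rw [gam_zero, gam_zero, h, mul_assoc, ← integral_sub i1 i2, ← integral_neg, mul_left_comm, ← integral_const_mul Complex.I]
    congr 2; funext s; simp; ring
  · intro s _
    exact (hasDerivAt_qk_s EI_I ha s).fun_add (hasDerivAt_qk_s EI_negI ha s)
  · have := (i1.sub i2).const_mul (-Complex.I)
    refine this.congr (ae_of_all _ fun s => ?_)
    simp; ring

lemma PI_tendsto (hc : BC c C) : Tendsto (PI c) (𝓝[>] 0) (𝓝 (c 0)) := by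
  have e : ∀ a, 0 < a → PI c a = (1 / Real.pi) * ∫ u : ℝ, (((1 + u^2)⁻¹ : ℝ) : ℂ) * c (a * u) := by
    intro a ha
    have h1 : ∀ s, pk a s * c s = (fun u : ℝ => (2 * a⁻¹ : ℂ) * ((((1 + u^2)⁻¹ : ℝ) : ℂ) * c (a * u))) (a⁻¹ * s) := by
      intro s
      rw [pk_eq ha, inv_sq_eq ha]
      beta_reduce
      rw [mul_inv_cancel_left₀ ha.ne']
      have : (a : ℂ) ≠ 0 := by exact_mod_cast ha.ne'
      push_cast; field_simp
    unfold PI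
    simp_rw [h1]
    rw [Measure.integral_comp_mul_left (fun u : ℝ => (2 * a⁻¹ : ℂ) * ((((1 + u^2)⁻¹ : ℝ) : ℂ) * c (a * u))) a⁻¹,
      integral_const_mul]
    have : (a : ℂ) ≠ 0 := by exact_mod_cast ha.ne'
    simp only [inv_inv, abs_of_pos ha, Complex.real_smul, ← mul_assoc]
    congr 1
    push_cast
    field_simp
  have lim : Tendsto (fun a : ℝ => ∫ u : ℝ, (((1 + u^2)⁻¹ : ℝ) : ℂ) * c (a * u)) (𝓝[>] 0)
      (𝓝 (∫ u : ℝ, (((1 + u^2)⁻¹ : ℝ) : ℂ) * c 0)) := by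
    apply tendsto_integral_filter_of_dominated_convergence (fun u => (1 + u^2)⁻¹ * C)
    · refine Eventually.of_forall fun a => Continuous.aestronglyMeasurable ?_
      refine (Complex.continuous_ofReal.comp ?_).mul (hc.cont.comp (by fun_prop))
      exact Continuous.inv₀ (by fun_prop) (fun u => by positivity)
    · refine Eventually.of_forall fun a => ae_of_all _ fun u => ?_
      rw [norm_mul, Complex.norm_real, Real.norm_of_nonneg (by positivity)]
      exact mul_le_mul_of_nonneg_left (hc.bd _) (by positivity)
    · exact integrable_inv_one_add_sq.mul_const _
    · refine ae_of_all _ fun u => tendsto_const_nhds.mul ?_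
      have : Tendsto (fun a : ℝ => a * u) (𝓝[>] 0) (𝓝 0) := by
        have h0 : Tendsto (fun a : ℝ => a * u) (𝓝 0) (𝓝 (0 * u)) := (continuous_id.mul continuous_const).tendsto 0
        rw [zero_mul] at h0
        exact h0.mono_left nhdsWithin_le_nhds
      exact (hc.cont.tendsto 0).comp this
  have lim2 := lim.const_mul (1 / Real.pi : ℂ)
  rw [integral_mul_const, integral_complex_ofReal, integral_univ_inv_one_add_sq] at lim2
  have : (1 / Real.pi : ℂ) * (Real.pi * c 0) = c 0 := by
    have : (Real.pi : ℂ) ≠ 0 := by exact_mod_cast Real.pi_ne_zero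
    field_simp
  rw [this] at lim2
  apply lim2.congr'
  filter_upwards [self_mem_nhdsWithin] with a ha
  exact (e a ha).symm

end

/-! ### the vertical convolution -/

section
variable {n : ℕ}

def cc (f χ : Hn n → ℂ) (s : ℝ) : ℂ := ∫ p, f (p + s • eT n) * χ p

/-- the hypotheses on the boundary function -/
structure FH (f : Hn n → ℂ) (M : ℝ) : Prop where
  sm : ContDiff ℝ ∞ f
  bd : ∀ p, ‖f p‖ ≤ M

variable {f χ κ : Hn n → ℂ} {M : ℝ}

lemma FH.transl (hf : FH f M) (s : ℝ) : FH (fun p => f (p + s • eT n)) M :=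
  ⟨hf.sm.comp (contDiff_id.add contDiff_const), fun p => hf.bd _⟩

lemma cc_integrable (hf : FH f M) (hχ : Tst χ) (s : ℝ) :
    Integrable (fun p => f (p + s • eT n) * χ p) := (hχ.mul_left (hf.transl s).sm).integrable

lemma cc_add (hf : FH f M) (hχ : Tst χ) (hκ : Tst κ) :
    cc f (fun p => χ p + κ p) = fun s => cc f χ s + cc f κ s := by
  funext s; unfold cc
  rw [← integral_add (cc_integrable hf hχ s) (cc_integrable hf hκ s)]
  congr 1; funext p; ring
lemma cc_const_mul (c : ℂ) :
    cc f (fun p => c * χ p) = fun s => c * cc f χ s := by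
  funext s; unfold cc
  rw [← integral_const_mul]
  congr 1; funext p; ring

lemma FH.nonneg (hf : FH f M) : 0 ≤ M := (norm_nonneg _).trans (hf.bd 0)

lemma norm_cc_le (hf : FH f M) (hχ : Tst χ) (s : ℝ) : ‖cc f χ s‖ ≤ M * ∫ p, ‖χ p‖ := by
  unfold cc
  rw [← integral_const_mul]
  refine norm_integral_le_of_norm_le (hχ.integrable.norm.const_mul M) (ae_of_all _ fun p => ?_)
  rw [norm_mul]
  exact mul_le_mul_of_nonneg_right (hf.bd _) (norm_nonneg _)

lemma cc_hasDerivAt (hf : FH f M) (hχ : Tst χ) (s : ℝ) :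
    HasDerivAt (cc f χ) (- cc f (LD (eT n) χ) s) s := by
  have hK : IsCompact (tsupport χ ×ˢ Icc (s-1) (s+1)) := hχ.2.isCompact.prod isCompact_Icc
  have hD : Continuous (fun q : Hn n × ℝ => LD (eT n) f (q.1 + q.2 • eT n)) :=
    (contDiff_LD (eT n) hf.sm).continuous.comp (by fun_prop)
  obtain ⟨C, hC⟩ := hK.exists_bound_of_continuousOn hD.continuousOn
  have hs : Ioo (s-1) (s+1) ∈ 𝓝 s := Ioo_mem_nhds (by linarith) (by linarith)
  have hT : ∀ p, LD (eT n) f p = fderiv ℝ f p (eT n) := by intro p; rw [LD_eq, cof_eT]; simp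
  have hTt : ∀ p, LD (eT n) (fun p => f (p + s • eT n)) p = LD (eT n) f (p + s • eT n) := by
    intro p
    rw [LD_eq, cof_eT, hT, fderiv_comp_add_right]; simp
  have := hasDerivAt_integral_of_dominated_loc_of_deriv_le (μ := (volume : Measure (Hn n)))
    (F := fun b p => f (p + b • eT n) * χ p) (F' := fun b p => LD (eT n) f (p + b • eT n) * χ p) (x₀ := s)
    (bound := fun w => C * ‖χ w‖) hs ?_ (cc_integrable hf hχ s) ?_ ?_
    (hχ.integrable.norm.const_mul C) ?_
  · refine this.2.congr_deriv ?_
    unfold cc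
    rw [← ibp (hf.transl s).sm hχ (eT n)]
    simp_rw [hTt]
  · filter_upwards with b
    exact (cc_integrable hf hχ b).aestronglyMeasurable
  · refine ((hD.comp (continuous_id.prodMk continuous_const)).mul hχ.continuous).aestronglyMeasurable
  · refine ae_of_all _ fun w b hb => ?_
    rw [norm_mul]
    by_cases hw : w ∈ tsupport χ
    · exact mul_le_mul_of_nonneg_right (hC (w, b) ⟨hw, ⟨hb.1.le, hb.2.le⟩⟩) (norm_nonneg _)
    · rw [image_eq_zero_of_notMem_tsupport hw]; simp
  · refine ae_of_all _ fun w b hb => ?_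
    have h1 := (hf.sm.differentiable (by simp) (w + b • eT n)).hasFDerivAt
    have h2 : HasDerivAt (fun b : ℝ => w + b • eT n) (eT n) b := by
      simpa using ((hasDerivAt_id b).smul_const (eT n)).const_add w
    have := (h1.comp_hasDerivAt b h2).mul_const (χ w)
    rw [hT]; exact this

lemma cc_BC (hf : FH f M) (hχ : Tst χ) : BC (cc f χ) (M * ∫ p, ‖χ p‖) :=
  ⟨continuous_iff_continuousAt.2 fun s => (cc_hasDerivAt hf hχ s).continuousAt, norm_cc_le hf hχ⟩

lemma gam_add {m : ℕ} {e : ℂ} (he : EI e) {c d : ℝ → ℂ} {C D : ℝ} (hc : BC c C) (hd : BC d D) {a : ℝ} (ha : 0 < a) :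
    gam m e (fun s => c s + d s) a = gam m e c a + gam m e d a := by
  unfold gam
  rw [← integral_add (integrable_gam he hc ha m) (integrable_gam he hd ha m)]
  congr 1; funext s; ring
lemma gam_const_mul {m : ℕ} {e : ℂ} {c : ℝ → ℂ} (k : ℂ) {a : ℝ} :
    gam m e (fun s => k * c s) a = k * gam m e c a := by
  unfold gam
  rw [← integral_const_mul]
  congr 1; funext s; ring
lemma PI_add {c d : ℝ → ℂ} {C D : ℝ} (hc : BC c C) (hd : BC d D) {a : ℝ} (ha : 0 < a) :
    PI (fun s => c s + d s) a = PI c a + PI d a := by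
  unfold PI
  rw [← mul_add, ← integral_add (integrable_pk hc ha) (integrable_pk hd ha)]
  congr 2; funext s; ring
lemma PI_const_mul {c : ℝ → ℂ} (k : ℂ) {a : ℝ} :
    PI (fun s => k * c s) a = k * PI c a := by
  unfold PI
  rw [mul_left_comm, ← integral_const_mul k]
  congr 2; funext s; ring

/-- Poisson integral tested against χ -/
def Ip (f χ : Hn n → ℂ) (a : ℝ) : ℂ := PI (cc f χ) a
def gp (m : ℕ) (e : ℂ) (f χ : Hn n → ℂ) (a : ℝ) : ℂ := gam m e (cc f χ) a
/-- its derivative -/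
def dIp (f χ : Hn n → ℂ) (a : ℝ) : ℂ :=
  -(1 / (2 * Real.pi)) * (gp 0 Complex.I f χ a + gp 0 (-Complex.I) f χ a)

lemma Ip_add (hf : FH f M) (hχ : Tst χ) (hκ : Tst κ) {a : ℝ} (ha : 0 < a) :
    Ip f (fun p => χ p + κ p) a = Ip f χ a + Ip f κ a := by
  unfold Ip; rw [cc_add hf hχ hκ, PI_add (cc_BC hf hχ) (cc_BC hf hκ) ha]
lemma Ip_const_mul (c : ℂ) (a : ℝ) : Ip f (fun p => c * χ p) a = c * Ip f χ a := by
  unfold Ip; rw [cc_const_mul, PI_const_mul]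
lemma gp_add {m : ℕ} {e : ℂ} (he : EI e) (hf : FH f M) (hχ : Tst χ) (hκ : Tst κ) {a : ℝ} (ha : 0 < a) :
    gp m e f (fun p => χ p + κ p) a = gp m e f χ a + gp m e f κ a := by
  unfold gp; rw [cc_add hf hχ hκ, gam_add he (cc_BC hf hχ) (cc_BC hf hκ) ha]
lemma gp_const_mul {m : ℕ} {e : ℂ} (c : ℂ) (a : ℝ) : gp m e f (fun p => c * χ p) a = c * gp m e f χ a := by
  unfold gp; rw [cc_const_mul, gam_const_mul]

lemma norm_Ip_le (hf : FH f M) (hχ : Tst χ) {a : ℝ} (ha : 0 < a) : ‖Ip f χ a‖ ≤ M * ∫ p, ‖χ p‖ :=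
  norm_PI_le (cc_BC hf hχ) ha

lemma Ip_hasDerivAt (hf : FH f M) (hχ : Tst χ) {a : ℝ} (ha : 0 < a) :
    HasDerivAt (Ip f χ) (dIp f χ a) a := hasDerivAt_PI (cc_BC hf hχ) ha

lemma cc_deriv' (hf : FH f M) (hχ : Tst χ) (s : ℝ) :
    HasDerivAt (cc f (fun p => (-1 : ℂ) * χ p)) (cc f (LD (eT n) χ) s) s := by
  rw [cc_const_mul]
  simpa using (cc_hasDerivAt hf hχ s).const_mul (-1 : ℂ)

lemma Ip_T (hf : FH f M) (hχ : Tst χ) {a : ℝ} (ha : 0 < a) :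
    Ip f (LD (eT n) χ) a = - Complex.I * (1 / (2 * Real.pi)) *
      (gp 0 Complex.I f χ a - gp 0 (-Complex.I) f χ a) := by
  have := PI_deriv (cc_BC hf (hχ.const_mul (-1))) (cc_BC hf (hχ.LD (eT n))) (cc_deriv' hf hχ) ha
  unfold Ip
  rw [this, cc_const_mul, gam_const_mul, gam_const_mul]; unfold gp; ring

lemma gp_T {e : ℂ} (he : EI e) (hf : FH f M) (hχ : Tst χ) {a : ℝ} (ha : 0 < a) :
    gp 0 e f (LD (eT n) χ) a = -2 * e * gp 1 e f χ a := by
  have := gam_deriv he (cc_BC hf (hχ.const_mul (-1))) (cc_BC hf (hχ.LD (eT n))) (cc_deriv' hf hχ) ha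
  unfold gp
  rw [this, cc_const_mul, gam_const_mul]; ring

lemma gp_hasDerivAt {e : ℂ} (he : EI e) (hf : FH f M) (hχ : Tst χ) {a : ℝ} (ha : 0 < a) :
    HasDerivAt (gp 0 e f χ) (-2 * gp 1 e f χ a) a := by
  have := hasDerivAt_gam he (cc_BC hf hχ) ha 0
  refine this.congr_deriv ?_
  simp [gp]

lemma dIp_hasDerivAt (hf : FH f M) (hχ : Tst χ) {a : ℝ} (ha : 0 < a) :
    HasDerivAt (dIp f χ) (- Ip f (LD (eT n) (LD (eT n) χ)) a) a := by
  have h := ((gp_hasDerivAt EI_I hf hχ ha).add (gp_hasDerivAt EI_negI hf hχ ha)).const_mul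
    (-(1 / (2 * Real.pi)) : ℂ)
  refine h.congr_deriv ?_
  rw [Ip_T hf (hχ.LD _) ha, gp_T EI_I hf hχ ha, gp_T EI_negI hf hχ ha]
  linear_combination ((1/Real.pi) * (gp 1 Complex.I f χ a + gp 1 (-Complex.I) f χ a)) * Complex.I_sq

lemma Ip_tendsto (hf : FH f M) (hχ : Tst χ) :
    Tendsto (Ip f χ) (𝓝[>] 0) (𝓝 (∫ p, f p * χ p)) := by
  have := PI_tendsto (cc_BC hf hχ)
  have e : cc f χ 0 = ∫ p, f p * χ p := by simp [cc]
  rwa [e] at this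

lemma gp_tendsto_atTop {e : ℂ} (he : EI e) (hf : FH f M) (hχ : Tst χ) :
    Tendsto (gp 0 e f χ) atTop (𝓝 0) := by
  apply squeeze_zero_norm' (a := fun a => (M * ∫ p, ‖χ p‖) * Real.pi * (a⁻¹)^(0+1))
  · filter_upwards [eventually_gt_atTop 0] with b hb
    exact norm_gam_le he (cc_BC hf hχ) hb 0
  · have := (tendsto_inv_atTop_zero (𝕜 := ℝ)).pow (0+1)
    simpa using this.const_mul ((M * ∫ p, ‖χ p‖) * Real.pi)

lemma cof_XY (j k : Fin n) : cof (eX n j) (eY n k) = (if j = k then 2 else 0) := by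
  rw [cof_eX]; simp [eY]; split_ifs <;> simp
lemma cof_YX (j k : Fin n) : cof (eY n j) (eX n k) = (if j = k then -2 else 0) := by
  rw [cof_eY]; simp [eX]; split_ifs <;> simp
lemma cof_XX (j k : Fin n) : cof (eX n j) (eX n k) = 0 := by
  rw [cof_eX]; simp [eX]; split_ifs <;> simp
lemma cof_YY (j k : Fin n) : cof (eY n j) (eY n k) = 0 := by
  rw [cof_eY]; simp [eY]; split_ifs <;> simp

lemma LD_ZC (hf : ContDiff ℝ ∞ f) (c : ℂ) (j : Fin n) (v p : Hn n) :
    LD v (ZC c j f) p = (1/2) * (LD v (LD (eX n j) f) p + c * LD v (LD (eY n j) f) p) := by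
  have hX := (contDiff_LD (eX n j) hf).differentiable (by simp)
  have hY := (contDiff_LD (eY n j) hf).differentiable (by simp)
  have e : ZC c j f = fun p => (1/2) * (LD (eX n j) f p + c * LD (eY n j) f p) := rfl
  rw [e, LD_const_mul (f := fun p => LD (eX n j) f p + c * LD (eY n j) f p) _
    ((hX p).fun_add ((hY p).const_mul c)), LD_add _ (hX p) ((hY p).const_mul c), LD_const_mul _ (hY p)]

lemma ZZ_comm (hf : ContDiff ℝ ∞ f) (j k : Fin n) (p : Hn n) :
    ZC Complex.I j (ZC (-Complex.I) k f) p = ZC (-Complex.I) k (ZC Complex.I j f) p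
      + (if j = k then 2 * Complex.I * LD (eT n) f p else 0) := by
  have hI := Complex.I_sq
  simp only [ZC.eq_1 Complex.I j (ZC (-Complex.I) k f), ZC.eq_1 (-Complex.I) k (ZC Complex.I j f), LD_ZC hf]
  rw [LD_comm (eX n j) (eX n k) hf, LD_comm (eX n j) (eY n k) hf, LD_comm (eY n j) (eX n k) hf,
    LD_comm (eY n j) (eY n k) hf]
  simp only [cof_XX, cof_XY, cof_YX, cof_YY, eq_comm (a := k) (b := j)]
  split_ifs
  · push_cast; ring
  · push_cast; ring

lemma LL_eq (hf : ContDiff ℝ ∞ f) (p : Hn n) :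
    LL f p = -(∑ j, ZC Complex.I j (ZC (-Complex.I) j f) p) + Complex.I * n * LD (eT n) f p := by
  have h : ∀ j : Fin n, ZC Complex.I j (ZC (-Complex.I) j f) p =
      (1/4) * (LD (eX n j) (LD (eX n j) f) p + LD (eY n j) (LD (eY n j) f) p) + Complex.I * LD (eT n) f p := by
    intro j
    simp only [ZC.eq_1 Complex.I j (ZC (-Complex.I) j f), LD_ZC hf]
    rw [LD_comm (eY n j) (eX n j) hf]
    simp only [cof_XY, cof_YX, if_true]
    push_cast
    linear_combination (-(1/4) * LD (eY n j) (LD (eY n j) f) p) * Complex.I_sq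
  simp_rw [h]
  rw [Finset.sum_add_distrib, ← Finset.mul_sum, LL]
  simp
  ring

lemma is_const_of_deriv {J : ℝ → ℂ} (hd : ∀ a ∈ Ioi (0:ℝ), HasDerivAt J 0 a) :
    ∀ a ∈ Ioi (0:ℝ), ∀ b ∈ Ioi (0:ℝ), J a = J b := by
  intro a ha b hb
  apply (convex_Ioi (0:ℝ)).is_const_of_fderivWithin_eq_zero (𝕜 := ℝ) (f := J) _ _ ha hb
  · intro x hx; exact (hd x hx).differentiableAt.differentiableWithinAt
  · intro x hx
    have := (hd x hx).hasFDerivAt.hasFDerivWithinAt (s := Ioi 0)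
    rw [this.fderivWithin (isOpen_Ioi.uniqueDiffWithinAt hx)]
    ext; simp

lemma zero_of_deriv {J : ℝ → ℂ} (hd : ∀ a ∈ Ioi (0:ℝ), HasDerivAt J 0 a) (hlim : Tendsto J atTop (𝓝 0)) :
    ∀ a, 0 < a → J a = 0 := by
  intro a ha
  have lim2 : Tendsto J atTop (𝓝 (J a)) := by
    apply tendsto_const_nhds.congr'
    filter_upwards [eventually_gt_atTop 0] with b hb
    exact is_const_of_deriv hd a ha b hb
  exact tendsto_nhds_unique lim2 hlim

/-- the consequences of the key vanishing (★) and of Lemma Z -/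
lemma Ip_W4 (hf : FH f M)
    (S1 : ∀ κ, Tst κ → ∀ j a, 0 < a → gp 0 Complex.I f (ZC Complex.I j κ) a = 0)
    (S2 : ∀ κ, Tst κ → ∀ j a, 0 < a → gp 0 (-Complex.I) f (ZC (-Complex.I) j κ) a = 0)
    (Z : ∀ κ, Tst κ → ∀ j, Tendsto (Ip f (ZC Complex.I j κ)) atTop (𝓝 0))
    (hχ : Tst χ) {a : ℝ} (ha : 0 < a) (j k : Fin n) :
    Ip f (ZC Complex.I j (ZC (-Complex.I) k χ)) a =
      if j = k then Complex.I * Ip f (LD (eT n) χ) a + dIp f χ a else 0 := by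
  have hpi : (Real.pi : ℂ) ≠ 0 := by exact_mod_cast Real.pi_ne_zero
  have hI := Complex.I_sq
  set δ : ℂ := if j = k then 1 else 0 with hδ
  have key : ∀ a, 0 < a → Ip f (ZC Complex.I j (ZC (-Complex.I) k χ)) a + (δ / Real.pi) * gp 0 (-Complex.I) f χ a = 0 := by
    apply zero_of_deriv
    · intro b hb
      have h := (Ip_hasDerivAt hf ((hχ.ZC (-Complex.I) k).ZC Complex.I j) hb).add
        ((gp_hasDerivAt EI_negI hf hχ hb).const_mul (δ / Real.pi))
      refine h.congr_deriv ?_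
      have e1 : ZC Complex.I j (ZC (-Complex.I) k χ) = fun p => ZC (-Complex.I) k (ZC Complex.I j χ) p
          + (δ * (2 * Complex.I)) * LD (eT n) χ p := by
        funext p; rw [ZZ_comm hχ.1, hδ]; split_ifs <;> simp
      rw [dIp, S1 _ (hχ.ZC _ _) j b hb, e1, gp_add EI_negI hf ((hχ.ZC _ _).ZC _ _) ((hχ.LD _).const_mul _) hb,
        gp_const_mul, S2 _ (hχ.ZC _ _) k b hb, gp_T EI_negI hf hχ hb]
      field_simp
      linear_combination (-4 * δ * gp 1 (-Complex.I) f χ b) * hI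
    · have := (Z _ (hχ.ZC (-Complex.I) k) j).add ((gp_tendsto_atTop EI_negI hf hχ).const_mul (δ / Real.pi))
      simpa using this
  have h := key a ha
  have e : Complex.I * Ip f (LD (eT n) χ) a + dIp f χ a = - (1 / Real.pi) * gp 0 (-Complex.I) f χ a := by
    rw [Ip_T hf hχ ha, dIp]
    field_simp
    linear_combination (-(gp 0 Complex.I f χ a - gp 0 (-Complex.I) f χ a)) * hI
  rw [e]
  split_ifs with hjk
  · rw [hδ, if_pos hjk] at h
    linear_combination h
  · rw [hδ, if_neg hjk] at h
    linear_combination h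

lemma Ip_W2 (hf : FH f M)
    (S1 : ∀ κ, Tst κ → ∀ j a, 0 < a → gp 0 Complex.I f (ZC Complex.I j κ) a = 0)
    (hχ : Tst χ) {a : ℝ} (ha : 0 < a) (j : Fin n) :
    Ip f (LD (eT n) (ZC Complex.I j χ)) a + Complex.I * dIp f (ZC Complex.I j χ) a = 0 := by
  rw [Ip_T hf (hχ.ZC _ _) ha, dIp, S1 χ hχ j a ha]; ring

lemma Ip_W3 (hf : FH f M)
    (S2 : ∀ κ, Tst κ → ∀ j a, 0 < a → gp 0 (-Complex.I) f (ZC (-Complex.I) j κ) a = 0)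
    (hχ : Tst χ) {a : ℝ} (ha : 0 < a) (j : Fin n) :
    Ip f (LD (eT n) (ZC (-Complex.I) j χ)) a - Complex.I * dIp f (ZC (-Complex.I) j χ) a = 0 := by
  rw [Ip_T hf (hχ.ZC _ _) ha, dIp, S2 χ hχ j a ha]; ring

lemma Ip_sum (hf : FH f M) {ι : Type*} (s : Finset ι) {χ : ι → Hn n → ℂ} (h : ∀ i ∈ s, Tst (χ i)) {a : ℝ} (ha : 0 < a) :
    Ip f (fun p => ∑ i ∈ s, χ i p) a = ∑ i ∈ s, Ip f (χ i) a := by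
  classical
  induction s using Finset.induction_on with
  | empty =>
    have := Ip_const_mul (f := f) (χ := fun _ => 0) 0 a
    simpa using this
  | insert b s hb ih =>
    simp only [Finset.sum_insert hb]
    rw [Ip_add hf (h b (by simp)) (Tst.sum s fun i hi => h i (by simp [hi])) ha,
      ih (fun i hi => h i (by simp [hi]))]

lemma Ip_LL (hf : FH f M)
    (W4 : ∀ χ, Tst χ → ∀ a, 0 < a → ∀ j k, Ip f (ZC Complex.I j (ZC (-Complex.I) k χ)) a =
      if j = k then Complex.I * Ip f (LD (eT n) χ) a + dIp f χ a else 0)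
    (hχ : Tst χ) {a : ℝ} (ha : 0 < a) :
    Ip f (LL χ) a + n * dIp f χ a = 0 := by
  have e : LL χ = fun p => (-1) * (∑ j, ZC Complex.I j (ZC (-Complex.I) j χ) p) + (Complex.I * n) * LD (eT n) χ p := by
    funext p; rw [LL_eq hχ.1]; ring
  have hs : Tst (fun p => ∑ j, ZC Complex.I j (ZC (-Complex.I) j χ) p) :=
    Tst.sum _ fun j _ => (hχ.ZC _ _).ZC _ _
  rw [e, Ip_add hf (hs.const_mul _) ((hχ.LD _).const_mul _) ha, Ip_const_mul, Ip_const_mul,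
    Ip_sum hf _ (fun j _ => (hχ.ZC _ _).ZC _ _) ha]
  have : ∀ j : Fin n, Ip f (ZC Complex.I j (ZC (-Complex.I) j χ)) a = Complex.I * Ip f (LD (eT n) χ) a + dIp f χ a := by
    intro j; rw [W4 χ hχ a ha j j, if_pos rfl]
  simp_rw [this]
  simp
  ring

end

/-- bounded linear functionals in the L¹ norm on test functions -/
structure Lin1 {n : ℕ} (m : (Hn n → ℂ) → ℂ) (C : ℝ) : Prop where
  add : ∀ χ κ, Tst χ → Tst κ → m (fun p => χ p + κ p) = m χ + m κ
  smul : ∀ (c : ℂ) χ, Tst χ → m (fun p => c * χ p) = c * m χ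
  bd : ∀ χ, Tst χ → ‖m χ‖ ≤ C * ∫ p, ‖χ p‖

/-- vector fields invariant under their own straight flow -/
structure FlV {n : ℕ} (V : Hn n → Hn n) : Prop where
  sm : ContDiff ℝ ∞ V
  inv : ∀ (s : ℝ) u, V (u + s • V u) = V u

def VD {n : ℕ} (V : Hn n → Hn n) (κ : Hn n → ℂ) (p : Hn n) : ℂ := fderiv ℝ κ p (V p)

section
variable {n : ℕ} {m : (Hn n → ℂ) → ℂ} {C : ℝ} {V : Hn n → Hn n} {χ κ : Hn n → ℂ}

lemma Lin1.neg (hm : Lin1 m C) (h : Tst χ) : m (fun p => - χ p) = - m χ := by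
  have := hm.smul (-1) χ h
  simpa using this
lemma Lin1.sub (hm : Lin1 m C) (h : Tst χ) (h' : Tst κ) : m (fun p => χ p - κ p) = m χ - m κ := by
  have := hm.add χ _ h h'.neg
  simp only [hm.neg h', ← sub_eq_add_neg] at this
  exact this
lemma Lin1.zero (hm : Lin1 m C) : m (fun _ => 0) = 0 := by
  have := hm.smul 0 _ Tst.zero
  simpa using this
lemma Lin1.sum (hm : Lin1 m C) {ι : Type*} (s : Finset ι) {χ : ι → Hn n → ℂ} (h : ∀ i ∈ s, Tst (χ i)) :
    m (fun p => ∑ i ∈ s, χ i p) = ∑ i ∈ s, m (χ i) := by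
  classical
  induction s using Finset.induction_on with
  | empty => simpa using hm.zero
  | insert a s ha ih =>
    simp only [Finset.sum_insert ha]
    rw [hm.add _ _ (h a (by simp)) (Tst.sum s fun i hi => h i (by simp [hi])), ih fun i hi => h i (by simp [hi])]

lemma FlV_xi (e : Hn n) : FlV (xi e) := by
  refine ⟨contDiff_xi e, fun s u => ?_⟩
  have h : cof e e = 0 := by have := cof_antisymm e e; linarith
  have h2 : cof e (eT n) = 0 := by simp [cof_apply, eT]
  simp [xi, h, h2]
lemma FlV_const (e : Hn n) : FlV (fun _ => e) := ⟨contDiff_const, fun _ _ => rfl⟩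

lemma Tst.VD (h : Tst χ) (hV : FlV V) : Tst (VD V χ) := by
  refine ⟨?_, ?_⟩
  · exact (h.1.fderiv_right (m := ∞) (by simp)).clm_apply hV.sm
  · refine HasCompactSupport.intro h.2 fun x hx => ?_
    have : _root_.fderiv ℝ χ x = 0 := by
      have := (support_fderiv_subset ℝ (f := χ))
      by_contra h0; exact hx (this h0)
    simp [_root_.VD, this]

lemma fl_inv (hV : FlV V) (s : ℝ) (u : Hn n) : (u + s • V u) + (-s) • V (u + s • V u) = u := by
  rw [hV.inv]; simp
lemma fl_add (hV : FlV V) (s r : ℝ) (u : Hn n) : (u + s • V u) + r • V (u + s • V u) = u + (s + r) • V u := by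
  rw [hV.inv]; module

def flH (hV : FlV V) (s : ℝ) : Hn n ≃ₜ Hn n where
  toFun u := u + s • V u
  invFun u := u + (-s) • V u
  left_inv u := fl_inv hV s u
  right_inv u := by have := fl_inv hV (-s) u; simpa using this
  continuous_toFun := by have := hV.sm.continuous; fun_prop
  continuous_invFun := by have := hV.sm.continuous; fun_prop

lemma Tst.fl (h : Tst χ) (hV : FlV V) (s : ℝ) : Tst (fun u => χ (u + s • V u)) := by
  refine ⟨h.1.comp (by have := hV.sm; fun_prop), ?_⟩
  exact h.2.comp_homeomorph (flH hV s)

lemma fl_hasDerivAt (h : Tst χ) (hV : FlV V) (u : Hn n) (s : ℝ) :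
    HasDerivAt (fun s : ℝ => χ (u + s • V u)) (VD V χ (u + s • V u)) s := by
  have h1 := (h.differentiable (u + s • V u)).hasFDerivAt
  have h2 : HasDerivAt (fun b : ℝ => u + b • V u) (V u) s := by
    simpa using ((hasDerivAt_id s).smul_const (V u)).const_add u
  have := h1.comp_hasDerivAt s h2
  refine this.congr_deriv ?_
  rw [VD, hV.inv]

lemma fl_taylor (h : Tst χ) (hV : FlV V) : ∃ B : ℝ, 0 ≤ B ∧ ∀ u (s : ℝ),
    ‖χ (u + s • V u) - χ u - s • VD V χ u‖ ≤ B * s ^ 2 := by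
  have h2 := (h.VD hV).VD hV
  obtain ⟨B, hB⟩ := h2.2.exists_bound_of_continuous h2.continuous
  have hB0 : 0 ≤ B := (norm_nonneg _).trans (hB 0)
  refine ⟨B, hB0, fun u s => ?_⟩
  have k1 : ∀ r : ℝ, ‖VD V χ (u + r • V u) - VD V χ u‖ ≤ B * |r| := by
    intro r
    have := Convex.norm_image_sub_le_of_norm_hasDerivWithin_le (s := univ) (x := (0:ℝ)) (y := r)
      (f := fun r : ℝ => VD V χ (u + r • V u)) (C := B)
      (fun x _ => (fl_hasDerivAt (h.VD hV) hV u x).hasDerivWithinAt) (fun x _ => hB _) convex_univ trivial trivial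
    simpa using this
  have := Convex.norm_image_sub_le_of_norm_hasDerivWithin_le (s := uIcc 0 s) (x := (0:ℝ)) (y := s)
      (f := fun r : ℝ => χ (u + r • V u) - r • VD V χ u) (C := B * |s|)
      (fun x _ => ((fl_hasDerivAt h hV u x).sub ((hasDerivAt_id x).smul_const _)).hasDerivWithinAt)
      (fun x hx => ?_) (convex_uIcc 0 s) (by simp) (by simp)
  · simp only [zero_smul, add_zero, sub_zero] at this
    rw [sub_right_comm]
    refine this.trans (le_of_eq ?_)
    rw [Real.norm_eq_abs, mul_assoc, ← pow_two, sq_abs]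
  · simp only [one_smul]
    refine (k1 x).trans (mul_le_mul_of_nonneg_left ?_ hB0)
    have := abs_sub_left_of_mem_uIcc hx
    simpa using this

lemma fl_supp (h : Tst χ) (hV : FlV V) : ∃ k : Set (Hn n), IsCompact k ∧ ∀ s ∈ Icc (-1:ℝ) 1, ∀ u ∉ k,
    χ (u + s • V u) = 0 ∧ χ u = 0 ∧ VD V χ u = 0 := by
  have hc : Continuous (fun q : ℝ × Hn n => q.2 + (-q.1) • V q.2) := by
    have := hV.sm.continuous; fun_prop
  refine ⟨(fun q : ℝ × Hn n => q.2 + (-q.1) • V q.2) '' (Icc (-1:ℝ) 1 ×ˢ tsupport χ),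
    (isCompact_Icc.prod h.2).image hc, fun s hs u hu => ?_⟩
  have h1 : ∀ s ∈ Icc (-1:ℝ) 1, χ (u + s • V u) = 0 := by
    intro s hs
    by_contra h0
    exact hu ⟨(s, u + s • V u), ⟨hs, subset_tsupport _ h0⟩, fl_inv hV s u⟩
  have h2 : u ∉ tsupport χ := fun h0 => hu ⟨(0, u), ⟨by simp, h0⟩, by simp⟩
  refine ⟨h1 s hs, by simpa using h1 0 (by simp), ?_⟩
  have : fderiv ℝ χ u = 0 := by
    by_contra h0; exact h2 (support_fderiv_subset ℝ h0)
  simp [VD, this]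

lemma Lin1.hasDerivAt_fl0 (hm : Lin1 m C) (h : Tst χ) (hV : FlV V) :
    HasDerivAt (fun s : ℝ => m (fun u => χ (u + s • V u))) (m (VD V χ)) 0 := by
  obtain ⟨B, hB0, hB⟩ := fl_taylor h hV
  obtain ⟨k, hk, hs⟩ := fl_supp h hV
  rw [hasDerivAt_iff_isLittleO_nhds_zero]
  have key : (fun s : ℝ => m (fun u => χ (u + (0 + s) • V u)) - m (fun u => χ (u + (0:ℝ) • V u)) - s • m (VD V χ))
      =O[𝓝 0] fun s : ℝ => s ^ 2 := by
    refine Asymptotics.IsBigO.of_bound (|C| * (B * (volume k).toReal)) ?_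
    filter_upwards [Icc_mem_nhds (show (-1:ℝ) < 0 by norm_num) (show (0:ℝ) < 1 by norm_num)] with s hs1
    have t1 : Tst (fun u => χ (u + s • V u) - χ u) := (h.fl hV s).sub h
    have t2 := (h.VD hV).const_mul (s : ℂ)
    have e : m (fun u => χ (u + (0 + s) • V u)) - m (fun u => χ (u + (0:ℝ) • V u)) - s • m (VD V χ)
        = m (fun u => (χ (u + s • V u) - χ u) - s * VD V χ u) := by
      rw [hm.sub t1 t2, hm.sub (h.fl hV s) h, hm.smul _ _ (h.VD hV)]; simp
    rw [e]
    refine (hm.bd _ (t1.sub t2)).trans ?_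
    have i1 : ∫ u, ‖(χ (u + s • V u) - χ u) - s * VD V χ u‖ ≤ B * s^2 * (volume k).toReal := by
      have : ∫ u, ‖(χ (u + s • V u) - χ u) - s * VD V χ u‖ ≤ ∫ u, k.indicator (fun _ => B * s^2) u := by
        refine integral_mono (t1.sub t2).integrable.norm ?_ fun u => ?_
        · exact (integrable_indicator_iff hk.measurableSet).2 (integrableOn_const hk.measure_lt_top.ne)
        · by_cases hu : u ∈ k
          · simp only [indicator_of_mem hu]
            simpa using hB u s
          · have := hs s hs1 u hu
            simp [indicator_of_notMem hu, this.1, this.2.1, this.2.2]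
      refine this.trans (le_of_eq ?_)
      rw [integral_indicator hk.measurableSet, setIntegral_const, smul_eq_mul, mul_comm]; rfl
    have i0 : 0 ≤ ∫ u, ‖(χ (u + s • V u) - χ u) - s * VD V χ u‖ := integral_nonneg fun _ => norm_nonneg _
    calc _ ≤ |C| * (B * s^2 * (volume k).toReal) := by
            refine (mul_le_mul_of_nonneg_right (le_abs_self C) i0).trans ?_
            exact mul_le_mul_of_nonneg_left i1 (abs_nonneg _)
      _ = _ := by rw [Real.norm_eq_abs, abs_of_nonneg (sq_nonneg s)]; ring
  refine key.trans_isLittleO ?_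
  have := Asymptotics.isLittleO_pow_id (𝕜 := ℝ) (n := 2) (by norm_num)
  exact this

lemma Lin1.hasDerivAt_fl (hm : Lin1 m C) (h : Tst χ) (hV : FlV V) (s : ℝ) :
    HasDerivAt (fun s : ℝ => m (fun u => χ (u + s • V u))) (m (fun u => VD V χ (u + s • V u))) s := by
  have h0 := hm.hasDerivAt_fl0 (h.fl hV s) hV
  have e1 : VD V (fun u => χ (u + s • V u)) = fun u => VD V χ (u + s • V u) := by
    funext u
    have a1 := fl_hasDerivAt (h.fl hV s) hV u 0
    have a2 := (fl_hasDerivAt h hV u (0 + s)).comp_add_const 0 s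
    simp only [zero_smul, add_zero, zero_add] at a1 a2
    refine a1.unique (a2.congr_of_eventuallyEq (Eventually.of_forall fun r => ?_))
    simp only []; rw [fl_add hV]
  rw [e1] at h0
  have h1 : HasDerivAt (fun r : ℝ => m (fun u => χ (u + (r + s) • V u))) (m (fun u => VD V χ (u + s • V u))) 0 := by
    simpa only [fl_add hV] using h0
  have h2 := HasDerivAt.comp_sub_const (f := fun r : ℝ => m (fun u => χ (u + (r + s) • V u))) s s (by simpa using h1)
  simpa using h2
end

lemma second_deriv_nonneg {g g1 : ℝ → ℝ} {g2 x0 : ℝ} (hmin : IsLocalMin g x0)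
    (h1 : ∀ᶠ x in 𝓝 x0, HasDerivAt g (g1 x) x) (h2 : HasDerivAt g1 g2 x0) : 0 ≤ g2 := by
  by_contra hneg
  push Not at hneg
  have hd0 : g1 x0 = 0 := hmin.hasDerivAt_eq_zero h1.self_of_nhds
  have hq : ∀ x, HasDerivAt (fun x => g x - g2/4 * (x - x0)^2) (deriv g x - g2/2 * (x - x0)) x ∨ ¬ HasDerivAt g (g1 x) x := by
    intro x
    by_cases hx : HasDerivAt g (g1 x) x
    · left
      have := hx.sub ((((hasDerivAt_id x).sub_const x0).pow 2).const_mul (g2/4))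
      rw [hx.deriv]
      refine this.congr_deriv ?_
      simp; ring
    · right; exact hx
  have hev : deriv (fun x => g x - g2/4 * (x - x0)^2) =ᶠ[𝓝 x0] fun x => g1 x - g2/2 * (x - x0) := by
    filter_upwards [h1] with x hx
    rcases hq x with h | h
    · rw [h.deriv, hx.deriv]
    · exact absurd hx h
  have hd2 : HasDerivAt (fun x => g1 x - g2/2 * (x - x0)) (g2/2) x0 := by
    have := h2.sub (((hasDerivAt_id x0).sub_const x0).const_mul (g2/2))
    refine this.congr_deriv ?_
    ring
  have hmax : IsLocalMax (fun x => g x - g2/4 * (x - x0)^2) x0 := by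
    apply isLocalMax_of_deriv_deriv_neg
    · rw [hev.deriv_eq, hd2.deriv]; linarith
    · rw [hev.eq_of_nhds, hd0]; simp
    · have := h1.self_of_nhds.continuousAt
      fun_prop
  have hne : ∀ᶠ x in 𝓝[≠] x0, False := by
    have a1 := hmin.filter_mono (nhdsWithin_le_nhds (s := {x0}ᶜ))
    have a2 := hmax.filter_mono (nhdsWithin_le_nhds (s := {x0}ᶜ))
    filter_upwards [a1, a2, self_mem_nhdsWithin] with x b1 b2 b3
    have : 0 < (x - x0)^2 := by
      have : x - x0 ≠ 0 := sub_ne_zero.2 b3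
      positivity
    simp only [sub_self] at b2
    nlinarith
  exact (hne.exists).elim fun _ h => h

section
variable {n : ℕ}

lemma mp_shear {c : (Fin n → ℂ) → ℝ} (hc : Continuous c) :
    MeasurePreserving (fun u : Hn n => ((u.1, u.2 + c u.1) : Hn n)) volume volume := by
  refine MeasurePreserving.skew_product (f := id) (g := fun x t => t + c x) (MeasurePreserving.id _) ?_ ?_
  · fun_prop
  · exact Eventually.of_forall fun x => (measurePreserving_add_right volume (c x)).map_eq

/-- right translate -/
def rt (χ : Hn n → ℂ) (w u : Hn n) : ℂ := χ (u + (-1:ℝ) • xi w u)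

lemma Tst.rt {χ : Hn n → ℂ} (h : Tst χ) (w : Hn n) : Tst (rt χ w) := h.fl (FlV_xi w) (-1)

lemma cof_left (w e u : Hn n) (s : ℝ) : cof (w + s • xi e w) u = cof w u + s * cof e u := by
  rw [cof_antisymm, map_add, map_smul, xi, map_add, map_smul]
  have : cof u (eT n) = 0 := by simp [cof_apply, eT]
  rw [this, cof_antisymm w u, cof_antisymm e u]; simp; ring

lemma rt_flow (χ : Hn n → ℂ) (w e : Hn n) (s : ℝ) :
    rt χ (w + s • xi e w) = fun u => rt χ w (u + (-s) • xi e u) := by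
  funext u
  unfold rt
  congr 1
  have h2 : ∀ w : Hn n, cof w (eT n) = 0 := fun w => by simp [cof_apply, eT]
  simp only [xi, map_add, map_smul, h2, smul_eq_mul, mul_zero, add_zero]
  have := cof_left w e u s
  simp only [xi] at this
  rw [this, cof_antisymm w e]
  module

lemma rt_zero (χ : Hn n → ℂ) : rt χ 0 = χ := by
  funext u
  have : cof (0 : Hn n) u = 0 := by simp [cof_apply]
  simp [rt, xi, this]

lemma mp_rt (w : Hn n) : MeasurePreserving (fun u : Hn n => u + (-1:ℝ) • xi w u) volume volume := by
  have h1 := mp_shear (n := n) (c := fun x => - cof w (x, 0)) (by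
    have := (cof w).continuous; fun_prop)
  have h2 := (measurePreserving_add_right (volume : Measure (Hn n)) (-w)).comp h1
  convert h2 using 2 with u
  have : cof w u = cof w (u.1, 0) := by simp [cof_apply]
  ext <;> simp [xi, this, eT, sub_eq_add_neg] <;> ring

lemma integral_norm_rt (χ : Hn n → ℂ) (w : Hn n) : ∫ u, ‖rt χ w u‖ = ∫ u, ‖χ u‖ := by
  have h : MeasurableEmbedding (fun u : Hn n => u + (-1:ℝ) • xi w u) := (flH (FlV_xi w) (-1)).measurableEmbedding
  exact (mp_rt w).integral_comp h (fun u => ‖χ u‖)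

lemma continuous_xi2 : Continuous (fun q : Hn n × Hn n => xi q.1 q.2) := by
  have : (fun q : Hn n × Hn n => xi q.1 q.2) = fun q => q.1 + (2 * ∑ i, (q.2.1 i * (starRingEnd ℂ) (q.1.1 i)).im) • eT n := by
    funext q; rw [xi, cof_apply]
  rw [this]
  have h : Continuous fun q : Hn n × Hn n => ∑ i, (q.2.1 i * (starRingEnd ℂ) (q.1.1 i)).im := by
    refine continuous_finsetSum _ fun i _ => ?_
    exact Complex.continuous_im.comp (by fun_prop)
  fun_prop

lemma rt_cont {χ : Hn n → ℂ} (h : Tst χ) (w0 : Hn n) :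
    Tendsto (fun w => ∫ u, ‖rt χ w u - rt χ w0 u‖) (𝓝 w0) (𝓝 0) := by
  have hcs : Continuous (fun q : Hn n × Hn n => q.2 + xi q.1 q.2) := continuous_snd.add continuous_xi2
  have hcs' : Continuous (fun q : Hn n × Hn n => q.2 + (-1:ℝ) • xi q.1 q.2) :=
    continuous_snd.add (continuous_const.fun_smul continuous_xi2)
  set k := (fun q : Hn n × Hn n => q.2 + xi q.1 q.2) '' (Metric.closedBall w0 1 ×ˢ tsupport χ)
  have hk : IsCompact k := ((isCompact_closedBall _ _).prod h.2).image hcs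
  have hz : ∀ w ∈ Metric.closedBall w0 1, ∀ u ∉ k, rt χ w u = 0 := by
    intro w hw u hu
    by_contra h0
    refine hu ⟨(w, u + (-1:ℝ) • xi w u), ⟨hw, subset_tsupport _ h0⟩, ?_⟩
    have := fl_inv (FlV_xi w) (-1) u
    simpa using this
  have hc : ContinuousOn (fun w => ∫ u, ‖rt χ w u - rt χ w0 u‖) (Metric.closedBall w0 1) := by
    refine continuousOn_integral_of_compact_support hk ?_ ?_
    · apply Continuous.continuousOn
      have c1 : Continuous (fun q : Hn n × Hn n => rt χ q.1 q.2) := h.continuous.comp hcs'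
      have c2 : Continuous (fun q : Hn n × Hn n => rt χ w0 q.2) := (h.rt w0).continuous.comp continuous_snd
      exact (c1.sub c2).norm
    · intro w u hw hu
      rw [hz w hw u hu, hz w0 (by simp) u hu]; simp
  have := (hc.continuousAt (Metric.closedBall_mem_nhds w0 one_pos)).tendsto
  simpa using this

/-- the barrier -/
def om (q : Sg n) : ℂ := ((1 + ∑ j, ‖q.1.1 j‖ ^ 2 + q.2 : ℝ) : ℂ) - Complex.I * (q.1.2 : ℂ)

lemma om_re (q : Sg n) : (om q).re = 1 + ∑ j, ‖q.1.1 j‖ ^ 2 + q.2 := by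
  rw [om, Complex.sub_re, Complex.ofReal_re]; simp
lemma om_im (q : Sg n) : (om q).im = - q.1.2 := by
  rw [om, Complex.sub_im, Complex.ofReal_im]; simp
lemma om_re_ge {q : Sg n} (h : 0 ≤ q.2) : 1 ≤ (om q).re := by
  rw [om_re]; have : 0 ≤ ∑ j, ‖q.1.1 j‖ ^ 2 := by positivity
  linarith
lemma om_slit {q : Sg n} (h : 0 ≤ q.2) : om q ∈ Complex.slitPlane := Or.inl (by linarith [om_re_ge h])
lemma om_cont : Continuous (om (n := n)) := by unfold om; fun_prop

lemma om_eX (w : Hn n) (a s : ℝ) (j : Fin n) :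
    om (w + s • xi (eX n j) w, a) = om (w, a) + s * (2 * (starRingEnd ℂ) (w.1 j)) + s^2 * 1 := by
  have e : ∀ i, ‖(w + s • xi (eX n j) w).1 i‖^2 = ‖w.1 i‖^2 + (if i = j then 2 * s * (w.1 j).re + s^2 else 0) := by
    intro i
    simp only [Complex.sq_norm, Complex.normSq_apply, xi, eX, eT]
    split_ifs with h
    · subst h; simp; ring
    · simp [h]
  apply Complex.ext
  · rw [om_re]; simp only [e, Finset.sum_add_distrib, Finset.sum_ite_eq', Finset.mem_univ, if_true]
    simp [om_re, pow_two]; ring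
  · rw [om_im]; have hc := cof_eX j w; simp only [xi, hc]; simp [om_im, pow_two, eX, eT]; ring
lemma om_eY (w : Hn n) (a s : ℝ) (j : Fin n) :
    om (w + s • xi (eY n j) w, a) = om (w, a) + s * (2 * Complex.I * (starRingEnd ℂ) (w.1 j)) + s^2 * 1 := by
  have e : ∀ i, ‖(w + s • xi (eY n j) w).1 i‖^2 = ‖w.1 i‖^2 + (if i = j then 2 * s * (w.1 j).im + s^2 else 0) := by
    intro i
    simp only [Complex.sq_norm, Complex.normSq_apply, xi, eY, eT]
    split_ifs with h
    · subst h; simp; ring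
    · simp [h]
  apply Complex.ext
  · rw [om_re]; simp only [e, Finset.sum_add_distrib, Finset.sum_ite_eq', Finset.mem_univ, if_true]
    simp [om_re, pow_two]; ring
  · rw [om_im]; have hc := cof_eY j w; simp only [xi, hc]; simp [om_im, pow_two, eY, eT]; ring
lemma om_eT (w : Hn n) (a s : ℝ) :
    om (w + s • xi (eT n) w, a) = om (w, a) + s * (-Complex.I) + s^2 * 0 := by
  apply Complex.ext
  · rw [om_re]; simp [om_re, xi, eT]
  · rw [om_im]; have hc := cof_eT w; simp only [xi, hc]; simp [om_im, eT]; ring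

structure KF (α : ℝ) (K K1 K2 : (Hn n → ℂ) → ℝ → ℂ) (C : ℝ) : Prop where
  lin : ∀ a, 0 < a → Lin1 (fun χ => K χ a) C
  d1 : ∀ χ, Tst χ → ∀ a, 0 < a → HasDerivAt (K χ) (K1 χ a) a
  d2 : ∀ χ, Tst χ → ∀ a, 0 < a → HasDerivAt (K1 χ) (K2 χ a) a
  ode : ∀ χ, Tst χ → ∀ a : ℝ, 0 < a → -(α : ℂ) * (a : ℂ) * (K (LL χ) a + (n : ℂ) * K1 χ a)
      + (a : ℂ) ^ 2 * (K2 χ a + K (LD (eT n) (LD (eT n) χ)) a) = 0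
  lim : ∀ χ, Tst χ → Tendsto (K χ) (𝓝[>] 0) (𝓝 0)

end

section
variable {n : ℕ} {α : ℝ} {K K1 K2 : (Hn n → ℂ) → ℝ → ℂ} {C : ℝ} {χ : Hn n → ℂ}

def PhiK (K : (Hn n → ℂ) → ℝ → ℂ) (χ : Hn n → ℂ) (c : ℂ) (q : Sg n) : ℝ :=
  if 0 < q.2 then (c * K (rt χ q.1) q.2).re else 0

def vK (ε : ℝ) (K : (Hn n → ℂ) → ℝ → ℂ) (χ : Hn n → ℂ) (c : ℂ) (q : Sg n) : ℝ :=
  ε * ((Complex.log (om q)).re + q.2) - PhiK K χ c q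

lemma re_comp_hasDerivAt {g : ℝ → ℂ} {g' : ℂ} {x : ℝ} (h : HasDerivAt g g' x) :
    HasDerivAt (fun s => (g s).re) g'.re x := by
  exact (Complex.reCLM.hasFDerivAt (x := g x)).comp_hasDerivAt x h

lemma PhiK_cont (hK : KF α K K1 K2 C) (hχ : Tst χ) (c : ℂ) :
    ContinuousOn (PhiK K χ c) {q : Sg n | 0 ≤ q.2} := by
  intro q0 hq0
  have hq0 : 0 ≤ q0.2 := hq0
  -- the one-variable part
  set h : ℝ → ℂ := fun a => if 0 < a then K (rt χ q0.1) a else 0 with hh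
  have hc1 : ContinuousWithinAt h (Ici 0) q0.2 := by
    rcases hq0.eq_or_lt with h0 | h0
    · rw [← h0]
      have : h 0 = 0 := by simp [hh]
      have l := hK.lim _ (hχ.rt q0.1)
      rw [← Ioi_insert (a := (0:ℝ)), continuousWithinAt_insert_self, ContinuousWithinAt, this]
      refine l.congr' ?_
      filter_upwards [self_mem_nhdsWithin] with a ha
      simp only [hh, if_pos (show 0 < a from ha)]
    · apply ContinuousAt.continuousWithinAt
      refine (hK.d1 _ (hχ.rt q0.1) _ h0).continuousAt.congr ?_
      filter_upwards [lt_mem_nhds h0] with a ha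
      simp [hh, ha]
  have hc2 : Tendsto (fun q : Sg n => h q.2) (𝓝[{q : Sg n | 0 ≤ q.2}] q0) (𝓝 (h q0.2)) := by
    refine hc1.tendsto.comp ?_
    refine tendsto_nhdsWithin_iff.2 ⟨(continuous_snd.continuousAt).continuousWithinAt, ?_⟩
    filter_upwards [self_mem_nhdsWithin] with q hq
    exact hq
  have hc3 : Tendsto (fun q : Sg n => |C| * ∫ u, ‖rt χ q.1 u - rt χ q0.1 u‖) (𝓝[{q : Sg n | 0 ≤ q.2}] q0) (𝓝 0) := by
    have := ((rt_cont hχ q0.1).comp (continuous_fst.tendsto q0)).const_mul |C|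
    rw [mul_zero] at this
    exact this.mono_left nhdsWithin_le_nhds
  have hc4 : Tendsto (fun q : Sg n => (if 0 < q.2 then K (rt χ q.1) q.2 else 0) - h q.2) (𝓝[{q : Sg n | 0 ≤ q.2}] q0) (𝓝 0) := by
    refine squeeze_zero_norm (fun q => ?_) hc3
    have i0 : 0 ≤ ∫ u, ‖rt χ q.1 u - rt χ q0.1 u‖ := integral_nonneg fun _ => norm_nonneg _
    by_cases hq : 0 < q.2
    · simp only [hh, if_pos hq]
      have := (hK.lin _ hq).sub (hχ.rt q.1) (hχ.rt q0.1)
      rw [← this]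
      refine ((hK.lin _ hq).bd _ ((hχ.rt q.1).sub (hχ.rt q0.1))).trans ?_
      exact mul_le_mul_of_nonneg_right (le_abs_self C) i0
    · simp only [hh, if_neg hq, sub_self, norm_zero]; positivity
  have hc5 := hc4.add hc2
  simp only [sub_add_cancel, zero_add] at hc5
  have hc6 := (Complex.continuous_re.tendsto _).comp (hc5.const_mul c)
  refine (hc6.congr fun q => ?_).trans (le_of_eq ?_)
  · simp only [Function.comp, PhiK]; split_ifs <;> simp
  · simp only [PhiK, hh]; split_ifs <;> simp

lemma PhiK_bd (hK : KF α K K1 K2 C) (hχ : Tst χ) (c : ℂ) (q : Sg n) :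
    PhiK K χ c q ≤ ‖c‖ * (|C| * ∫ u, ‖χ u‖) := by
  have i0 : 0 ≤ ∫ u, ‖χ u‖ := integral_nonneg fun _ => norm_nonneg _
  unfold PhiK; split_ifs with hq
  · refine (Complex.re_le_norm _).trans ?_
    rw [norm_mul]
    refine mul_le_mul_of_nonneg_left (((hK.lin _ hq).bd _ (hχ.rt q.1)).trans ?_) (norm_nonneg _)
    rw [integral_norm_rt]
    exact mul_le_mul_of_nonneg_right (le_abs_self C) i0
  · positivity

lemma logom_nonneg {q : Sg n} (h : 0 ≤ q.2) : 0 ≤ (Complex.log (om q)).re := by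
  rw [Complex.log_re]
  exact Real.log_nonneg ((om_re_ge h).trans (Complex.re_le_norm _))

lemma om_bounded {q : Sg n} {R : ℝ} (h : 0 ≤ q.2) (hR : (Complex.log (om q)).re + q.2 ≤ R) :
    q.2 ≤ Real.exp R ∧ ‖q.1‖ ≤ Real.exp R := by
  have h1 := logom_nonneg h
  have h2 : ‖om q‖ ≤ Real.exp R := by
    have : Real.log ‖om q‖ ≤ R := by rw [← Complex.log_re]; linarith
    have hp : 0 < ‖om q‖ := by linarith [(om_re_ge h).trans (Complex.re_le_norm (om q))]
    rwa [Real.log_le_iff_le_exp hp] at this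
  have h3 : 1 + ∑ j, ‖q.1.1 j‖ ^ 2 + q.2 ≤ Real.exp R := by
    rw [← om_re]; exact (Complex.re_le_norm _).trans h2
  have hs : 0 ≤ ∑ j, ‖q.1.1 j‖ ^ 2 := by positivity
  refine ⟨by linarith, ?_⟩
  rw [Prod.norm_def, max_le_iff]
  constructor
  · refine (pi_norm_le_iff_of_nonneg (Real.exp_pos R).le).2 fun i => ?_
    have := Finset.single_le_sum (f := fun j => ‖q.1.1 j‖ ^ 2) (fun j _ => by positivity) (Finset.mem_univ i)
    nlinarith [sq_nonneg (‖q.1.1 i‖ - 1), norm_nonneg (q.1.1 i)]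
  · have := (Complex.abs_im_le_norm (om q)).trans h2
    rw [om_im, abs_neg] at this
    exact this

lemma vK_cont (hK : KF α K K1 K2 C) (hχ : Tst χ) (c : ℂ) (ε : ℝ) :
    ContinuousOn (vK ε K χ c) {q : Sg n | 0 ≤ q.2} := by
  have h1 : ContinuousOn (fun q : Sg n => (Complex.log (om q)).re) {q : Sg n | 0 ≤ q.2} := by
    refine Complex.continuous_re.comp_continuousOn ?_
    exact om_cont.continuousOn.clog fun q hq => om_slit hq
  exact ((h1.add continuous_snd.continuousOn).const_smul ε).sub (PhiK_cont hK hχ c)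

lemma vK_min (hK : KF α K K1 K2 C) (hχ : Tst χ) (c : ℂ) {ε : ℝ} (hε : 0 < ε) {q0 : Sg n} (h0 : 0 ≤ q0.2)
    (hneg : vK ε K χ c q0 < 0) : ∃ q1 : Sg n, 0 < q1.2 ∧ ∀ q : Sg n, 0 ≤ q.2 → vK ε K χ c q1 ≤ vK ε K χ c q := by
  set R := ‖c‖ * (|C| * ∫ u, ‖χ u‖) / ε
  have hB : ∀ q : Sg n, 0 ≤ q.2 → vK ε K χ c q ≤ 0 → q ∈ (Metric.closedBall 0 (Real.exp R) : Set (Hn n)) ×ˢ Icc 0 (Real.exp R) := by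
    intro q hq hv
    have : (Complex.log (om q)).re + q.2 ≤ R := by
      rw [le_div_iff₀ hε]
      have := PhiK_bd hK hχ c q
      unfold vK at hv; linarith
    obtain ⟨a1, a2⟩ := om_bounded hq this
    exact ⟨by simpa using a2, hq, a1⟩
  have hcpt : IsCompact ((Metric.closedBall 0 (Real.exp R) : Set (Hn n)) ×ˢ Icc 0 (Real.exp R)) :=
    (isCompact_closedBall _ _).prod isCompact_Icc
  obtain ⟨q1, hq1, hmin⟩ := hcpt.exists_isMinOn ⟨q0, hB q0 h0 hneg.le⟩ ((vK_cont hK hχ c ε).mono fun q hq => hq.2.1)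
  have hv1 : vK ε K χ c q1 < 0 := (hmin (hB q0 h0 hneg.le)).trans_lt hneg
  refine ⟨q1, ?_, fun q hq => ?_⟩
  · rcases (show 0 ≤ q1.2 from hq1.2.1).eq_or_lt with h | h
    · exfalso
      have e : vK ε K χ c q1 = ε * (Complex.log (om q1)).re := by simp [vK, PhiK, ← h]
      rw [e] at hv1
      have := mul_nonneg hε.le (logom_nonneg (q := q1) h.le)
      linarith
    · exact h
  · by_cases hv : vK ε K χ c q ≤ 0
    · exact hmin (hB q hq hv)
    · push Not at hv; exact (hv1.trans hv).le

lemma dirtest (hK : KF α K K1 K2 C) (hχ : Tst χ) (c : ℂ) {ε : ℝ} {w : Hn n} {a : ℝ} (ha : 0 < a)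
    (hmin : ∀ q : Sg n, 0 ≤ q.2 → vK ε K χ c (w, a) ≤ vK ε K χ c q) (e : Hn n) (b d : ℂ)
    (hom : ∀ s : ℝ, om (w + s • xi e w, a) = om (w, a) + s * b + s^2 * d) :
    0 ≤ ε * (2 * d / om (w, a) - b^2 / om (w, a)^2).re - (c * K (LD e (LD e (rt χ w))) a).re := by
  have hs : ∀ s : ℝ, om (w, a) + s * b + s^2 * d ∈ Complex.slitPlane := fun s => by
    rw [← hom]; exact om_slit ha.le
  have hκ := hχ.rt w
  have hV := FlV_xi e
  have hm := hK.lin a ha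
  have kd : ∀ {κ : Hn n → ℂ} (_ : Tst κ) (s : ℝ), HasDerivAt (fun s : ℝ => K (fun u => κ (u + (-s) • xi e u)) a)
      (- K (fun u => LD e κ (u + (-s) • xi e u)) a) s := by
    intro κ hκ s
    have := (hm.hasDerivAt_fl hκ hV (-s)).scomp s (hasDerivAt_neg s)
    refine this.congr_deriv ?_
    simp only [neg_one_smul]; rfl
  have hp : ∀ s : ℝ, HasDerivAt (fun s : ℝ => om (w, a) + s * b + s^2 * d) (b + 2 * s * d) s := by
    intro s
    have h1 : HasDerivAt (fun s : ℝ => (s : ℂ)) 1 s := Complex.ofRealCLM.hasDerivAt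
    have := ((h1.mul_const b).const_add (om (w, a))).fun_add ((h1.fun_pow 2).mul_const d)
    refine this.congr_deriv ?_
    simp
  refine second_deriv_nonneg (x0 := 0) (g := fun s : ℝ => vK ε K χ c (w + s • xi e w, a))
    (g1 := fun s : ℝ => ε * ((b + 2 * s * d) / (om (w, a) + s * b + s^2 * d)).re
      - (c * (- K (fun u => LD e (rt χ w) (u + (-s) • xi e u)) a)).re) ?_ ?_ ?_
  · exact Eventually.of_forall fun s => by simpa using hmin (w + s • xi e w, a) ha.le
  · refine Eventually.of_forall fun s => ?_
    have e1 : (fun s : ℝ => vK ε K χ c (w + s • xi e w, a)) = fun s : ℝ =>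
        ε * ((Complex.log (om (w, a) + s * b + s^2 * d)).re + a) - (c * K (fun u => rt χ w (u + (-s) • xi e u)) a).re := by
      funext s
      simp only [vK, hom, PhiK, if_pos ha, rt_flow]
    rw [e1]
    have d1 := ((re_comp_hasDerivAt ((hp s).clog_real (hs s))).add_const a).const_mul ε
    exact d1.sub (re_comp_hasDerivAt ((kd hκ s).const_mul c))
  · have h1 : HasDerivAt (fun s : ℝ => (s : ℂ)) 1 0 := Complex.ofRealCLM.hasDerivAt
    have n1 : HasDerivAt (fun s : ℝ => b + 2 * s * d) (2 * d) 0 := by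
      refine (((h1.const_mul 2).mul_const d).const_add b).congr_deriv ?_
      simp
    have hne : om (w, a) + ((0:ℝ):ℂ) * b + ((0:ℝ):ℂ)^2 * d ≠ 0 := Complex.slitPlane_ne_zero (hs 0)
    have d1 := (re_comp_hasDerivAt (n1.fun_div (hp 0) hne)).const_mul ε
    have d2 := d1.sub (re_comp_hasDerivAt ((kd (hκ.LD e) 0).neg.const_mul c))
    refine d2.congr_deriv ?_
    have hne' : om (w, a) ≠ 0 := by simpa using hne
    have e2 : (fun u => LD e (LD e (rt χ w)) (u + (-(0:ℝ)) • xi e u)) = LD e (LD e (rt χ w)) := by simp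
    rw [e2]
    congr 3
    · simp; field_simp
    · simp

lemma atest (hK : KF α K K1 K2 C) (hχ : Tst χ) (c : ℂ) {ε : ℝ} {w : Hn n} {a : ℝ} (ha : 0 < a)
    (hmin : ∀ q : Sg n, 0 ≤ q.2 → vK ε K χ c (w, a) ≤ vK ε K χ c q) :
    ε * ((1 / om (w, a)).re + 1) - (c * K1 (rt χ w) a).re = 0 ∧
    0 ≤ ε * (-1 / om (w, a)^2).re - (c * K2 (rt χ w) a).re := by
  have hκ := hχ.rt w
  have hom : ∀ b : ℝ, om (w, b) = om (w, 0) + b := by intro b; simp [om]; ring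
  have hp : ∀ b : ℝ, HasDerivAt (fun s : ℝ => om (w, 0) + s) 1 b := fun b =>
    HasDerivAt.const_add _ Complex.ofRealCLM.hasDerivAt
  have hs : ∀ s : ℝ, 0 ≤ s → om (w, 0) + s ∈ Complex.slitPlane := fun s h => by
    rw [← hom]; exact om_slit h
  have hloc : IsLocalMin (fun s : ℝ => vK ε K χ c (w, s)) a := by
    filter_upwards [lt_mem_nhds ha] with s hs
    exact hmin (w, s) hs.le
  have hd : ∀ b : ℝ, 0 < b → HasDerivAt (fun s : ℝ => vK ε K χ c (w, s))
      (ε * ((1 / (om (w, 0) + b)).re + 1) - (c * K1 (rt χ w) b).re) b := by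
    intro b hb
    have d1 := ((re_comp_hasDerivAt ((hp b).clog_real (hs b hb.le))).fun_add (hasDerivAt_id' b)).const_mul ε
    have d2 := d1.sub (re_comp_hasDerivAt ((hK.d1 _ hκ b hb).const_mul c))
    refine d2.congr_of_eventuallyEq ?_
    filter_upwards [lt_mem_nhds hb] with s hs
    simp [vK, PhiK, hs, hom s]
  constructor
  · have := hloc.hasDerivAt_eq_zero (hd a ha)
    rwa [← hom] at this
  · refine second_deriv_nonneg hloc (by filter_upwards [lt_mem_nhds ha] with s hs using hd s hs) ?_
    have d1 := (((re_comp_hasDerivAt (((hasDerivAt_const a (1:ℂ)).fun_div (hp a) (Complex.slitPlane_ne_zero (hs a ha.le)))))).add_const 1).const_mul ε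
    have d2 := d1.sub (re_comp_hasDerivAt ((hK.d2 _ hκ a ha).const_mul c))
    refine d2.congr_deriv ?_
    rw [← hom]; simp

lemma vK_nonneg (hn : 1 ≤ n) (hα : 0 < α) (hK : KF α K K1 K2 C) (hχ : Tst χ) (c : ℂ) {ε : ℝ} (hε : 0 < ε) {q0 : Sg n}
    (h0 : 0 ≤ q0.2) : 0 ≤ vK ε K χ c q0 := by
  by_contra hneg
  push Not at hneg
  obtain ⟨⟨w, a⟩, ha, hmin⟩ := vK_min hK hχ c hε h0 hneg
  replace ha : 0 < a := ha
  obtain ⟨a1, a2⟩ := atest hK hχ c ha hmin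
  have tX := fun j => dirtest hK hχ c ha hmin (eX n j) _ _ (fun s => om_eX w a s j)
  have tY := fun j => dirtest hK hχ c ha hmin (eY n j) _ _ (fun s => om_eY w a s j)
  have tT := dirtest hK hχ c ha hmin (eT n) _ _ (fun s => om_eT w a s)
  have hκ := hχ.rt w
  have hode := congrArg Complex.re (congrArg (fun z => c * z) (hK.ode _ hκ a ha))
  have hm := hK.lin a ha
  have hLL : K (LL (rt χ w)) a = -(1/4) * ∑ j, (K (LD (eX n j) (LD (eX n j) (rt χ w))) a + K (LD (eY n j) (LD (eY n j) (rt χ w))) a) := by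
    have tt : ∀ j ∈ Finset.univ, Tst (fun p => LD (eX n j) (LD (eX n j) (rt χ w)) p + LD (eY n j) (LD (eY n j) (rt χ w)) p) :=
      fun j _ => ((hκ.LD _).LD _).add ((hκ.LD _).LD _)
    have := hm.smul (-(1/4)) _ (Tst.sum Finset.univ tt)
    have e : LL (rt χ w) = fun p => -(1/4) * ∑ j, (LD (eX n j) (LD (eX n j) (rt χ w)) p + LD (eY n j) (LD (eY n j) (rt χ w)) p) := by
      funext p; rfl
    rw [e, this, hm.sum _ tt]
    congr 1
    refine Finset.sum_congr rfl fun j _ => ?_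
    exact hm.add _ _ ((hκ.LD _).LD _) ((hκ.LD _).LD _)
  rw [hLL] at hode
  generalize om (w, a) = om0 at *
  have hsum : 0 ≤ ∑ j : Fin n, (ε * (4 * (1 / om0).re) - (c * (K (LD (eX n j) (LD (eX n j) (rt χ w))) a + K (LD (eY n j) (LD (eY n j) (rt χ w))) a)).re) := by
    refine Finset.sum_nonneg fun j _ => ?_
    have e : (2 * 1 / om0 - (2 * (starRingEnd ℂ) (w.1 j)) ^ 2 / om0 ^ 2).re +
       (2 * 1 / om0 - (2 * Complex.I * (starRingEnd ℂ) (w.1 j)) ^ 2 / om0 ^ 2).re = 4 * (1 / om0).re := by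
      rw [← Complex.add_re]
      have : (2 * 1 / om0 - (2 * (starRingEnd ℂ) (w.1 j)) ^ 2 / om0 ^ 2) +
       (2 * 1 / om0 - (2 * Complex.I * (starRingEnd ℂ) (w.1 j)) ^ 2 / om0 ^ 2) = ((4:ℝ):ℂ) * (1 / om0) := by
        push_cast
        linear_combination (-(4 * (starRingEnd ℂ) (w.1 j) ^ 2 / om0 ^ 2)) * Complex.I_sq
      rw [this, Complex.re_ofReal_mul]
    rw [← e, mul_add, mul_add, Complex.add_re]
    linarith [tX j, tY j]
  rw [Finset.sum_sub_distrib, Finset.sum_const, ← Complex.re_sum, ← Finset.mul_sum] at hsum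
  generalize (∑ j, (K (LD (eX n j) (LD (eX n j) (rt χ w))) a + K (LD (eY n j) (LD (eY n j) (rt χ w))) a)) = Sg0 at *
  simp only [Finset.card_univ, Fintype.card_fin, nsmul_eq_mul] at hsum
  generalize K1 (rt χ w) a = k1 at *
  generalize K2 (rt χ w) a = k2 at *
  generalize K (LD (eT n) (LD (eT n) (rt χ w))) a = kT at *
  have o2 : c * (-(α : ℂ) * (a : ℂ) * (-(1/4) * Sg0 + (n : ℂ) * k1) + (a : ℂ) ^ 2 * (k2 + kT))
      = ((α * a / 4 : ℝ) : ℂ) * (c * Sg0) - ((α * a * n : ℝ) : ℂ) * (c * k1) + ((a^2 : ℝ) : ℂ) * (c * k2) + ((a^2 : ℝ) : ℂ) * (c * kT) := by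
    push_cast; ring
  rw [o2] at hode
  simp only [Complex.add_re, Complex.sub_re, Complex.re_ofReal_mul, mul_zero, Complex.zero_re] at hode
  have eT2 : (2 * 0 / om0 - (-Complex.I) ^ 2 / om0 ^ 2).re = - (-1 / om0^2).re := by
    rw [neg_sq, Complex.I_sq]; simp
  rw [eT2] at tT
  have hn' : (1:ℝ) ≤ n := by exact_mod_cast hn
  have p1 : 0 ≤ α * a / 4 * ((n:ℝ) * (ε * (4 * (1 / om0).re)) - (c * Sg0).re) := mul_nonneg (by positivity) hsum
  have p2 := mul_nonneg (sq_nonneg a) a2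
  have p3 := mul_nonneg (sq_nonneg a) tT
  have p4 : 0 < α * a * n * ε := by positivity
  have p5 : α * a * n * (ε * ((1 / om0).re + 1) - (c * k1).re) = 0 := by rw [a1, mul_zero]
  nlinarith

theorem KF.zero (hn : 1 ≤ n) (hα : 0 < α) (hK : KF α K K1 K2 C) (hχ : Tst χ) {a : ℝ} (ha : 0 < a) : K χ a = 0 := by
  have key : ∀ c : ℂ, (c * K χ a).re ≤ 0 := by
    intro c
    have h1 : ∀ ε : ℝ, 0 < ε → (c * K χ a).re ≤ ε * ((Complex.log (om ((0 : Hn n), a))).re + a) := by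
      intro ε hε
      have := vK_nonneg hn hα hK hχ c hε (q0 := ((0 : Hn n), a)) ha.le
      simp only [vK, PhiK, if_pos ha, rt_zero] at this
      linarith
    have l : Tendsto (fun ε : ℝ => ε * ((Complex.log (om ((0 : Hn n), a))).re + a)) (𝓝[>] 0) (𝓝 0) := by
      have : Tendsto (fun ε : ℝ => ε * ((Complex.log (om ((0 : Hn n), a))).re + a)) (𝓝 0) (𝓝 (0 * _)) :=
        tendsto_id.mul_const _
      rw [zero_mul] at this
      exact this.mono_left nhdsWithin_le_nhds
    refine ge_of_tendsto l ?_
    filter_upwards [self_mem_nhdsWithin] with ε hε using h1 ε hε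
  have h2 := key ((starRingEnd ℂ) (K χ a))
  rw [mul_comm, Complex.mul_conj, Complex.ofReal_re] at h2
  exact Complex.normSq_eq_zero.1 (le_antisymm h2 (Complex.normSq_nonneg _))
end

/-- flat directional derivative -/
def FD {n : ℕ} (v : Hn n) (χ : Hn n → ℂ) : Hn n → ℂ := VD (fun _ => v) χ
def dv {n : ℕ} (k : Fin n × Bool) : Hn n := if k.2 then eY n k.1 else eX n k.1
def co {n : ℕ} (k : Fin n × Bool) (y : Fin n → ℂ) : ℝ := if k.2 then (y k.1).im else (y k.1).re
def gau {n : ℕ} (y : Fin n → ℂ) : ℝ := Real.exp (- ∑ j, ‖y j‖ ^ 2)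

section
variable {n : ℕ} {m : (Hn n → ℂ) → ℂ} {C : ℝ} {χ κ : Hn n → ℂ}

lemma Tst.FD (h : Tst χ) (v : Hn n) : Tst (FD v χ) := h.VD (FlV_const v)
lemma Tst.tr (h : Tst χ) (v : Hn n) : Tst (fun u => χ (u + v)) := by
  simpa using h.fl (FlV_const v) 1

lemma FD_tr (χ : Hn n → ℂ) (v w : Hn n) : FD v (fun u => χ (u + w)) = fun u => FD v χ (u + w) := by
  funext u; simp only [FD, VD]; rw [fderiv_comp_add_right]

lemma dv_snd (k : Fin n × Bool) : (dv k).2 = 0 := by unfold dv; split_ifs <;> simp [eX, eY]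
lemma dv_eta (k : Fin n × Bool) : (((dv k).1, 0) : Hn n) = dv k := by ext <;> simp [dv_snd]

lemma y_decomp (y : Fin n → ℂ) : ((y, 0) : Hn n) = ∑ k : Fin n × Bool, co k y • dv k := by
  rw [Fintype.sum_prod_type]
  simp only [Fintype.sum_bool, dv, co, if_true]
  apply Prod.ext
  · funext i
    rw [Prod.fst_sum]
    simp [eX, eY]
    rw [Finset.sum_add_distrib, Finset.sum_ite_eq, Finset.sum_ite_eq]
    simp only [Finset.mem_univ, if_true]
    rw [add_comm]; exact (Complex.re_add_im _).symm
  · rw [Prod.snd_sum]; simp [eX, eY]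

lemma FD_decomp (y : Fin n → ℂ) (χ : Hn n → ℂ) :
    FD ((y, 0) : Hn n) χ = fun p => ∑ k : Fin n × Bool, (co k y : ℂ) * FD (dv k) χ p := by
  funext p
  simp only [FD, VD]
  rw [y_decomp, map_sum]
  simp

def bb (m : (Hn n → ℂ) → ℂ) (χ : Hn n → ℂ) (x : Fin n → ℂ) : ℂ := m (fun u => χ (u + ((x, 0) : Hn n)))

lemma bb_zero (χ : Hn n → ℂ) : bb m χ 0 = m χ := by
  have : (((0 : Fin n → ℂ), (0:ℝ)) : Hn n) = 0 := rfl
  simp only [bb, this, add_zero]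

lemma bb_bd (hm : Lin1 m C) (h : Tst χ) (x : Fin n → ℂ) : ‖bb m χ x‖ ≤ |C| * ∫ p, ‖χ p‖ := by
  refine (hm.bd _ (h.tr _)).trans ?_
  rw [integral_add_right_eq_self (fun u => ‖χ u‖)]
  exact mul_le_mul_of_nonneg_right (le_abs_self C) (integral_nonneg fun _ => norm_nonneg _)

lemma bb_deriv (hm : Lin1 m C) (h : Tst χ) (x y : Fin n → ℂ) (s : ℝ) :
    HasDerivAt (fun s : ℝ => bb m χ (x + s • y)) (bb m (FD ((y, 0) : Hn n) χ) (x + s • y)) s := by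
  have := hm.hasDerivAt_fl (h.tr ((x, 0) : Hn n)) (FlV_const ((y, 0) : Hn n)) s
  have e : ∀ (u : Hn n) (s : ℝ), u + s • ((y, 0) : Hn n) + ((x, 0) : Hn n) = u + ((x + s • y, 0) : Hn n) := by
    intro u s; ext <;> simp; ring
  have e2 := FD_tr χ ((y, 0) : Hn n) ((x, 0) : Hn n)
  simp only [FD] at e2
  rw [e2] at this
  simp only [e] at this
  exact this

lemma bb_decomp (hm : Lin1 m C) (h : Tst χ) (x y : Fin n → ℂ) :
    bb m (FD ((y, 0) : Hn n) χ) x = ∑ k : Fin n × Bool, (co k y : ℂ) * bb m (FD (dv k) χ) x := by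
  unfold bb
  rw [FD_decomp]
  rw [hm.sum Finset.univ (χ := fun k u => (co k y : ℂ) * FD (dv k) χ (u + ((x, 0) : Hn n)))
    fun k _ => ((h.FD _).tr _).const_mul _]
  exact Finset.sum_congr rfl fun k _ => hm.smul _ _ ((h.FD _).tr _)

lemma abs_co_le (k : Fin n × Bool) (y : Fin n → ℂ) : |co k y| ≤ ‖y‖ := by
  unfold co; split_ifs
  · exact (Complex.abs_im_le_norm _).trans (norm_le_pi_norm y _)
  · exact (Complex.abs_re_le_norm _).trans (norm_le_pi_norm y _)

def Bd (C : ℝ) (χ : Hn n → ℂ) : ℝ := ∑ k : Fin n × Bool, |C| * ∫ p, ‖FD (dv k) χ p‖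
lemma Bd_nonneg (C : ℝ) (χ : Hn n → ℂ) : 0 ≤ Bd C χ :=
  Finset.sum_nonneg fun k _ => mul_nonneg (abs_nonneg _) (integral_nonneg fun _ => norm_nonneg _)

lemma bb_FD_bd (hm : Lin1 m C) (h : Tst χ) (x y : Fin n → ℂ) :
    ‖bb m (FD ((y, 0) : Hn n) χ) x‖ ≤ ‖y‖ * Bd C χ := by
  rw [bb_decomp hm h, Bd, Finset.mul_sum]
  refine norm_sum_le_of_le _ fun k _ => ?_
  rw [norm_mul, Complex.norm_real, Real.norm_eq_abs]
  exact mul_le_mul (abs_co_le k y) (bb_bd hm (h.FD _) x) (norm_nonneg _) (norm_nonneg _)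

lemma bb_cont (hm : Lin1 m C) (h : Tst χ) : Continuous (bb m χ) := by
  have : LipschitzWith (Bd C χ).toNNReal (bb m χ) := by
    refine LipschitzWith.of_dist_le_mul fun x x' => ?_
    have := Convex.norm_image_sub_le_of_norm_hasDerivWithin_le (s := univ) (x := (0:ℝ)) (y := 1)
      (f := fun r : ℝ => bb m χ (x' + r • (x - x'))) (C := ‖x - x'‖ * Bd C χ)
      (fun r _ => (bb_deriv hm h x' (x - x') r).hasDerivWithinAt) (fun r _ => bb_FD_bd hm h _ _) convex_univ trivial trivial
    rw [dist_eq_norm, dist_eq_norm, Real.coe_toNNReal _ (Bd_nonneg _ _)]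
    simpa [mul_comm] using this
  exact this.continuous

lemma gau_cont : Continuous (gau (n := n)) := by unfold gau; fun_prop

lemma gau_half_int : Integrable (fun y : Fin n → ℂ => Real.exp (- (1/2) * ∑ j, ‖y j‖ ^ 2)) := by
  have h1 : Integrable (fun z : ℂ => Real.exp (-(1/2) * ‖z‖^2)) := by
    have := (GaussianFourier.integrable_cexp_neg_mul_sq_norm_add (V := ℂ) (b := 1/2) (by norm_num) 0 0).norm
    refine this.congr (Eventually.of_forall fun z => ?_)
    simp only [Complex.norm_exp]
    simp [← Complex.ofReal_pow]
  have := Integrable.fintype_prod (ι := Fin n) (E := ℂ) (f := fun _ (z : ℂ) => Real.exp (-(1/2) * ‖z‖^2)) (μ := fun _ => volume) fun _ => h1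
  refine this.congr (Eventually.of_forall fun y => ?_)
  simp only []
  rw [Finset.mul_sum, Real.exp_sum]

lemma norm_sq_le (y : Fin n → ℂ) : ‖y‖^2 ≤ ∑ j, ‖y j‖^2 := by
  have h0 : 0 ≤ ∑ j, ‖y j‖^2 := by positivity
  have : ‖y‖ ≤ Real.sqrt (∑ j, ‖y j‖^2) := by
    refine (pi_norm_le_iff_of_nonneg (Real.sqrt_nonneg _)).2 fun i => ?_
    apply Real.le_sqrt_of_sq_le
    exact Finset.single_le_sum (f := fun j => ‖y j‖ ^ 2) (fun j _ => by positivity) (Finset.mem_univ i)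
  calc ‖y‖^2 ≤ (Real.sqrt (∑ j, ‖y j‖^2))^2 := by gcongr
    _ = _ := Real.sq_sqrt h0

lemma gau_int1 : Integrable (fun y : Fin n → ℂ => (1 + ‖y‖) * gau y) := by
  refine (gau_half_int.const_mul 2).mono' ?_ (Eventually.of_forall fun y => ?_)
  · exact ((by fun_prop : Continuous fun y : Fin n → ℂ => 1 + ‖y‖).mul gau_cont).aestronglyMeasurable
  · have h1 := norm_sq_le y
    rw [Real.norm_eq_abs, abs_of_nonneg (by unfold gau; positivity)]
    set r := ∑ j, ‖y j‖^2
    have e : gau y = Real.exp (-(1/2) * r) * Real.exp (-(1/2) * r) := by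
      rw [← Real.exp_add, gau]; congr 1; ring
    rw [e]
    have h2 : (1 + ‖y‖) * Real.exp (-(1/2) * r) ≤ 2 := by
      have h3 : 1 + (1/2) * r ≤ Real.exp ((1/2) * r) := by linarith [Real.add_one_le_exp ((1/2) * r)]
      rw [show -(1/2) * r = -((1/2) * r) by ring, Real.exp_neg, ← div_eq_mul_inv, div_le_iff₀ (Real.exp_pos _)]
      nlinarith [sq_nonneg (‖y‖ - 1)]
    nlinarith [Real.exp_pos (-(1/2) * r)]

lemma gau_pos (y : Fin n → ℂ) : 0 < gau y := Real.exp_pos _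
lemma gau_int : Integrable (gau (n := n)) := by
  refine gau_int1.mono' gau_cont.aestronglyMeasurable (Eventually.of_forall fun y => ?_)
  rw [Real.norm_eq_abs, abs_of_pos (gau_pos y)]
  nlinarith [norm_nonneg y, gau_pos y, mul_nonneg (norm_nonneg y) (gau_pos y).le]

lemma co_cont (k : Fin n × Bool) : Continuous (co (n := n) k) := by
  unfold co; split_ifs <;> fun_prop

lemma int_bb_gau {B : ℝ} {b : (Fin n → ℂ) → ℂ} (hc : Continuous b) (hB : ∀ x, ‖b x‖ ≤ B) :
    Integrable (fun y => b y * (gau y : ℂ)) := by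
  have := gau_int (n := n).ofReal (𝕜 := ℂ)
  exact this.bdd_mul hc.aestronglyMeasurable (Eventually.of_forall hB)
lemma int_co_bb_gau {B : ℝ} {b : (Fin n → ℂ) → ℂ} (hc : Continuous b) (hB : ∀ x, ‖b x‖ ≤ B) (k : Fin n × Bool) :
    Integrable (fun y => b y * ((co k y : ℂ) * (gau y : ℂ))) := by
  have h1 : Integrable (fun y : Fin n → ℂ => (co k y : ℂ) * (gau y : ℂ)) := by
    refine gau_int1.mono' ?_ (Eventually.of_forall fun y => ?_)
    · have := co_cont k; have := gau_cont (n := n)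
      exact Continuous.aestronglyMeasurable (by fun_prop)
    · rw [norm_mul, Complex.norm_real, Complex.norm_real, Real.norm_eq_abs, Real.norm_eq_abs, abs_of_pos (gau_pos y)]
      have := abs_co_le k y
      exact mul_le_mul_of_nonneg_right (by linarith) (gau_pos y).le
  exact h1.bdd_mul hc.aestronglyMeasurable (Eventually.of_forall hB)

lemma gau_line (y : Fin n → ℂ) (k : Fin n × Bool) :
    HasLineDerivAt ℝ (fun y : Fin n → ℂ => (gau y : ℂ)) (-2 * (co k y : ℂ) * (gau y : ℂ)) y (dv k).1 := by
  unfold HasLineDerivAt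
  have e : ∀ s : ℝ, gau (y + s • (dv k).1) = Real.exp (-(∑ j, ‖y j‖^2 + (2 * s * co k y + s^2))) := by
    intro s
    unfold gau
    congr 2
    have e : ∀ i, ‖(y + s • (dv k).1) i‖^2 = ‖y i‖^2 + (if i = k.1 then 2 * s * co k y + s^2 else 0) := by
      intro i
      simp only [Complex.sq_norm, Complex.normSq_apply, dv, co, eX, eY]
      split_ifs with h1 h2 <;> simp [*] <;> ring
    simp only [e, Finset.sum_add_distrib, Finset.sum_ite_eq', Finset.mem_univ, if_true]
  simp only [e]
  have h1 : HasDerivAt (fun s : ℝ => Real.exp (-(∑ j, ‖y j‖^2 + (2 * s * co k y + s^2)))) (gau y * (-2 * co k y)) 0 := by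
    have := ((((((hasDerivAt_id (0:ℝ)).const_mul 2).mul_const (co k y)).fun_add ((hasDerivAt_id (0:ℝ)).fun_pow 2)).const_add (∑ j, ‖y j‖^2)).fun_neg).exp
    refine this.congr_deriv ?_
    simp [gau]
  have := h1.ofReal_comp
  refine this.congr_deriv ?_
  push_cast; ring

def Ez (m : (Hn n → ℂ) → ℂ) (χ : Hn n → ℂ) (s : ℝ) : ℂ := ∫ y : Fin n → ℂ, bb m χ (s • y) * (gau y : ℂ)

lemma bbs_cont (hm : Lin1 m C) (h : Tst χ) (s : ℝ) : Continuous (fun y : Fin n → ℂ => bb m χ (s • y)) :=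
  (bb_cont hm h).comp (continuous_const_smul s)

lemma Ez_ibp (hm : Lin1 m C) (h : Tst χ) (s : ℝ) (k : Fin n × Bool) :
    ∫ y : Fin n → ℂ, bb m χ (s • y) * ((co k y : ℂ) * (gau y : ℂ)) = (s / 2) * Ez m (FD (dv k) χ) s := by
  have hl : ∀ y, HasLineDerivAt ℝ (fun y : Fin n → ℂ => bb m χ (s • y)) (s * bb m (FD (dv k) χ) (s • y)) y (dv k).1 := by
    intro y
    unfold HasLineDerivAt
    have h0 := bb_deriv hm h (s • y) (dv k).1 (s * 0)
    have h1 : HasDerivAt (fun r : ℝ => s * r) s 0 := by simpa using (hasDerivAt_id (0:ℝ)).const_mul s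
    have := h0.scomp (0:ℝ) h1
    rw [dv_eta] at this
    refine (this.congr_of_eventuallyEq (Eventually.of_forall fun r => ?_)).congr_deriv ?_
    · simp only [Function.comp, smul_add, smul_smul]
    · simp
  have := integral_bilinear_hasLineDerivAt_right_eq_neg_left_of_integrable (μ := (volume : Measure (Fin n → ℂ)))
    (B := ContinuousLinearMap.mul ℝ ℂ) (v := (dv k).1) (f := fun y : Fin n → ℂ => bb m χ (s • y))
    (f' := fun y => s * bb m (FD (dv k) χ) (s • y))
    (g := fun y => (gau y : ℂ)) (g' := fun y => -2 * (co k y : ℂ) * (gau y : ℂ)) ?_ ?_ ?_ (fun y _ => hl y) (fun y _ => gau_line y k)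
  · simp only [ContinuousLinearMap.mul_apply'] at this
    have e1 : ∫ y : Fin n → ℂ, bb m χ (s • y) * (-2 * (co k y : ℂ) * (gau y : ℂ)) = -2 * ∫ y : Fin n → ℂ, bb m χ (s • y) * ((co k y : ℂ) * (gau y : ℂ)) := by
      rw [← integral_const_mul]; congr 1; funext y; ring
    have e2 : ∫ y : Fin n → ℂ, s * bb m (FD (dv k) χ) (s • y) * (gau y : ℂ) = s * Ez m (FD (dv k) χ) s := by
      rw [Ez, ← integral_const_mul]; congr 1; funext y; ring
    rw [e1, e2] at this
    linear_combination (-1/2 : ℂ) * this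
  · simp only [ContinuousLinearMap.mul_apply', mul_assoc]
    exact (int_bb_gau (bbs_cont hm (h.FD _) s) (fun y => bb_bd hm (h.FD _) _)).const_mul _
  · simp only [ContinuousLinearMap.mul_apply']
    refine ((int_co_bb_gau (bbs_cont hm h s) (fun y => bb_bd hm h _) k).const_mul (-2)).congr (Eventually.of_forall fun y => ?_)
    simp only []; ring
  · exact int_bb_gau (bbs_cont hm h s) (fun y => bb_bd hm h _)

def Lap (χ : Hn n → ℂ) (p : Hn n) : ℂ := ∑ k : Fin n × Bool, FD (dv k) (FD (dv k) χ) p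
lemma Tst.Lap (h : Tst χ) : Tst (Lap χ) := Tst.sum _ fun k _ => (h.FD _).FD _

lemma bb_Lap (hm : Lin1 m C) (h : Tst χ) (x : Fin n → ℂ) :
    bb m (Lap χ) x = ∑ k : Fin n × Bool, bb m (FD (dv k) (FD (dv k) χ)) x := by
  unfold bb Lap
  exact hm.sum Finset.univ (χ := fun k u => FD (dv k) (FD (dv k) χ) (u + ((x, 0) : Hn n))) fun k _ => ((h.FD _).FD _).tr _

lemma Ez_deriv (hm : Lin1 m C) (h : Tst χ) (s : ℝ) :
    HasDerivAt (Ez m χ) ((s / 2) * Ez m (Lap χ) s) s := by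
  have hb := fun (y : Fin n → ℂ) (s : ℝ) => bb_deriv hm h 0 y s
  simp only [zero_add] at hb
  have hk : ∀ y : Fin n → ℂ, bb m (FD ((y, 0) : Hn n) χ) (s • y) * (gau y : ℂ) =
      ∑ k : Fin n × Bool, bb m (FD (dv k) χ) (s • y) * ((co k y : ℂ) * (gau y : ℂ)) := by
    intro y
    rw [bb_decomp hm h, Finset.sum_mul]; exact Finset.sum_congr rfl fun k _ => by ring
  have hi : ∀ k ∈ (Finset.univ : Finset (Fin n × Bool)), Integrable (fun y : Fin n → ℂ => bb m (FD (dv k) χ) (s • y) * ((co k y : ℂ) * (gau y : ℂ))) :=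
    fun k _ => int_co_bb_gau (bbs_cont hm (h.FD _) s) (fun y => bb_bd hm (h.FD _) _) k
  have := hasDerivAt_integral_of_dominated_loc_of_deriv_le (μ := (volume : Measure (Fin n → ℂ))) (s := univ) (x₀ := s)
    (F := fun s y => bb m χ (s • y) * (gau y : ℂ)) (F' := fun s y => bb m (FD ((y, 0) : Hn n) χ) (s • y) * (gau y : ℂ))
    (bound := fun y => Bd C χ * ((1 + ‖y‖) * gau y)) univ_mem
    (Eventually.of_forall fun s => (int_bb_gau (bbs_cont hm h s) (fun y => bb_bd hm h _)).aestronglyMeasurable)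
    (int_bb_gau (bbs_cont hm h s) (fun y => bb_bd hm h _)) ?_ (Eventually.of_forall fun y s _ => ?_)
    (gau_int1.const_mul _) (Eventually.of_forall fun y s _ => (hb y s).mul_const _)
  · refine this.2.congr_deriv ?_
    simp only [hk]
    rw [integral_finsetSum _ hi]
    simp only [Ez_ibp hm (h.FD _)]
    rw [← Finset.mul_sum]
    congr 1
    simp only [Ez]
    rw [← integral_finsetSum _ fun k _ => int_bb_gau (bbs_cont hm ((h.FD _).FD _) s) (fun y => bb_bd hm ((h.FD _).FD _) _)]
    congr 1; funext y
    rw [bb_Lap hm h, Finset.sum_mul]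
  · simp only [hk]
    exact (integrable_finsetSum _ hi).aestronglyMeasurable
  · rw [norm_mul, Complex.norm_real, Real.norm_eq_abs, abs_of_pos (gau_pos y)]
    have := bb_FD_bd hm h (s • y) y
    have h2 := Bd_nonneg C χ
    nlinarith [mul_le_mul_of_nonneg_right this (gau_pos y).le, mul_nonneg h2 (gau_pos y).le]

lemma Ez_bd (hm : Lin1 m C) (h : Tst χ) (s : ℝ) : ‖Ez m χ s‖ ≤ (|C| * ∫ p, ‖χ p‖) * ∫ y : Fin n → ℂ, gau y := by
  unfold Ez
  rw [← integral_const_mul]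
  refine norm_integral_le_of_norm_le (gau_int.const_mul _) (Eventually.of_forall fun y => ?_)
  rw [norm_mul, Complex.norm_real, Real.norm_eq_abs, abs_of_pos (gau_pos y)]
  exact mul_le_mul_of_nonneg_right (bb_bd hm h _) (gau_pos y).le

lemma gau_int_pos : 0 < ∫ y : Fin n → ℂ, gau y := by
  refine (integral_pos_iff_support_of_nonneg (fun y => (gau_pos y).le) gau_int).2 ?_
  have : Function.support (gau (n := n)) = univ := by ext y; simp [(gau_pos y).ne']
  rw [this]; exact isOpen_univ.measure_pos _ ⟨0, trivial⟩

lemma Ez_zero (χ : Hn n → ℂ) : Ez m χ 0 = m χ * ((∫ y : Fin n → ℂ, gau y : ℝ) : ℂ) := by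
  unfold Ez
  simp only [zero_smul, bb_zero]
  rw [integral_const_mul, integral_complex_ofReal]

lemma FD_comm (h : Tst χ) (v w : Hn n) : FD v (FD w χ) = FD w (FD v χ) := by
  funext p
  have hd : DifferentiableAt ℝ (fderiv ℝ χ) p :=
    (h.contDiff.fderiv_right (m := ∞) (by simp)).differentiable (by simp) p
  have hsym : IsSymmSndFDerivAt ℝ χ p := by
    apply (h.contDiff.contDiffAt (x := p)).isSymmSndFDerivAt
    simp only [minSmoothness_of_isRCLikeNormedField]
    exact WithTop.coe_le_coe.2 le_top
  have e : ∀ v w : Hn n, FD v (FD w χ) p = fderiv ℝ (fderiv ℝ χ) p v w := by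
    intro v w
    simp only [FD]
    unfold VD
    rw [fderiv_clm_apply hd (differentiableAt_const w)]; simp
  rw [e, e, hsym.eq]

/-- bounded biharmonic functions are constant -/
theorem liouville (hm : Lin1 m C) (hL : ∀ χ, Tst χ → m (Lap (Lap χ)) = 0) (h : Tst χ) (k : Fin n × Bool) :
    m (FD (dv k) χ) = 0 := by
  have lap_tr : ∀ (χ : Hn n → ℂ) (w : Hn n), Lap (fun u => χ (u + w)) = fun u => Lap χ (u + w) := by
    intro χ w; funext u
    simp only [Lap, FD_tr]
  have hG := gau_int_pos (n := n)
  have hG' : ((∫ y : Fin n → ℂ, gau y : ℝ) : ℂ) ≠ 0 := by exact_mod_cast hG.ne'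
  have grow : ∀ (z w : ℂ) (B : ℝ), (∀ s : ℝ, ‖z + s * w‖ ≤ B) → w = 0 := by
    intro z w B hB
    by_contra hw
    have hw' : 0 < ‖w‖ := norm_pos_iff.2 hw
    have hB0 : 0 ≤ B := (norm_nonneg _).trans (hB 0)
    have h1 := hB ((B + ‖z‖ + 1) / ‖w‖)
    have h2 : ‖(((B + ‖z‖ + 1) / ‖w‖ : ℝ) : ℂ) * w‖ = B + ‖z‖ + 1 := by
      rw [norm_mul, Complex.norm_real, Real.norm_eq_abs, abs_of_nonneg (by positivity)]; field_simp
    have h3 := norm_sub_le (z + (((B + ‖z‖ + 1) / ‖w‖ : ℝ) : ℂ) * w) z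
    rw [add_sub_cancel_left, h2] at h3
    linarith
  have step1 : ∀ χ, Tst χ → m (Lap χ) = 0 := by
    intro χ h
    have hb0 : ∀ s, Ez m (Lap (Lap χ)) s = 0 := by
      intro s
      have : ∀ x, bb m (Lap (Lap χ)) x = 0 := by
        intro x
        unfold bb
        rw [← lap_tr, ← lap_tr]; exact hL _ (h.tr _)
      simp [Ez, this]
    have hc : ∀ s, Ez m (Lap χ) s = Ez m (Lap χ) 0 := by
      intro s
      refine is_const_of_deriv_eq_zero (fun s => (Ez_deriv hm h.Lap s).differentiableAt) (fun s => ?_) s 0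
      rw [(Ez_deriv hm h.Lap s).deriv, hb0]; simp
    have hc2 : ∀ s : ℝ, Ez m χ s - s^2/4 * Ez m (Lap χ) 0 = Ez m χ 0 := by
      intro s
      have hd : ∀ s : ℝ, HasDerivAt (fun s : ℝ => Ez m χ s - s^2/4 * Ez m (Lap χ) 0) 0 s := by
        intro s
        have h1 : HasDerivAt (fun s : ℝ => (s : ℂ)) 1 s := Complex.ofRealCLM.hasDerivAt
        have := (Ez_deriv hm h s).fun_sub (((h1.fun_pow 2).div_const 4).mul_const (Ez m (Lap χ) 0))
        refine this.congr_deriv ?_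
        rw [hc s]; simp; ring
      have := is_const_of_deriv_eq_zero (fun s => (hd s).differentiableAt) (fun s => (hd s).deriv) s 0
      simpa using this
    have h0 : Ez m (Lap χ) 0 = 0 := by
      have hB := Ez_bd hm h
      set B := (|C| * ∫ p, ‖χ p‖) * ∫ y : Fin n → ℂ, gau y
      -- use only nonnegative parameters, extended by symmetry
      by_contra hw
      have hw' : 0 < ‖Ez m (Lap χ) 0‖ := norm_pos_iff.2 hw
      have hB0 : 0 ≤ B := (norm_nonneg _).trans (hB 0)
      set r := Real.sqrt (4 * (2 * B + 1) / ‖Ez m (Lap χ) 0‖)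
      have hr : r^2 = 4 * (2 * B + 1) / ‖Ez m (Lap χ) 0‖ := Real.sq_sqrt (by positivity)
      have e1 : (r : ℂ)^2/4 * Ez m (Lap χ) 0 = Ez m χ r - Ez m χ 0 := by linear_combination - hc2 r
      have e2 := congrArg norm e1
      rw [norm_mul, ← Complex.ofReal_pow, hr, norm_div, Complex.norm_real, Real.norm_eq_abs, abs_of_nonneg (by positivity)] at e2
      have e3 : 4 * (2 * B + 1) / ‖Ez m (Lap χ) 0‖ / ‖(4:ℂ)‖ * ‖Ez m (Lap χ) 0‖ = 2 * B + 1 := by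
        simp; field_simp
      rw [e3] at e2
      have := norm_sub_le (Ez m χ r) (Ez m χ 0)
      linarith [hB r, hB 0]
    rw [Ez_zero] at h0
    exact (mul_eq_zero.1 h0).resolve_right hG'
  have hz : ∀ s, Ez m (Lap (FD (dv k) χ)) s = 0 := by
    intro s
    have : ∀ x, bb m (Lap (FD (dv k) χ)) x = 0 := by
      intro x
      unfold bb
      rw [← lap_tr]; exact step1 _ ((h.FD _).tr _)
    simp [Ez, this]
  have hc : ∀ s, Ez m (FD (dv k) χ) s = Ez m (FD (dv k) χ) 0 := by
    intro s
    refine is_const_of_deriv_eq_zero (fun s => (Ez_deriv hm (h.FD _) s).differentiableAt) (fun s => ?_) s 0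
    rw [(Ez_deriv hm (h.FD _) s).deriv, hz]; simp
  have h0 : (1/2) * Ez m (FD (dv k) χ) 0 = 0 := by
    refine grow 0 _ (((|C| * ∫ p, ‖χ p‖)) * ∫ y : Fin n → ℂ, ((1 + ‖y‖) * gau y)) fun s => ?_
    have e := Ez_ibp hm h s k
    rw [hc s] at e
    rw [zero_add, show (s:ℂ) * (1/2 * Ez m (FD (dv k) χ) 0) = s / 2 * Ez m (FD (dv k) χ) 0 by ring, ← e, ← integral_const_mul]
    refine norm_integral_le_of_norm_le (gau_int1.const_mul _) (Eventually.of_forall fun y => ?_)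
    rw [norm_mul, norm_mul, Complex.norm_real, Complex.norm_real, Real.norm_eq_abs, Real.norm_eq_abs, abs_of_pos (gau_pos y)]
    refine mul_le_mul (bb_bd hm h _) ?_ (by have := gau_pos y; positivity) (mul_nonneg (abs_nonneg _) (integral_nonneg fun _ => norm_nonneg _))
    exact mul_le_mul_of_nonneg_right (by linarith [abs_co_le k y]) (gau_pos y).le
  rw [Ez_zero] at h0
  simpa [hG'] using h0
end

/-- the operator `ℒ² + n² T²` -/
def DD {n : ℕ} (f : Hn n → ℂ) (p : Hn n) : ℂ := LL (LL f) p + (n:ℂ)^2 * LD (eT n) (LD (eT n) f) p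

section
variable {n : ℕ} {f χ κ : Hn n → ℂ} {M C : ℝ} {m : (Hn n → ℂ) → ℂ}

lemma Tst.DD (h : Tst χ) : Tst (DD χ) := h.LL.LL.add (((h.LD _).LD _).const_mul _)

lemma DD_weak (hf : ContDiff ℝ ∞ f) (hD : ∀ p, DD f p = 0) (h : Tst χ) : ∫ p, f p * DD χ p = 0 := by
  have e1 := ibp_LL (contDiff_LL hf) h
  rw [ibp_LL hf h.LL] at e1
  have e2 := ibp2 hf h (eT n) (eT n)
  have i1 : Integrable (fun p => f p * LL (LL χ) p) := (h.LL.LL.mul_left hf).integrable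
  have i2 : Integrable (fun p => (n:ℂ)^2 * (f p * LD (eT n) (LD (eT n) χ) p)) :=
    (((h.LD _).LD _).mul_left hf).integrable.const_mul _
  have j1 : Integrable (fun p => LL (LL f) p * χ p) := (h.mul_left (contDiff_LL (contDiff_LL hf))).integrable
  have j2 : Integrable (fun p => (n:ℂ)^2 * (LD (eT n) (LD (eT n) f) p * χ p)) :=
    (h.mul_left (contDiff_LD _ (contDiff_LD _ hf))).integrable.const_mul _
  calc ∫ p, f p * DD χ p = ∫ p, (f p * LL (LL χ) p + (n:ℂ)^2 * (f p * LD (eT n) (LD (eT n) χ) p)) := by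
        congr 1; funext p; simp only [_root_.DD]; ring
    _ = ∫ p, (LL (LL f) p * χ p + (n:ℂ)^2 * (LD (eT n) (LD (eT n) f) p * χ p)) := by
        rw [integral_add i1 i2, integral_add j1 j2, integral_const_mul, integral_const_mul, e1, e2]
    _ = 0 := by
        rw [← integral_zero (α := Hn n) (μ := volume) (G := ℂ)]
        congr 1; funext p; have := hD p; simp only [_root_.DD] at this
        linear_combination this * χ p

lemma LL_lmul (hf : ContDiff ℝ ∞ f) (w p : Hn n) : LL (fun u => f (lmul w u)) p = LL f (lmul w p) := by
  have e : ∀ v, ∀ g : Hn n → ℂ, ContDiff ℝ ∞ g → LD v (fun u => g (lmul w u)) = fun p => LD v g (lmul w p) :=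
    fun v g hg => funext fun p => LD_lmul v w (hg.differentiable (by simp)) p
  simp only [LL]
  simp_rw [e _ _ hf, e _ _ (contDiff_LD _ hf)]

lemma DD_lmul (hf : ContDiff ℝ ∞ f) (w p : Hn n) : DD (fun u => f (lmul w u)) p = DD f (lmul w p) := by
  have e : ∀ v, ∀ g : Hn n → ℂ, ContDiff ℝ ∞ g → LD v (fun u => g (lmul w u)) = fun p => LD v g (lmul w p) :=
    fun v g hg => funext fun p => LD_lmul v w (hg.differentiable (by simp)) p
  have e2 : LL (fun u => f (lmul w u)) = fun p => LL f (lmul w p) := funext fun p => LL_lmul hf w p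
  simp only [DD]
  rw [e2, LL_lmul (contDiff_LL hf), e _ _ hf, e _ _ (contDiff_LD _ hf)]

lemma cof_eT_right (v : Hn n) : cof v (eT n) = 0 := by rw [cof_apply]; simp [eT]

lemma lmul_T (s : ℝ) (p : Hn n) : lmul (s • eT n) p = p + s • eT n := by
  rw [lmul, map_smul, cof_eT_right]; simp [add_comm]

lemma cc_DD (hf : ContDiff ℝ ∞ f) (hD : ∀ p, DD f p = 0) (h : Tst χ) (s : ℝ) : cc f (DD χ) s = 0 := by
  unfold cc
  apply DD_weak (hf.comp (contDiff_id.add contDiff_const)) _ h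
  intro p
  have := DD_lmul hf (s • eT n) p
  simp_rw [lmul_T] at this
  exact this.trans (hD _)

lemma Ip_DD (hf : ContDiff ℝ ∞ f) (hD : ∀ p, DD f p = 0) (h : Tst χ) (a : ℝ) : Ip f (DD χ) a = 0 := by
  have e : cc f (DD χ) = fun s => (0:ℂ) * cc f χ s := by funext s; rw [cc_DD hf hD h]; simp
  unfold Ip; rw [e, PI_const_mul]; simp

/-- linear functionals invariant under vertical translation -/
structure TL (m : (Hn n → ℂ) → ℂ) : Prop where
  add : ∀ χ κ, Tst χ → Tst κ → m (fun p => χ p + κ p) = m χ + m κ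
  smul : ∀ (c : ℂ) χ, Tst χ → m (fun p => c * χ p) = c * m χ
  T : ∀ χ, Tst χ → m (LD (eT n) χ) = 0

lemma TL.sum (hm : TL m) {ι : Type*} (s : Finset ι) {χ : ι → Hn n → ℂ} (h : ∀ i ∈ s, Tst (χ i)) :
    m (fun p => ∑ i ∈ s, χ i p) = ∑ i ∈ s, m (χ i) := by
  classical
  induction s using Finset.induction_on with
  | empty => simpa using hm.smul 0 _ Tst.zero
  | insert a s ha ih =>
    simp only [Finset.sum_insert ha]
    rw [hm.add _ _ (h a (by simp)) (Tst.sum s fun i hi => h i (by simp [hi])), ih fun i hi => h i (by simp [hi])]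

lemma contDiff_cof (v : Hn n) : ContDiff ℝ ∞ (fun p : Hn n => (cof v p : ℂ)) :=
  Complex.ofRealCLM.contDiff.comp (cof v).contDiff

lemma LD_cof (u v p : Hn n) : LD u (fun p : Hn n => (cof v p : ℂ)) p = cof v u := by
  have : HasFDerivAt (fun p : Hn n => (cof v p : ℂ)) (Complex.ofRealCLM ∘L (cof v)) p :=
    (Complex.ofRealCLM ∘L (cof v)).hasFDerivAt
  rw [LD_eq, this.fderiv]
  simp [cof_eT_right]

lemma LD_eq_FD (h : Tst χ) (v : Hn n) : LD v χ = fun p => FD v χ p + LD (eT n) (fun p => (cof v p : ℂ) * χ p) p := by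
  funext p
  rw [LD_mul _ ((contDiff_cof v).differentiable (by simp) p) (h.differentiable p), LD_cof, cof_eT_right,
    LD_eq v, LD_eq (eT n), cof_eT]
  simp [FD, VD]

lemma LDT_eq_FD (χ : Hn n → ℂ) : LD (eT n) χ = FD (eT n) χ := by
  funext p; rw [LD_eq, cof_eT]; simp [FD, VD]

lemma TL.LD (hm : TL m) (h : Tst χ) (v : Hn n) : m (LD v χ) = m (FD v χ) := by
  rw [LD_eq_FD h, hm.add _ _ (h.FD v) ((h.mul_left (contDiff_cof v)).LD _), hm.T _ (h.mul_left (contDiff_cof v)), add_zero]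

lemma FD_add (h : Tst χ) (h' : Tst κ) (v : Hn n) : FD v (fun p => χ p + κ p) = fun p => FD v χ p + FD v κ p := by
  funext p; simp only [FD, VD]; rw [fderiv_fun_add (h.differentiable p) (h'.differentiable p)]; rfl
lemma FD_const_mul (h : Tst χ) (c : ℂ) (v : Hn n) : FD v (fun p => c * χ p) = fun p => c * FD v χ p := by
  funext p; simp only [FD, VD]; rw [fderiv_const_mul (h.differentiable p)]; rfl

lemma TL.LD2 (hm : TL m) (h : Tst χ) (v : Hn n) : m (_root_.LD v (_root_.LD v χ)) = m (FD v (FD v χ)) := by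
  have h1 := h.mul_left (contDiff_cof v)
  rw [hm.LD (h.LD v), LD_eq_FD h, FD_add (h.FD v) (h1.LD _), hm.add _ _ ((h.FD v).FD v) ((h1.LD _).FD _),
    LDT_eq_FD, FD_comm h1, ← LDT_eq_FD, hm.T _ (h1.FD v), add_zero]

lemma TL.LL (hm : TL m) (h : Tst χ) : m (LL χ) = -(1/4) * m (Lap χ) := by
  unfold _root_.LL Lap
  rw [hm.smul _ _ (Tst.sum _ fun j _ => ((h.LD _).LD _).add ((h.LD _).LD _)),
    hm.sum _ fun j _ => ((h.LD _).LD _).add ((h.LD _).LD _), hm.sum _ fun k _ => (h.FD _).FD _,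
    Fintype.sum_prod_type]
  congr 1
  refine Finset.sum_congr rfl fun j _ => ?_
  rw [hm.add _ _ ((h.LD _).LD _) ((h.LD _).LD _), hm.LD2 h, hm.LD2 h]
  simp [dv, add_comm]

lemma TL.Lap (hm : TL m) : TL (fun χ => m (Lap χ)) := by
  refine ⟨fun χ κ h h' => ?_, fun c χ h => ?_, fun χ h => ?_⟩
  · rw [← hm.add _ _ h.Lap h'.Lap]
    congr 1; funext p; simp only [_root_.Lap]
    simp_rw [FD_add h h', FD_add (h.FD _) (h'.FD _), Finset.sum_add_distrib]
  · rw [← hm.smul _ _ h.Lap]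
    congr 1; funext p; simp only [_root_.Lap]
    simp_rw [FD_const_mul h, FD_const_mul (h.FD _), Finset.mul_sum]
  · unfold _root_.Lap
    rw [hm.sum _ fun k _ => ((h.LD _).FD _).FD _]
    refine Finset.sum_eq_zero fun k _ => ?_
    rw [LDT_eq_FD, FD_comm h, FD_comm (h.FD _), ← LDT_eq_FD]
    exact hm.T _ ((h.FD _).FD _)

/-- Lemma Z -/
theorem lemma_Z (hf : FH f M) (hD : ∀ p, DD f p = 0) (h : Tst κ) (j : Fin n) :
    Tendsto (Ip f (ZC Complex.I j κ)) atTop (𝓝 0) := by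
  rw [tendsto_iff_ultrafilter]
  intro U hU
  have hpos : ∀ᶠ a in (U : Filter ℝ), 0 < a := hU (eventually_gt_atTop 0)
  have ex : ∀ χ, Tst χ → ∃ l, Tendsto (Ip f χ) U (𝓝 l) := by
    intro χ hχ
    have hc : IsCompact (Metric.closedBall (0:ℂ) (M * ∫ p, ‖χ p‖)) := isCompact_closedBall _ _
    obtain ⟨l, -, hl⟩ := hc.ultrafilter_le_nhds (U.map (Ip f χ)) (by
      rw [le_principal_iff]
      change ∀ᶠ a in (U : Filter ℝ), Ip f χ a ∈ Metric.closedBall (0:ℂ) (M * ∫ p, ‖χ p‖)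
      filter_upwards [hpos] with a ha
      simpa using norm_Ip_le hf hχ ha)
    exact ⟨l, hl⟩
  let m : (Hn n → ℂ) → ℂ := fun χ => limUnder (U : Filter ℝ) (Ip f χ)
  have hm : ∀ χ, Tst χ → Tendsto (Ip f χ) U (𝓝 (m χ)) := fun χ hχ => tendsto_nhds_limUnder (ex χ hχ)
  have uq : ∀ χ, Tst χ → ∀ l, Tendsto (Ip f χ) U (𝓝 l) → m χ = l := fun χ hχ l hl =>
    tendsto_nhds_unique (hm χ hχ) hl
  have madd : ∀ χ κ, Tst χ → Tst κ → m (fun p => χ p + κ p) = m χ + m κ := by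
    intro χ κ h1 h2
    refine uq _ (h1.add h2) _ (((hm χ h1).add (hm κ h2)).congr' ?_)
    filter_upwards [hpos] with a ha
    rw [Ip_add hf h1 h2 ha]
  have msmul : ∀ (c : ℂ) χ, Tst χ → m (fun p => c * χ p) = c * m χ := by
    intro c χ h1
    refine uq _ (h1.const_mul c) _ (((hm χ h1).const_mul c).congr fun a => ?_)
    rw [Ip_const_mul]
  have hL : Lin1 m M := by
    refine ⟨madd, msmul, fun χ h1 => ?_⟩
    refine le_of_tendsto (hm χ h1).norm ?_
    filter_upwards [hpos] with a ha using norm_Ip_le hf h1 ha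
  have hT : TL m := by
    refine ⟨madd, msmul, fun χ h1 => ?_⟩
    refine uq _ (h1.LD _) _ ?_
    have := (((gp_tendsto_atTop EI_I hf h1).sub (gp_tendsto_atTop EI_negI hf h1)).const_mul
      (- Complex.I * (1 / (2 * Real.pi)))).mono_left hU
    simp only [sub_zero, mul_zero] at this
    refine this.congr' ?_
    filter_upwards [hpos] with a ha
    rw [Ip_T hf h1 ha]
  have hDD : ∀ χ, Tst χ → m (Lap (Lap χ)) = 0 := by
    intro χ h1
    have e1 : m (DD χ) = 0 := by
      refine uq _ h1.DD _ (tendsto_const_nhds.congr fun a => ?_)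
      rw [Ip_DD hf.sm hD h1]
    unfold DD at e1
    rw [madd _ _ h1.LL.LL (((h1.LD _).LD _).const_mul _), msmul _ _ ((h1.LD _).LD _), hT.T _ (h1.LD _),
      hT.LL h1.LL, hT.Lap.LL h1] at e1
    have : (1/16 : ℂ) * m (Lap (Lap χ)) = 0 := by linear_combination e1
    simpa using this
  have hX : m (LD (eX n j) κ) = 0 := by
    rw [hT.LD h]; simpa [dv] using liouville hL hDD h (j, false)
  have hY : m (LD (eY n j) κ) = 0 := by
    rw [hT.LD h]; simpa [dv] using liouville hL hDD h (j, true)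
  have : m (ZC Complex.I j κ) = 0 := by
    unfold ZC
    rw [msmul _ _ ((h.LD _).add ((h.LD _).const_mul _)), madd _ _ (h.LD _) ((h.LD _).const_mul _),
      msmul _ _ (h.LD _), hX, hY]; simp
  have h2 := hm _ (h.ZC Complex.I j)
  rwa [this] at h2

end

section
variable {n : ℕ}

def cx (j : Fin n) (p : Hn n) : ℂ := ((p.1 j).re : ℂ)
def cy (j : Fin n) (p : Hn n) : ℂ := ((p.1 j).im : ℂ)
def ct (p : Hn n) : ℂ := (p.2 : ℂ)
def rho (p : Hn n) : ℝ := ∑ j, ‖p.1 j‖ ^ 2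
def rC (p : Hn n) : ℂ := ∑ j, (cx j p * cx j p + cy j p * cy j p)
/-- the function `σ + μ |ζ|² + i t` -/
def ww (σ μ : ℝ) (p : Hn n) : ℂ := σ + μ * rC p + Complex.I * ct p

lemma rC_eq (p : Hn n) : rC p = (rho p : ℂ) := by
  unfold rC rho cx cy
  push_cast
  refine Finset.sum_congr rfl fun j _ => ?_
  rw [← Complex.ofReal_pow, ← Complex.normSq_eq_norm_sq, Complex.normSq_apply]; push_cast; ring

lemma rho_nonneg (p : Hn n) : 0 ≤ rho p := by unfold rho; positivity

lemma ww_re (σ μ : ℝ) (p : Hn n) : (ww σ μ p).re = σ + μ * rho p := by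
  unfold ww ct; rw [rC_eq]; simp [← Complex.ofReal_mul]
lemma ww_im (σ μ : ℝ) (p : Hn n) : (ww σ μ p).im = p.2 := by
  unfold ww ct; rw [rC_eq]; simp

lemma ww_ne {σ μ : ℝ} (hσ : 0 < σ) (hμ : 0 ≤ μ) (p : Hn n) : ww σ μ p ≠ 0 := by
  intro h
  have := congrArg Complex.re h
  rw [ww_re] at this
  have h2 := mul_nonneg hμ (rho_nonneg p)
  simp at this; linarith

def cxL (j : Fin n) : Hn n →L[ℝ] ℂ := Complex.ofRealCLM ∘L Complex.reCLM ∘L (ContinuousLinearMap.proj j) ∘L (ContinuousLinearMap.fst ℝ (Fin n → ℂ) ℝ)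
def cyL (j : Fin n) : Hn n →L[ℝ] ℂ := Complex.ofRealCLM ∘L Complex.imCLM ∘L (ContinuousLinearMap.proj j) ∘L (ContinuousLinearMap.fst ℝ (Fin n → ℂ) ℝ)
def ctL : Hn n →L[ℝ] ℂ := Complex.ofRealCLM ∘L (ContinuousLinearMap.snd ℝ (Fin n → ℂ) ℝ)

lemma cx_eq (j : Fin n) : cx j = ⇑(cxL j) := rfl
lemma cy_eq (j : Fin n) : cy j = ⇑(cyL j) := rfl
lemma ct_eq : (ct : Hn n → ℂ) = ⇑(ctL (n := n)) := rfl

lemma LD_clm (L : Hn n →L[ℝ] ℂ) (v p : Hn n) : LD v L p = L v + (cof v p : ℂ) * L (eT n) := by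
  rw [LD_eq, L.fderiv]

@[fun_prop] lemma contDiff_cx (j : Fin n) : ContDiff ℝ ∞ (cx j) := (cxL j).contDiff
@[fun_prop] lemma contDiff_cy (j : Fin n) : ContDiff ℝ ∞ (cy j) := (cyL j).contDiff
@[fun_prop] lemma contDiff_ct : ContDiff ℝ ∞ (ct : Hn n → ℂ) := (ctL (n := n)).contDiff
@[fun_prop] lemma contDiff_rC : ContDiff ℝ ∞ (rC : Hn n → ℂ) := by unfold rC; fun_prop
@[fun_prop] lemma contDiff_ww (σ μ : ℝ) : ContDiff ℝ ∞ (ww σ μ : Hn n → ℂ) := by unfold ww; fun_prop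

lemma LDX_cx (j i : Fin n) (p : Hn n) : LD (eX n j) (cx i) p = if i = j then 1 else 0 := by
  rw [cx_eq, LD_clm]; simp only [← cx_eq]; simp [cx, eX, eT]; split_ifs <;> simp
lemma LDX_cy (j i : Fin n) (p : Hn n) : LD (eX n j) (cy i) p = 0 := by
  rw [cy_eq, LD_clm]; simp only [← cy_eq]; simp [cy, eX, eT]; split_ifs <;> simp
lemma LDX_ct (j : Fin n) (p : Hn n) : LD (eX n j) ct p = 2 * cy j p := by
  rw [ct_eq, LD_clm, cof_eX]; simp only [← ct_eq]; simp [ct, cy, eX, eT]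
lemma LDY_cx (j i : Fin n) (p : Hn n) : LD (eY n j) (cx i) p = 0 := by
  rw [cx_eq, LD_clm]; simp only [← cx_eq]; simp [cx, eY, eT]; split_ifs <;> simp
lemma LDY_cy (j i : Fin n) (p : Hn n) : LD (eY n j) (cy i) p = if i = j then 1 else 0 := by
  rw [cy_eq, LD_clm]; simp only [← cy_eq]; simp [cy, eY, eT]; split_ifs <;> simp
lemma LDY_ct (j : Fin n) (p : Hn n) : LD (eY n j) ct p = -2 * cx j p := by
  rw [ct_eq, LD_clm, cof_eY]; simp only [← ct_eq]; simp [ct, cx, eY, eT]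
lemma LDT_cx (i : Fin n) (p : Hn n) : LD (eT n) (cx i) p = 0 := by
  rw [cx_eq, LD_clm]; simp only [← cx_eq]; simp [cx, eT]
lemma LDT_cy (i : Fin n) (p : Hn n) : LD (eT n) (cy i) p = 0 := by
  rw [cy_eq, LD_clm]; simp only [← cy_eq]; simp [cy, eT]
lemma LDT_ct (p : Hn n) : LD (eT n) ct p = 1 := by
  rw [ct_eq, LD_clm, cof_eT]; simp only [← ct_eq]; simp [ct, eT]

lemma dif {g : Hn n → ℂ} (hg : ContDiff ℝ ∞ g) (p : Hn n) : DifferentiableAt ℝ g p := hg.differentiable (by simp) p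

lemma LD_rC (v p : Hn n) : LD v rC p = ∑ j, (2 * cx j p * LD v (cx j) p + 2 * cy j p * LD v (cy j) p) := by
  unfold rC
  rw [LD_sum _ _ fun j _ => dif (by fun_prop) p]
  refine Finset.sum_congr rfl fun j _ => ?_
  rw [LD_add _ (dif (by fun_prop) p) (dif (by fun_prop) p), LD_mul _ (dif (by fun_prop) p) (dif (by fun_prop) p),
    LD_mul _ (dif (by fun_prop) p) (dif (by fun_prop) p)]
  ring

lemma LDX_rC (j : Fin n) : LD (eX n j) rC = fun p => 2 * cx j p := by
  funext p; rw [LD_rC]; simp [LDX_cx, LDX_cy]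
lemma LDY_rC (j : Fin n) : LD (eY n j) rC = fun p => 2 * cy j p := by
  funext p; rw [LD_rC]; simp [LDY_cx, LDY_cy]
lemma LDT_rC : LD (eT n) rC = fun _ => 0 := by
  funext p; rw [LD_rC]; simp [LDT_cx, LDT_cy]

lemma LD_const' (v p : Hn n) (c : ℂ) : LD v (fun _ => c) p = 0 := by
  unfold LD; simp

lemma LD_ww (σ μ : ℝ) (v p : Hn n) : LD v (ww σ μ) p = μ * LD v rC p + Complex.I * LD v ct p := by
  unfold ww
  rw [LD_add _ (dif (by fun_prop) p) (dif (by fun_prop) p), LD_add _ (dif (by fun_prop) p) (dif (by fun_prop) p),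
    LD_const', LD_const_mul _ (dif (by fun_prop) p), LD_const_mul _ (dif (by fun_prop) p)]
  ring

lemma LDX_ww (σ μ : ℝ) (j : Fin n) : LD (eX n j) (ww σ μ) = fun p => 2 * μ * cx j p + 2 * Complex.I * cy j p := by
  funext p; rw [LD_ww, LDX_rC, LDX_ct]; ring
lemma LDY_ww (σ μ : ℝ) (j : Fin n) : LD (eY n j) (ww σ μ) = fun p => 2 * μ * cy j p - 2 * Complex.I * cx j p := by
  funext p; rw [LD_ww, LDY_rC, LDY_ct]; ring
lemma LDT_ww (σ μ : ℝ) : LD (eT n) (ww σ μ) = fun _ => Complex.I := by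
  funext p; rw [LD_ww, LDT_rC, LDT_ct]; ring

lemma LDXX_ww (σ μ : ℝ) (j : Fin n) (p : Hn n) : LD (eX n j) (LD (eX n j) (ww σ μ)) p = 2 * μ := by
  rw [LDX_ww, LD_add _ (dif (by fun_prop) p) (dif (by fun_prop) p), LD_const_mul _ (dif (by fun_prop) p),
    LD_const_mul _ (dif (by fun_prop) p), LDX_cx, LDX_cy]; simp
lemma LDYY_ww (σ μ : ℝ) (j : Fin n) (p : Hn n) : LD (eY n j) (LD (eY n j) (ww σ μ)) p = 2 * μ := by
  rw [LDY_ww, LD_sub _ (dif (by fun_prop) p) (dif (by fun_prop) p), LD_const_mul _ (dif (by fun_prop) p),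
    LD_const_mul _ (dif (by fun_prop) p), LDY_cx, LDY_cy]; simp
lemma LDXX_rC (j : Fin n) (p : Hn n) : LD (eX n j) (LD (eX n j) rC) p = 2 := by
  rw [LDX_rC, LD_const_mul _ (dif (by fun_prop) p), LDX_cx]; simp
lemma LDYY_rC (j : Fin n) (p : Hn n) : LD (eY n j) (LD (eY n j) rC) p = 2 := by
  rw [LDY_rC, LD_const_mul _ (dif (by fun_prop) p), LDY_cy]; simp

lemma LD_invpow {g : Hn n → ℂ} (hg : ContDiff ℝ ∞ g) (h0 : ∀ p, g p ≠ 0) (N : ℕ) (v p : Hn n) :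
    LD v (fun p => (g p)⁻¹ ^ N) p = - N * ((g p)⁻¹ ^ (N+1) * LD v g p) := by
  have h1 : HasDerivAt (fun z : ℂ => z⁻¹ ^ N) (-N * (g p)⁻¹ ^ (N+1)) (g p) := by
    refine ((hasDerivAt_inv (h0 p)).pow N).congr_deriv ?_
    rcases N with _ | N
    · simp
    · simp only [Nat.add_sub_cancel, Pi.inv_apply]; ring
  have h2 := h1.comp_hasFDerivAt p (dif hg p).hasFDerivAt
  unfold LD
  have e : (fun p => (g p)⁻¹ ^ N) = (fun z : ℂ => z⁻¹ ^ N) ∘ g := rfl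
  rw [e, h2.fderiv]
  simp; ring

lemma contDiff_invpow {g : Hn n → ℂ} (hg : ContDiff ℝ ∞ g) (h0 : ∀ p, g p ≠ 0) (N : ℕ) :
    ContDiff ℝ ∞ (fun p => (g p)⁻¹ ^ N) := (hg.inv h0).pow N

lemma LD2_mul {g h : Hn n → ℂ} (hg : ContDiff ℝ ∞ g) (hh : ContDiff ℝ ∞ h) (v p : Hn n) :
    LD v (LD v (fun p => g p * h p)) p = g p * LD v (LD v h) p + 2 * (LD v g p * LD v h p) + LD v (LD v g) p * h p := by
  have e : LD v (fun p => g p * h p) = fun p => g p * LD v h p + LD v g p * h p :=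
    funext fun p => LD_mul v (dif hg p) (dif hh p)
  have hg' := contDiff_LD v hg
  have hh' := contDiff_LD v hh
  rw [e, LD_add _ (dif (hg.mul hh') p) (dif (hg'.mul hh) p), LD_mul _ (dif hg p) (dif hh' p), LD_mul _ (dif hg' p) (dif hh p)]
  ring

lemma LD2_invpow {g : Hn n → ℂ} (hg : ContDiff ℝ ∞ g) (h0 : ∀ p, g p ≠ 0) (N : ℕ) (v p : Hn n) :
    LD v (LD v (fun p => (g p)⁻¹ ^ N)) p = N * (N+1) * (g p)⁻¹ ^ (N+2) * (LD v g p)^2 - N * (g p)⁻¹ ^ (N+1) * LD v (LD v g) p := by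
  have e : LD v (fun p => (g p)⁻¹ ^ N) = fun p => (- N : ℂ) * ((g p)⁻¹ ^ (N+1) * LD v g p) :=
    funext fun p => LD_invpow hg h0 N v p
  have hg' := contDiff_LD v hg
  have hi := contDiff_invpow hg h0 (N+1)
  rw [e, LD_const_mul _ (dif (hi.mul hg') p), LD_mul _ (dif hi p) (dif hg' p), LD_invpow hg h0]
  push_cast; ring

lemma LL_mul {g h : Hn n → ℂ} (hg : ContDiff ℝ ∞ g) (hh : ContDiff ℝ ∞ h) (p : Hn n) :
    LL (fun p => g p * h p) p = g p * LL h p + LL g p * h p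
      - (1/2) * ∑ j, (LD (eX n j) g p * LD (eX n j) h p + LD (eY n j) g p * LD (eY n j) h p) := by
  unfold LL
  simp_rw [LD2_mul hg hh]
  simp only [Finset.mul_sum, Finset.sum_mul, ← Finset.sum_add_distrib, ← Finset.sum_sub_distrib]
  refine Finset.sum_congr rfl fun j _ => ?_
  ring

variable {σ μ : ℝ}

lemma LL_u (hσ : 0 < σ) (hμ : 0 ≤ μ) (N : ℕ) (p : Hn n) :
    LL (fun p => (ww σ μ p)⁻¹ ^ N) p = n * N * μ * (ww σ μ p)⁻¹ ^ (N+1)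
      - N * (N+1) * (μ^2-1) * (rC p * (ww σ μ p)⁻¹ ^ (N+2)) := by
  unfold LL
  simp_rw [LD2_invpow (contDiff_ww σ μ) (ww_ne hσ hμ), LDXX_ww, LDYY_ww, LDX_ww, LDY_ww]
  have e : ∀ j, (↑N * (↑N + 1) * (ww σ μ p)⁻¹ ^ (N + 2) * (2 * ↑μ * cx j p + 2 * Complex.I * cy j p) ^ 2 -
            ↑N * (ww σ μ p)⁻¹ ^ (N + 1) * (2 * ↑μ) +
          (↑N * (↑N + 1) * (ww σ μ p)⁻¹ ^ (N + 2) * (2 * ↑μ * cy j p - 2 * Complex.I * cx j p) ^ 2 -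
            ↑N * (ww σ μ p)⁻¹ ^ (N + 1) * (2 * ↑μ))) =
      (4 * N * (N+1) * (μ^2 - 1) * (ww σ μ p)⁻¹ ^ (N + 2)) * (cx j p * cx j p + cy j p * cy j p) - 4 * N * μ * (ww σ μ p)⁻¹ ^ (N + 1) := by
    intro j
    linear_combination (4 * ↑N * (↑N + 1) * (ww σ μ p)⁻¹ ^ (N + 2) * (cx j p * cx j p + cy j p * cy j p)) * Complex.I_sq
  simp_rw [e, Finset.sum_sub_distrib, ← Finset.mul_sum]
  simp only [Finset.sum_const, Finset.card_univ, Fintype.card_fin, nsmul_eq_mul]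
  rw [← rC]
  ring

lemma LL_rC (p : Hn n) : LL rC p = - n := by
  unfold LL
  simp_rw [LDXX_rC, LDYY_rC]
  simp only [Finset.sum_const, Finset.card_univ, Fintype.card_fin, nsmul_eq_mul]
  ring

lemma LL_ru (hσ : 0 < σ) (hμ : 0 ≤ μ) (N : ℕ) (p : Hn n) :
    LL (fun p => rC p * (ww σ μ p)⁻¹ ^ N) p = - n * (ww σ μ p)⁻¹ ^ N + (n + 2) * N * μ * (rC p * (ww σ μ p)⁻¹ ^ (N+1))
      - N * (N+1) * (μ^2-1) * (rC p ^ 2 * (ww σ μ p)⁻¹ ^ (N+2)) := by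
  have hw := contDiff_invpow (contDiff_ww (n := n) σ μ) (ww_ne hσ hμ) N
  rw [LL_mul contDiff_rC hw, LL_u hσ hμ, LL_rC]
  simp_rw [LD_invpow (contDiff_ww σ μ) (ww_ne hσ hμ), LDX_ww, LDY_ww, LDX_rC, LDY_rC]
  have e : ∀ j, (2 * cx j p * (-↑N * ((ww σ μ p)⁻¹ ^ (N + 1) * (2 * ↑μ * cx j p + 2 * Complex.I * cy j p))) +
            2 * cy j p * (-↑N * ((ww σ μ p)⁻¹ ^ (N + 1) * (2 * ↑μ * cy j p - 2 * Complex.I * cx j p)))) =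
       (- 4 * N * μ * (ww σ μ p)⁻¹ ^ (N + 1)) * (cx j p * cx j p + cy j p * cy j p) := by
    intro j; ring
  simp_rw [e, ← Finset.mul_sum]
  rw [← rC]; ring

lemma LL_lin {g h : Hn n → ℂ} (hg : ContDiff ℝ ∞ g) (hh : ContDiff ℝ ∞ h) (a b : ℂ) (p : Hn n) :
    LL (fun p => a * g p - b * h p) p = a * LL g p - b * LL h p := by
  have e : ∀ v, ∀ g h : Hn n → ℂ, ContDiff ℝ ∞ g → ContDiff ℝ ∞ h → LD v (fun p => a * g p - b * h p) = fun p => a * LD v g p - b * LD v h p := by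
    intro v g h hg hh; funext p
    rw [LD_sub _ (dif (contDiff_const.mul hg) p) (dif (contDiff_const.mul hh) p), LD_const_mul _ (dif hg p), LD_const_mul _ (dif hh p)]
  unfold LL
  simp_rw [e _ g h hg hh, e _ _ _ (contDiff_LD _ hg) (contDiff_LD _ hh)]
  simp only [Finset.mul_sum, ← Finset.sum_sub_distrib]
  refine Finset.sum_congr rfl fun j _ => ?_
  ring

theorem DD_u (hσ : 0 < σ) (hμ : 0 ≤ μ) (N : ℕ) (p : Hn n) :
    DD (fun p => (ww σ μ p)⁻¹ ^ N) p = N * (N+1) * (μ^2-1) * (n * (n+1) * (ww σ μ p)⁻¹ ^ (N+2)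
      - 2 * (n+1) * (N+2) * μ * (rC p * (ww σ μ p)⁻¹ ^ (N+3))
      + (N+2) * (N+3) * (μ^2-1) * (rC p ^ 2 * (ww σ μ p)⁻¹ ^ (N+4))) := by
  have hw := fun N => contDiff_invpow (contDiff_ww (n := n) σ μ) (ww_ne hσ hμ) N
  have e : LL (fun p : Hn n => (ww σ μ p)⁻¹ ^ N) = fun p => (n * N * μ : ℂ) * (ww σ μ p)⁻¹ ^ (N+1)
      - (N * (N+1) * (μ^2-1) : ℂ) * (rC p * (ww σ μ p)⁻¹ ^ (N+2)) := by
    funext p; rw [LL_u hσ hμ]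
  unfold DD
  rw [e, LL_lin (hw _) (contDiff_rC.mul (hw _)), LL_u hσ hμ, LL_ru hσ hμ, LD2_invpow (contDiff_ww σ μ) (ww_ne hσ hμ),
    LDT_ww, LD_const', Complex.I_sq]
  push_cast
  ring

end

section
variable {n : ℕ}

/-- families of functions with `k` derivatives of size `(1+|p|)^r` -/
def Dec : ℕ → ℤ → (ℕ → Hn n → ℂ) → Prop
  | 0, r, u => ∃ C, ∀ i p, ‖u i p‖ ≤ C * (1 + ‖p‖) ^ r
  | (k+1), r, u => (∃ C, ∀ i p, ‖u i p‖ ≤ C * (1 + ‖p‖) ^ r) ∧ ∀ v, Dec k r (fun i => FD v (u i))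

variable {k : ℕ} {r s : ℤ} {u v : ℕ → Hn n → ℂ}

lemma Dec.zero (h : Dec k r u) : Dec 0 r u := by
  cases k with
  | zero => exact h
  | succ k => exact h.1

lemma Dec.pred (h : Dec (k+1) r u) : Dec k r u := by
  induction k generalizing u with
  | zero => exact h.1
  | succ k ih => exact ⟨h.1, fun v => ih (h.2 v)⟩

lemma Dec0.add (hu : Dec 0 r u) (hv : Dec 0 r v) : Dec 0 r (fun i p => u i p + v i p) := by
  obtain ⟨C, hC⟩ := hu; obtain ⟨D, hD⟩ := hv
  refine ⟨C + D, fun i p => (norm_add_le _ _).trans ?_⟩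
  rw [add_mul]; exact add_le_add (hC i p) (hD i p)

lemma Dec0.mul (hu : Dec 0 r u) (hv : Dec 0 s v) : Dec 0 (r+s) (fun i p => u i p * v i p) := by
  obtain ⟨C, hC⟩ := hu; obtain ⟨D, hD⟩ := hv
  refine ⟨C * D, fun i p => ?_⟩
  have h0 : (1 + ‖p‖) ≠ 0 := by positivity
  rw [norm_mul, zpow_add₀ h0]
  calc ‖u i p‖ * ‖v i p‖ ≤ (C * (1 + ‖p‖) ^ r) * (D * (1 + ‖p‖) ^ s) :=
        mul_le_mul (hC i p) (hD i p) (norm_nonneg _) ((norm_nonneg _).trans (hC i p))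
    _ = _ := by ring

lemma Dec0.mono (hu : Dec 0 r u) (h : r ≤ s) : Dec 0 s u := by
  obtain ⟨C, hC⟩ := hu
  refine ⟨|C|, fun i p => (hC i p).trans ?_⟩
  have h1 : (1:ℝ) ≤ 1 + ‖p‖ := by have := norm_nonneg p; linarith
  have h2 := zpow_le_zpow_right₀ h1 h
  have h3 : (0:ℝ) < (1 + ‖p‖)^r := by positivity
  calc C * (1 + ‖p‖) ^ r ≤ |C| * (1 + ‖p‖) ^ r := by gcongr; exact le_abs_self C
    _ ≤ _ := by gcongr

lemma Dec.mono (hu : Dec k r u) (h : r ≤ s) : Dec k s u := by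
  induction k generalizing u with
  | zero => exact Dec0.mono hu h
  | succ k ih => exact ⟨Dec0.mono hu.zero h, fun v => ih (hu.2 v)⟩

def SmF (u : ℕ → Hn n → ℂ) : Prop := ∀ i, ContDiff ℝ ∞ (u i)
lemma SmF.FD (h : SmF u) (v : Hn n) : SmF (fun i => FD v (u i)) := fun i =>
  ((h i).fderiv_right (m := ∞) (by simp)).clm_apply contDiff_const

lemma FD_add' {g h : Hn n → ℂ} (hg : ContDiff ℝ ∞ g) (hh : ContDiff ℝ ∞ h) (v : Hn n) :
    FD v (fun p => g p + h p) = fun p => FD v g p + FD v h p := by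
  funext p; simp only [FD, VD]; rw [fderiv_fun_add (dif hg p) (dif hh p)]; rfl
lemma FD_mul' {g h : Hn n → ℂ} (hg : ContDiff ℝ ∞ g) (hh : ContDiff ℝ ∞ h) (v : Hn n) :
    FD v (fun p => g p * h p) = fun p => g p * FD v h p + FD v g p * h p := by
  funext p; simp only [FD, VD]; rw [fderiv_fun_mul (dif hg p) (dif hh p)]; simp; ring

lemma Dec.add (hu : Dec k r u) (hv : Dec k r v) (su : SmF u) (sv : SmF v) : Dec k r (fun i p => u i p + v i p) := by
  induction k generalizing u v with
  | zero => exact Dec0.add hu hv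
  | succ k ih =>
    refine ⟨Dec0.add hu.zero hv.zero, fun w => ?_⟩
    have := ih (hu.2 w) (hv.2 w) (su.FD w) (sv.FD w)
    simp_rw [FD_add' (su _) (sv _)]; exact this

lemma Dec.mul (hu : Dec k r u) (hv : Dec k s v) (su : SmF u) (sv : SmF v) : Dec k (r+s) (fun i p => u i p * v i p) := by
  induction k generalizing u v with
  | zero => exact Dec0.mul hu hv
  | succ k ih =>
    refine ⟨Dec0.mul hu.zero hv.zero, fun w => ?_⟩
    have h1 := ih (hu.pred) (hv.2 w) su (sv.FD w)
    have h2 := ih (hu.2 w) (hv.pred) (su.FD w) sv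
    have := h1.add h2 (fun i => (su i).mul (sv.FD w i)) (fun i => (su.FD w i).mul (sv i))
    simp_rw [FD_mul' (su _) (sv _)]; exact this

lemma Dec.const (c : ℂ) : Dec k 0 (fun _ => (fun _ : Hn n => c)) := by
  induction k generalizing c with
  | zero => exact ⟨‖c‖, fun i p => by simp⟩
  | succ k ih =>
    refine ⟨⟨‖c‖, fun i p => by simp⟩, fun w => ?_⟩
    have e : FD w (fun _ : Hn n => c) = fun _ => 0 := by funext p; simp [FD, VD]
    simp_rw [e]; exact ih 0

lemma SmF.const {g : Hn n → ℂ} (h : ContDiff ℝ ∞ g) : SmF (fun _ => g) := fun _ => h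

lemma Dec0.clm (L : Hn n →L[ℝ] ℂ) : Dec 0 1 (fun _ => (L : Hn n → ℂ)) := by
  refine ⟨‖L‖, fun i p => (L.le_opNorm p).trans ?_⟩
  rw [zpow_one]; gcongr; linarith

lemma Dec.clm (L : Hn n →L[ℝ] ℂ) : Dec k 1 (fun _ => (L : Hn n → ℂ)) := by
  cases k with
  | zero => exact Dec0.clm L
  | succ k =>
    refine ⟨Dec0.clm L, fun w => ?_⟩
    have e : FD w L = fun _ => L w := by funext p; simp [FD, VD]
    simp_rw [e]; exact (Dec.const _).mono (by norm_num)

lemma Dec.cof (w : Hn n) : Dec k 1 (fun _ => (fun p : Hn n => (cof w p : ℂ))) :=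
  Dec.clm (Complex.ofRealCLM ∘L (_root_.cof w))

lemma LD_eq' (w : Hn n) (g : Hn n → ℂ) : LD w g = fun p => FD w g p + (cof w p : ℂ) * FD (eT n) g p := by
  funext p; rw [LD_eq]; rfl

lemma Dec.LD (hu : Dec (k+1) r u) (su : SmF u) (w : Hn n) : Dec k (r+1) (fun i => LD w (u i)) := by
  have h1 : Dec k (r+1) (fun i => FD w (u i)) := (hu.2 w).mono (by omega)
  have sc : SmF (fun _ => (fun p : Hn n => (_root_.cof w p : ℂ))) := SmF.const (contDiff_cof w)
  have h2 := (Dec.cof (k := k) w).mul (hu.2 (eT n)) sc (su.FD _)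
  rw [add_comm 1 r] at h2
  have := h1.add h2 (su.FD _) (fun i => (sc i).mul (su.FD _ i))
  simp_rw [LD_eq']; exact this

lemma SmF.LD (h : SmF u) (w : Hn n) : SmF (fun i => LD w (u i)) := fun i => contDiff_LD w (h i)

lemma Dec.const_mul (hu : Dec k r u) (su : SmF u) (c : ℂ) : Dec k r (fun i p => c * u i p) := by
  have := (Dec.const (k := k) (n := n) c).mul hu (SmF.const contDiff_const) su
  rwa [zero_add] at this

lemma SmF.sum {ι : Type*} (t : Finset ι) {u : ι → ℕ → Hn n → ℂ} (hu : ∀ j ∈ t, SmF (u j)) : SmF (fun i p => ∑ j ∈ t, u j i p) :=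
  fun i => ContDiff.sum fun j hj => hu j hj i

lemma Dec.sum {ι : Type*} (t : Finset ι) {u : ι → ℕ → Hn n → ℂ} (hu : ∀ j ∈ t, Dec k r (u j)) (su : ∀ j ∈ t, SmF (u j)) :
    Dec k r (fun i p => ∑ j ∈ t, u j i p) := by
  classical
  have h0 : Dec k r (fun _ => (fun _ : Hn n => (0:ℂ))) := by
    clear hu su
    induction k with
    | zero => exact ⟨0, fun i p => by simp⟩
    | succ k ih =>
      refine ⟨⟨0, fun i p => by simp⟩, fun w => ?_⟩
      have e : FD w (fun _ : Hn n => (0:ℂ)) = fun _ => 0 := by funext p; simp [FD, VD]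
      simp_rw [e]; exact ih
  induction t using Finset.induction_on with
  | empty => simpa using h0
  | insert a t ha ih =>
    simp only [Finset.sum_insert ha]
    exact (hu a (by simp)).add (ih (fun j hj => hu j (by simp [hj])) (fun j hj => su j (by simp [hj])))
      (su a (by simp)) (SmF.sum t fun j hj => su j (by simp [hj]))

lemma Dec.LL (hu : Dec (k+2) r u) (su : SmF u) : Dec k (r+2) (fun i => LL (u i)) := by
  unfold _root_.LL
  have h : ∀ w, Dec k (r+2) (fun i => _root_.LD w (_root_.LD w (u i))) := fun w => by
    have := (Dec.LD (k := k+1) hu su w).LD (su.LD w) w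
    rwa [add_assoc] at this
  have s : ∀ w, SmF (fun i => _root_.LD w (_root_.LD w (u i))) := fun w => (su.LD w).LD w
  refine Dec.const_mul (Dec.sum _ (fun j _ => (h _).add (h _) (s _) (s _)) (fun j _ => fun i => (s _ i).add (s _ i))) ?_ _
  exact SmF.sum _ fun j _ => fun i => (s _ i).add (s _ i)

lemma SmF.LL (su : SmF u) : SmF (fun i => LL (u i)) := fun i => contDiff_LL (su i)

lemma Dec.DD (hu : Dec 4 r u) (su : SmF u) : Dec 0 (r+4) (fun i => DD (u i)) := by
  have h1 := (Dec.LL (k := 2) hu su).LL su.LL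
  have h2 := (Dec.LD (k := 1) hu.pred.pred su (eT n)).LD (su.LD _) (eT n)
  rw [add_assoc] at h1 h2
  have h3 := (h2.const_mul ((su.LD _).LD _) ((n:ℂ)^2)).mono (s := r + 4) (by omega)
  exact h1.add h3 su.LL.LL (fun i => contDiff_const.mul ((su.LD _).LD _ i))

/-- dilated test functions -/
lemma Dec.dil {χ : Hn n → ℂ} (h : Tst χ) (c : ℕ → ℝ) (hc : ∀ i, |c i| ≤ 1) :
    Dec k 0 (fun i p => (c i : ℂ) * χ (((i:ℝ)+1)⁻¹ • p)) := by
  have h0 : ∀ {χ : Hn n → ℂ} (h : Tst χ) (c : ℕ → ℝ) (hc : ∀ i, |c i| ≤ 1), Dec 0 0 (fun i p => (c i : ℂ) * χ (((i:ℝ)+1)⁻¹ • p)) := by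
    intro χ h c hc
    obtain ⟨B, hB⟩ := h.2.exists_bound_of_continuous h.continuous
    refine ⟨B, fun i p => ?_⟩
    rw [norm_mul, zpow_zero, mul_one, Complex.norm_real, Real.norm_eq_abs]
    have := hB (((i:ℝ)+1)⁻¹ • p)
    nlinarith [hc i, norm_nonneg (χ (((i:ℝ)+1)⁻¹ • p)), abs_nonneg (c i)]
  induction k generalizing χ c with
  | zero => exact h0 h c hc
  | succ k ih =>
    refine ⟨h0 h c hc, fun w => ?_⟩
    have := ih (h.FD w) (fun i => c i * ((i:ℝ)+1)⁻¹) (fun i => ?_)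
    · convert this using 3 with i p
      have hd : HasFDerivAt (fun p : Hn n => χ (((i:ℝ)+1)⁻¹ • p)) ((fderiv ℝ χ (((i:ℝ)+1)⁻¹ • p)).comp (((i:ℝ)+1)⁻¹ • ContinuousLinearMap.id ℝ (Hn n))) p :=
        (h.differentiable _).hasFDerivAt.comp p (((i:ℝ)+1)⁻¹ • ContinuousLinearMap.id ℝ (Hn n)).hasFDerivAt
      simp only [_root_.FD, VD]
      rw [(hd.const_mul (c i : ℂ)).fderiv]
      simp; ring
    · rw [abs_mul]
      have h1 : |((i:ℝ)+1)⁻¹| ≤ 1 := by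
        rw [abs_of_pos (by positivity)]; exact inv_le_one_of_one_le₀ (by have : (0:ℝ) ≤ i := by positivity
                                                                         linarith)
      nlinarith [hc i, abs_nonneg (c i), abs_nonneg (((i:ℝ)+1)⁻¹)]

end

section
variable {n : ℕ} {f : Hn n → ℂ} {M : ℝ} {σ μ : ℝ}

lemma finrank_Hn : Module.finrank ℝ (Hn n) = 2 * n + 1 := by
  simp [Module.finrank_prod, Module.finrank_pi_fintype, Complex.finrank_real_complex, mul_comm]

lemma integrable_zpow {r : ℤ} (hr : r < -(2 * n + 1)) : Integrable (fun p : Hn n => (1 + ‖p‖) ^ r) := by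
  have h := integrable_one_add_norm (E := Hn n) (μ := volume) (r := ((-r : ℤ) : ℝ)) (by
    rw [finrank_Hn]; exact_mod_cast (by push_cast; omega))
  refine h.congr (Eventually.of_forall fun p => ?_)
  simp only []
  rw [← Real.rpow_intCast]; push_cast; simp

/-- the weak equation extends to rapidly decaying functions -/
lemma weak_ext (hf : FH f M) (hD : ∀ p, DD f p = 0) {u : Hn n → ℂ} (su : ContDiff ℝ ∞ u) {r : ℤ}
    (hu : Dec 4 r (fun _ => u)) (hr : r + 4 < -(2 * n + 1)) : ∫ p, f p * DD u p = 0 := by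
  let b : ContDiffBump (0 : Hn n) := ⟨1, 2, by norm_num, by norm_num⟩
  let θ : Hn n → ℂ := fun p => (b p : ℂ)
  have hθ : Tst θ := ⟨Complex.ofRealCLM.contDiff.comp b.contDiff, b.hasCompactSupport.comp_left (g := fun x : ℝ => (x:ℂ)) (by simp)⟩
  let g : ℕ → Hn n → ℂ := fun i p => (((1:ℝ):ℝ) : ℂ) * θ (((i:ℝ)+1)⁻¹ • p) * u p
  have d1 := Dec.dil (k := 4) hθ (fun _ => 1) (fun _ => by simp)
  have s1 : SmF (fun (i:ℕ) p => (((1:ℝ):ℝ) : ℂ) * θ (((i:ℝ)+1)⁻¹ • p)) := fun i =>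
    contDiff_const.mul (hθ.contDiff.comp (contDiff_const_smul _))
  have hg := d1.mul hu s1 (SmF.const su)
  rw [zero_add] at hg
  have sg : SmF g := fun i => (s1 i).mul su
  have cpt : ∀ i : ℕ, HasCompactSupport (fun p : Hn n => θ (((i:ℝ)+1)⁻¹ • p)) := by
    intro i
    have h0 : ((i:ℝ)+1)⁻¹ ≠ 0 := by positivity
    exact hθ.2.comp_homeomorph (Homeomorph.smulOfNeZero (α := Hn n) (((i:ℝ)+1)⁻¹) h0)
  have tg : ∀ i, Tst (g i) := fun i => ⟨sg i, by
    have h1 : HasCompactSupport (fun p : Hn n => (((1:ℝ):ℝ) : ℂ) * θ (((i:ℝ)+1)⁻¹ • p)) := (cpt i).mul_left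
    exact h1.mul_right⟩
  obtain ⟨C, hC⟩ := Dec.DD hg sg
  have hlim : Tendsto (fun i => ∫ p, f p * DD (g i) p) atTop (𝓝 (∫ p, f p * DD u p)) := by
    apply tendsto_integral_of_dominated_convergence (fun p => M * (C * (1 + ‖p‖) ^ (r+4)))
    · intro i; exact ((tg i).DD.mul_left hf.sm).continuous.aestronglyMeasurable
    · exact ((integrable_zpow hr).const_mul C).const_mul M
    · intro i
      refine Eventually.of_forall fun p => ?_
      rw [norm_mul]
      exact mul_le_mul (hf.bd p) (hC i p) (norm_nonneg _) hf.nonneg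
    · refine Eventually.of_forall fun p => ?_
      have loc : ∀ᶠ i : ℕ in atTop, g i =ᶠ[𝓝 p] u := by
        obtain ⟨K, hK⟩ := exists_nat_gt (‖p‖ + 1)
        filter_upwards [eventually_ge_atTop K] with i hi
        have hi' : (K:ℝ) ≤ i := by exact_mod_cast hi
        filter_upwards [Metric.ball_mem_nhds p one_pos] with q hq
        have hq' : ‖q‖ < ‖p‖ + 1 := by
          have := norm_sub_norm_le q p
          rw [Metric.mem_ball, dist_eq_norm] at hq; linarith
        have : b (((i:ℝ)+1)⁻¹ • q) = 1 := by
          apply b.one_of_mem_closedBall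
          rw [mem_closedBall_zero_iff, norm_smul, Real.norm_eq_abs, abs_of_pos (by positivity)]
          change _ ≤ (1:ℝ)
          rw [inv_mul_le_iff₀ (by positivity)]; linarith
        simp [g, θ, this]
      have LDc : ∀ (w : Hn n) (g h : Hn n → ℂ) (p : Hn n), g =ᶠ[𝓝 p] h → LD w g =ᶠ[𝓝 p] LD w h := by
        intro w g h p he
        filter_upwards [he.fderiv (𝕜 := ℝ)] with q hq
        simp only [LD, hq]
      have LLc : ∀ (g h : Hn n → ℂ) (p : Hn n), g =ᶠ[𝓝 p] h → LL g =ᶠ[𝓝 p] LL h := by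
        intro g h p he
        have e1 : ∀ᶠ q in 𝓝 p, ∀ j, LD (eX n j) (LD (eX n j) g) q = LD (eX n j) (LD (eX n j) h) q := by
          rw [eventually_all]; intro j; exact LDc _ _ _ _ (LDc _ _ _ _ he)
        have e2 : ∀ᶠ q in 𝓝 p, ∀ j, LD (eY n j) (LD (eY n j) g) q = LD (eY n j) (LD (eY n j) h) q := by
          rw [eventually_all]; intro j; exact LDc _ _ _ _ (LDc _ _ _ _ he)
        filter_upwards [e1, e2] with q h1 h2
        simp only [LL, h1, h2]
      apply tendsto_const_nhds.congr'
      filter_upwards [loc] with i hi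
      have h1 := (LLc _ _ _ (LLc _ _ _ hi)).eq_of_nhds
      have h2 := (LDc (eT n) _ _ _ (LDc (eT n) _ _ _ hi)).eq_of_nhds
      simp only [DD, h1, h2]
  have hz : ∀ i, ∫ p, f p * DD (g i) p = 0 := fun i => DD_weak hf.sm hD (tg i)
  simp_rw [hz] at hlim
  exact tendsto_nhds_unique hlim tendsto_const_nhds |>.symm ▸ rfl

/-- lower bound for `|w|` -/
lemma ww_lower {c : ℝ} (h1 : 0 < c) (hc : c ≤ 1) (hσ : c ≤ σ) (hμ : c ≤ μ) (p : Hn n) :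
    c / 4 * (1 + ‖p‖) ≤ ‖ww σ μ p‖ := by
  have a1 : σ + μ * rho p ≤ ‖ww σ μ p‖ := by
    rw [← ww_re]; exact Complex.re_le_norm _
  have a2 : |p.2| ≤ ‖ww σ μ p‖ := by
    rw [← ww_im σ μ p]; exact Complex.abs_im_le_norm _
  have a3 : ‖p.1‖^2 ≤ rho p := norm_sq_le p.1
  have a4 : ‖p‖ ≤ ‖p.1‖ + |p.2| := by
    rw [Prod.norm_def]; exact max_le (by have := abs_nonneg p.2; linarith) (by have := norm_nonneg p.1; rw [Real.norm_eq_abs]; linarith)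
  have a5 : c * (1 + rho p) ≤ σ + μ * rho p := by nlinarith [rho_nonneg p]
  have a6 : ‖p.1‖ ≤ 1 + ‖p.1‖^2 := by nlinarith [sq_nonneg (‖p.1‖ - 1), norm_nonneg p.1]
  have a7 : c * |p.2| ≤ |p.2| := by nlinarith [abs_nonneg p.2]
  nlinarith [norm_nonneg p.1, abs_nonneg p.2, norm_nonneg p]

lemma Dec.ww {k : ℕ} : Dec k 2 (fun _ => (ww σ μ : Hn n → ℂ)) ∧ ∀ v, Dec k 1 (fun _ => FD v (ww σ μ : Hn n → ℂ)) := by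
  have sx : ∀ j, SmF (fun _ => (cx j : Hn n → ℂ)) := fun j => SmF.const (contDiff_cx j)
  have sy : ∀ j, SmF (fun _ => (cy j : Hn n → ℂ)) := fun j => SmF.const (contDiff_cy j)
  have dx : ∀ k j, Dec k 1 (fun _ => (cx j : Hn n → ℂ)) := fun k j => Dec.clm (cxL j)
  have dy : ∀ k j, Dec k 1 (fun _ => (cy j : Hn n → ℂ)) := fun k j => Dec.clm (cyL j)
  have dt : ∀ k, Dec k 1 (fun _ => (ct : Hn n → ℂ)) := fun k => Dec.clm ctL
  have st : SmF (fun _ => (ct : Hn n → ℂ)) := SmF.const contDiff_ct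
  constructor
  · unfold _root_.ww
    have h1 : Dec k 2 (fun _ => (rC : Hn n → ℂ)) := by
      unfold rC
      refine Dec.sum _ (fun j _ => ?_) (fun j _ => SmF.const (by fun_prop))
      exact ((dx k j).mul (dx k j) (sx j) (sx j)).add ((dy k j).mul (dy k j) (sy j) (sy j)) (SmF.const (by fun_prop)) (SmF.const (by fun_prop))
    have h2 := (h1.const_mul (SmF.const contDiff_rC) (μ:ℂ))
    have h3 := ((dt k).const_mul st Complex.I).mono (s := 2) (by norm_num)
    have h4 : Dec k 2 (fun _ => (fun _ : Hn n => (σ:ℂ))) := (Dec.const _).mono (by norm_num)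
    exact (h4.add h2 (SmF.const (by fun_prop)) (SmF.const (by fun_prop))).add h3 (SmF.const (by fun_prop)) (SmF.const (by fun_prop))
  · intro v
    have e : FD v (_root_.ww σ μ : Hn n → ℂ) = fun p => (∑ j, ((2 * μ * cxL j v) * cx j p + (2 * μ * cyL j v) * cy j p)) + Complex.I * ctL v := by
      have fm : ∀ (g h : Hn n → ℂ) (p : Hn n), ContDiff ℝ ∞ g → ContDiff ℝ ∞ h → FD v (fun p => g p * h p) p = g p * FD v h p + FD v g p * h p :=
        fun g h p hg hh => congrFun (FD_mul' hg hh v) p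
      have fcl : ∀ L : Hn n →L[ℝ] ℂ, ∀ p, FD v L p = L v := by intro L p; simp [FD, VD]
      have fco : ∀ (c : ℂ) (p : Hn n), FD v (fun _ => c) p = 0 := by intro c p; simp [FD, VD]
      funext p
      unfold _root_.ww rC
      rw [FD_add' (by fun_prop) (by fun_prop), FD_add' (by fun_prop) (by fun_prop)]
      simp only []
      rw [fm _ _ p (by fun_prop) (by fun_prop), fm _ _ p (by fun_prop) (by fun_prop), fco, fco, fco, ct_eq, fcl]
      have : FD v (fun p : Hn n => ∑ j, (cx j p * cx j p + cy j p * cy j p)) p = ∑ j, FD v (fun p : Hn n => (cx j p * cx j p + cy j p * cy j p)) p := by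
        simp only [FD, VD]
        rw [fderiv_fun_sum fun j _ => dif (by fun_prop) p]; simp
      rw [this, Finset.mul_sum]
      simp only [zero_mul, zero_add, add_zero]
      congr 1
      refine Finset.sum_congr rfl fun j _ => ?_
      rw [FD_add' (by fun_prop) (by fun_prop)]
      simp only []
      rw [fm _ _ p (by fun_prop) (by fun_prop), fm _ _ p (by fun_prop) (by fun_prop), cx_eq, cy_eq, fcl, fcl]
      ring
    simp_rw [e]
    refine (Dec.sum _ (fun j _ => ?_) (fun j _ => SmF.const (by fun_prop))).add ((Dec.const _).mono (by norm_num)) (SmF.const (by fun_prop)) (SmF.const (by fun_prop))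
    exact ((dx k j).const_mul (sx j) _).add ((dy k j).const_mul (sy j) _) (SmF.const (by fun_prop)) (SmF.const (by fun_prop))

lemma FD_inv' {g : Hn n → ℂ} (hg : ContDiff ℝ ∞ g) (h0 : ∀ p, g p ≠ 0) (v : Hn n) :
    FD v (fun p => (g p)⁻¹) = fun p => (-1) * ((g p)⁻¹ * (g p)⁻¹ * FD v g p) := by
  funext p
  have h2 := (hasDerivAt_inv (h0 p)).comp_hasFDerivAt p (dif hg p).hasFDerivAt
  simp only [FD, VD]
  have e : (fun p => (g p)⁻¹) = (fun z : ℂ => z⁻¹) ∘ g := rfl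
  rw [e, h2.fderiv]
  simp only [_root_.smul_apply, smul_eq_mul, ← inv_pow]; ring

lemma Dec.wwinv {k : ℕ} (hσ : 0 < σ) (hμ : 0 < μ) : Dec k (-1) (fun _ => (fun p : Hn n => (_root_.ww σ μ p)⁻¹)) := by
  have h0 : Dec 0 (-1) (fun _ => (fun p : Hn n => (_root_.ww σ μ p)⁻¹)) := by
    let c := min 1 (min σ μ)
    have hc : 0 < c := by simp [c, hσ, hμ]
    refine ⟨4 / c, fun i p => ?_⟩
    have := ww_lower (σ := σ) (μ := μ) hc (min_le_left _ _) ((min_le_right _ _).trans (min_le_left _ _)) ((min_le_right _ _).trans (min_le_right _ _)) p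
    rw [norm_inv, zpow_neg_one]
    calc ‖_root_.ww σ μ p‖⁻¹ ≤ (c / 4 * (1 + ‖p‖))⁻¹ := inv_anti₀ (by positivity) this
      _ = _ := by field_simp
  have si : SmF (fun _ => (fun p : Hn n => (_root_.ww σ μ p)⁻¹)) := SmF.const ((contDiff_ww σ μ).inv (ww_ne hσ hμ.le))
  have sf : ∀ v, SmF (fun _ => FD v (_root_.ww σ μ : Hn n → ℂ)) := fun v => (SmF.const (contDiff_ww σ μ)).FD v
  induction k with
  | zero => exact h0
  | succ k ih =>
    refine ⟨h0, fun v => ?_⟩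
    simp_rw [FD_inv' (contDiff_ww σ μ) (ww_ne hσ hμ.le)]
    have := (ih.mul ih si si).mul (Dec.ww.2 v) (fun i => (si i).mul (si i)) (sf v)
    exact this.const_mul (fun i => ((si i).mul (si i)).mul (sf v i)) _

lemma Dec.wwpow {k : ℕ} (hσ : 0 < σ) (hμ : 0 < μ) (N : ℕ) : Dec k (-N) (fun _ => (fun p : Hn n => (_root_.ww σ μ p)⁻¹ ^ N)) := by
  induction N with
  | zero => simpa using Dec.const (k := k) (n := n) 1
  | succ N ih =>
    have := ih.mul (Dec.wwinv (k := k) hσ hμ) (SmF.const (contDiff_invpow (contDiff_ww σ μ) (ww_ne hσ hμ.le) N)) (SmF.const ((contDiff_ww σ μ).inv (ww_ne hσ hμ.le)))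
    simp_rw [pow_succ]
    convert this using 1; push_cast; ring

theorem weak_u (hf : FH f M) (hD : ∀ p, DD f p = 0) (hσ : 0 < σ) (hμ : 0 < μ) {N : ℕ} (hN : 2 * n + 6 ≤ N) :
    ∫ p, f p * DD (fun p => (ww σ μ p)⁻¹ ^ N) p = 0 :=
  weak_ext hf hD (contDiff_invpow (contDiff_ww σ μ) (ww_ne hσ hμ.le) N) (Dec.wwpow hσ hμ N) (by omega)

end

section
variable {n : ℕ} {f : Hn n → ℂ} {M : ℝ} {σ μ : ℝ}

def Bk (f : Hn n → ℂ) (σ : ℝ) (k N : ℕ) (μ : ℝ) : ℂ := ∫ p, f p * (rC p ^ k * (ww σ μ p)⁻¹ ^ N)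

def bnd (n : ℕ) (c : ℝ) (k l : ℕ) (p : Hn n) : ℝ := (1/c)^k * (4/c)^l * (1 + ‖p‖) ^ (-(l:ℤ))

lemma bnd_int {c : ℝ} {k l : ℕ} (hl : 2 * n + 2 ≤ l) : Integrable (bnd n c k l) := by
  unfold bnd; exact (integrable_zpow (by omega)).const_mul _

lemma bnd_le {c : ℝ} (h1 : 0 < c) (hc : c ≤ 1) (hσ : c ≤ σ) (hμ : c ≤ μ) (k l : ℕ) (p : Hn n) :
    ‖rC p ^ k * (ww σ μ p)⁻¹ ^ (k + l)‖ ≤ bnd n c k l p := by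
  have a0 := ww_lower h1 hc hσ hμ p
  have hw : 0 < ‖ww σ μ p‖ := lt_of_lt_of_le (by positivity) a0
  have a1 : σ + μ * rho p ≤ ‖ww σ μ p‖ := by
    rw [← ww_re]; exact Complex.re_le_norm _
  have a2 : ‖rC p * (ww σ μ p)⁻¹‖ ≤ 1 / c := by
    rw [norm_mul, norm_inv, rC_eq, Complex.norm_real, Real.norm_eq_abs, abs_of_nonneg (rho_nonneg p),
      ← div_eq_mul_inv, div_le_div_iff₀ hw h1]
    nlinarith [rho_nonneg p]
  have a3 : ‖(ww σ μ p)⁻¹‖ ≤ 4 / c * (1 + ‖p‖)⁻¹ := by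
    rw [norm_inv]
    calc ‖ww σ μ p‖⁻¹ ≤ (c / 4 * (1 + ‖p‖))⁻¹ := inv_anti₀ (by positivity) a0
      _ = _ := by field_simp
  have e : rC p ^ k * (ww σ μ p)⁻¹ ^ (k + l) = (rC p * (ww σ μ p)⁻¹)^k * ((ww σ μ p)⁻¹)^l := by ring
  rw [e, norm_mul, norm_pow, norm_pow, bnd, zpow_neg, zpow_natCast, ← inv_pow, mul_assoc, ← mul_pow]
  gcongr

lemma contDiff_P (hσ : 0 < σ) (hμ : 0 ≤ μ) (k N : ℕ) : ContDiff ℝ ∞ (fun p : Hn n => rC p ^ k * (ww σ μ p)⁻¹ ^ N) :=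
  (contDiff_rC.pow k).mul (contDiff_invpow (contDiff_ww σ μ) (ww_ne hσ hμ) N)

lemma min3 {a b : ℝ} (ha : 0 < a) (hb : 0 < b) : ∃ c, 0 < c ∧ c ≤ 1 ∧ c ≤ a ∧ c ≤ b :=
  ⟨min 1 (min a b), by simp [ha, hb], min_le_left _ _, (min_le_right _ _).trans (min_le_left _ _), (min_le_right _ _).trans (min_le_right _ _)⟩

lemma P_int (hσ : 0 < σ) (hμ : 0 < μ) {k l : ℕ} (hl : 2 * n + 2 ≤ l) :
    Integrable (fun p : Hn n => rC p ^ k * (ww σ μ p)⁻¹ ^ (k + l)) := by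
  obtain ⟨c, h1, h2, h3, h4⟩ := min3 hσ hμ
  exact (bnd_int hl).mono' (contDiff_P hσ hμ.le k _).continuous.aestronglyMeasurable
    (Eventually.of_forall fun p => bnd_le h1 h2 h3 h4 k l p)

lemma FH.int (hf : FH f M) {g : Hn n → ℂ} (hg : Integrable g) : Integrable (fun p => f p * g p) :=
  hg.bdd_mul hf.sm.continuous.aestronglyMeasurable (Eventually.of_forall hf.bd)

lemma Bk_deriv (hf : FH f M) (hσ : 0 < σ) (hμ : 0 < μ) {k l : ℕ} (hl : 2 * n + 2 ≤ l) :
    HasDerivAt (Bk f σ k (k + l)) (- ((k + l : ℕ) : ℂ) * Bk f σ (k+1) (k + 1 + l) μ) μ := by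
  obtain ⟨c, h1, h2, h3, h4⟩ := min3 hσ (half_pos hμ)
  have hs : Ioi (μ/2) ∈ 𝓝 μ := Ioi_mem_nhds (by linarith)
  have := hasDerivAt_integral_of_dominated_loc_of_deriv_le (μ := (volume : Measure (Hn n)))
    (F := fun b p => f p * (rC p ^ k * (ww σ b p)⁻¹ ^ (k + l)))
    (F' := fun b p => f p * (- ((k + l : ℕ) : ℂ) * (rC p ^ (k+1) * (ww σ b p)⁻¹ ^ (k + 1 + l)))) (x₀ := μ)
    (bound := fun p => M * (((k + l : ℕ) : ℝ) * bnd n c (k+1) l p)) hs ?_ ?_ ?_ ?_ ?_ ?_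
  · refine this.2.congr_deriv ?_
    unfold Bk
    rw [← integral_const_mul]
    congr 1; funext p; ring
  · filter_upwards [hs] with b hb
    have hb' : 0 < b := lt_trans (half_pos hμ) hb
    exact (hf.sm.continuous.mul (contDiff_P hσ hb'.le _ _).continuous).aestronglyMeasurable
  · exact hf.int (P_int hσ hμ hl)
  · exact (hf.sm.continuous.mul (continuous_const.mul (contDiff_P hσ hμ.le _ _).continuous)).aestronglyMeasurable
  · refine Eventually.of_forall fun p b hb => ?_
    rw [norm_mul, norm_mul, norm_neg, Complex.norm_natCast]
    have := bnd_le (n := n) h1 h2 h3 (h4.trans (le_of_lt hb)) (k+1) l p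
    have h0 := hf.nonneg
    have := hf.bd p
    gcongr
  · exact ((bnd_int hl).const_mul _).const_mul _
  · refine Eventually.of_forall fun p b hb => ?_
    have hb' : 0 < b := lt_trans (half_pos hμ) hb
    have d1 : HasDerivAt (fun b : ℝ => ww σ b p) (rC p) b := by
      unfold ww
      have := (((Complex.ofRealCLM.hasDerivAt (x := b)).mul_const (rC p)).const_add (σ:ℂ)).add_const (Complex.I * ct p)
      simpa using this
    have d2 : HasDerivAt (fun z : ℂ => z⁻¹ ^ (k+l)) (-(((k+l : ℕ):ℂ)) * (ww σ b p)⁻¹ ^ (k+l+1)) (ww σ b p) := by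
      refine ((hasDerivAt_inv (ww_ne hσ hb'.le p)).pow (k+l)).congr_deriv ?_
      rcases (k+l) with _ | N
      · simp
      · simp only [Nat.add_sub_cancel]; ring
    have d3 := ((d2.comp_of_eq b d1 rfl).const_mul (rC p ^ k)).const_mul (f p)
    refine d3.congr_deriv ?_
    have : k + 1 + l = k + l + 1 := by ring
    rw [this]; ring

lemma Bk_ode (hf : FH f M) (hD : ∀ p, DD f p = 0) (hσ : 0 < σ) (hμ : 0 < μ) (h1 : μ ≠ 1) {N : ℕ} (hN : 2 * n + 8 ≤ N) :
    (n * (n+1) : ℂ) * Bk f σ 0 N μ - 2 * (n+1) * N * μ * Bk f σ 1 (N+1) μ + N * (N+1) * (μ^2-1) * Bk f σ 2 (N+2) μ = 0 := by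
  obtain ⟨K, rfl⟩ : ∃ K, N = K + 2 := ⟨N - 2, by omega⟩
  have h := weak_u hf hD hσ hμ (N := K) (by omega)
  simp_rw [DD_u hσ hμ.le] at h
  have i0 := hf.int (P_int (n := n) hσ hμ (k := 0) (l := K+2) (by omega))
  have i1 := hf.int (P_int (n := n) hσ hμ (k := 1) (l := K+2) (by omega))
  have i2 := hf.int (P_int (n := n) hσ hμ (k := 2) (l := K+2) (by omega))
  have e : ∀ p : Hn n, f p * (K * (K+1) * ((μ:ℂ)^2-1) * (n * (n+1) * (ww σ μ p)⁻¹ ^ (K+2)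
      - 2 * (n+1) * (K+2) * μ * (rC p * (ww σ μ p)⁻¹ ^ (K+3))
      + (K+2) * (K+3) * (μ^2-1) * (rC p ^ 2 * (ww σ μ p)⁻¹ ^ (K+4)))) =
      (K * (K+1) * ((μ:ℂ)^2-1)) * (((n * (n+1) : ℂ) * (f p * (rC p ^ 0 * (ww σ μ p)⁻¹ ^ (0 + (K+2))))
      - (2 * (n+1) * (K+2) * μ) * (f p * (rC p ^ 1 * (ww σ μ p)⁻¹ ^ (1 + (K+2)))))
      + ((K+2) * (K+3) * (μ^2-1)) * (f p * (rC p ^ 2 * (ww σ μ p)⁻¹ ^ (2 + (K+2))))) := by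
    intro p
    have e1 : 1 + (K+2) = K + 3 := by ring
    have e2 : 2 + (K+2) = K + 4 := by ring
    rw [e1, e2, zero_add]; ring
  simp_rw [e] at h
  have e3 := integral_add ((i0.const_mul (n * (n+1) : ℂ)).sub (i1.const_mul (2 * (n+1) * (K+2) * μ : ℂ)))
    (i2.const_mul ((K+2) * (K+3) * (μ^2-1) : ℂ))
  simp only [Pi.sub_apply] at e3
  rw [integral_const_mul, e3,
    integral_sub (i0.const_mul _) (i1.const_mul _), integral_const_mul, integral_const_mul, integral_const_mul] at h
  have hne : ((K:ℂ) * (K+1) * ((μ:ℂ)^2-1)) ≠ 0 := by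
    have a1 : (K:ℂ) ≠ 0 := by exact_mod_cast (by omega : K ≠ 0)
    have a2 : (K:ℂ) + 1 ≠ 0 := by exact_mod_cast (by omega : K + 1 ≠ 0)
    have a3 : (μ:ℂ)^2 - 1 ≠ 0 := by
      have : μ^2 - 1 ≠ 0 := by
        intro h; apply h1; nlinarith
      exact_mod_cast this
    exact mul_ne_zero (mul_ne_zero a1 a2) a3
  have h := (mul_eq_zero.1 h).resolve_left hne
  have e1 : 1 + (K+2) = K + 2 + 1 := by ring
  have e2 : 2 + (K+2) = K + 2 + 2 := by ring
  rw [e1, e2, zero_add] at h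
  unfold Bk
  push_cast
  linear_combination h

lemma Bk_const (hn : 1 ≤ n) (hf : FH f M) (hD : ∀ p, DD f p = 0) (hσ : 0 < σ) {N : ℕ} (hN : 2 * n + 8 ≤ N) :
    ∀ μ : ℝ, 0 < μ → ((μ:ℂ) + 1)^n * Bk f σ 0 N μ = 2^n * Bk f σ 0 N 1 := by
  have d0 : ∀ μ : ℝ, 0 < μ → HasDerivAt (Bk f σ 0 N) (- N * Bk f σ 1 (N+1) μ) μ := by
    intro μ hμ
    have := Bk_deriv hf hσ hμ (k := 0) (l := N) (by omega)
    simp only [zero_add] at this; rwa [add_comm 1 N] at this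
  have d1 : ∀ μ : ℝ, 0 < μ → HasDerivAt (Bk f σ 1 (N+1)) (- (N+1) * Bk f σ 2 (N+2) μ) μ := by
    intro μ hμ
    have := Bk_deriv hf hσ hμ (k := 1) (l := N) (by omega)
    rw [add_comm 1 N, (by ring : 1 + 1 + N = N + 2)] at this
    simpa using this
  let Q : ℝ → ℂ := fun μ => - N * ((μ + 1) * Bk f σ 1 (N+1) μ) + n * Bk f σ 0 N μ
  have dl : ∀ (c : ℂ) (μ : ℝ), HasDerivAt (fun μ : ℝ => (μ:ℂ) + c) 1 μ := by
    intro c μ; simpa using (Complex.ofRealCLM.hasDerivAt (x := μ)).add_const c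
  have dQ : ∀ μ : ℝ, 0 < μ → HasDerivAt Q (- N * (1 * Bk f σ 1 (N+1) μ + (μ+1) * (- (N+1) * Bk f σ 2 (N+2) μ)) + n * (- N * Bk f σ 1 (N+1) μ)) μ := by
    intro μ hμ
    exact ((((dl 1 μ).fun_mul (d1 μ hμ)).const_mul (-(N:ℂ)))).fun_add ((d0 μ hμ).const_mul (n:ℂ))
  obtain ⟨k, rfl⟩ : ∃ k, n = k + 1 := ⟨n - 1, by omega⟩
  have dR : ∀ μ ∈ Ioi (0:ℝ), HasDerivAt (fun μ : ℝ => ((μ:ℂ) + (-1))^(k+1+1) * Q μ) 0 μ := by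
    intro μ hμ
    refine (((dl (-1) μ).fun_pow (k+1+1)).fun_mul (dQ μ hμ)).congr_deriv ?_
    by_cases h1 : μ = 1
    · subst h1; simp
    · have := Bk_ode hf hD hσ hμ h1 hN
      simp only [Nat.add_sub_cancel, Q]
      push_cast at this ⊢
      linear_combination ((μ:ℂ) + (-1))^(k+1) * this
  have cR := is_const_of_deriv dR
  have Q0 : ∀ μ : ℝ, 0 < μ → μ ≠ 1 → Q μ = 0 := by
    intro μ hμ h1
    have := cR μ hμ 1 (mem_Ioi.2 one_pos)
    simp only [Complex.ofReal_one, add_neg_cancel, ne_eq, Nat.add_eq_zero_iff, one_ne_zero, and_false, not_false_eq_true, zero_pow, zero_mul] at this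
    rcases mul_eq_zero.1 this with h | h
    · exfalso; apply h1
      have := pow_eq_zero_iff (by omega) |>.1 h
      have h2 : (μ:ℂ) = 1 := by linear_combination this
      exact_mod_cast h2
    · exact h
  have Q1 : Q 1 = 0 := by
    have c1 : Tendsto Q (𝓝[≠] 1) (𝓝 (Q 1)) := (dQ 1 one_pos).continuousAt.tendsto.mono_left nhdsWithin_le_nhds
    have c2 : Tendsto Q (𝓝[≠] 1) (𝓝 0) := by
      apply tendsto_const_nhds.congr'
      filter_upwards [self_mem_nhdsWithin, nhdsWithin_le_nhds (Ioi_mem_nhds one_pos)] with μ h1 h2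
      exact (Q0 μ h2 h1).symm
    exact tendsto_nhds_unique c1 c2
  have QQ : ∀ μ : ℝ, 0 < μ → Q μ = 0 := fun μ hμ => by
    by_cases h1 : μ = 1
    · rw [h1, Q1]
    · exact Q0 μ hμ h1
  have dS : ∀ μ ∈ Ioi (0:ℝ), HasDerivAt (fun μ : ℝ => ((μ:ℂ) + 1)^(k+1) * Bk f σ 0 N μ) 0 μ := by
    intro μ hμ
    refine (((dl 1 μ).fun_pow (k+1)).fun_mul (d0 μ hμ)).congr_deriv ?_
    have := QQ μ hμ
    simp only [Nat.add_sub_cancel, Q] at this ⊢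
    push_cast at this ⊢
    linear_combination ((μ:ℂ) + 1)^k * this
  intro μ hμ
  have := is_const_of_deriv dS μ hμ 1 (mem_Ioi.2 one_pos)
  rw [this]; push_cast; norm_num

end

section
variable {n : ℕ} {f : Hn n → ℂ} {M : ℝ} {σ : ℝ}

lemma scale_int {g : Hn n → ℂ} {l : ℝ} (hl : 0 < l) (hg : Integrable g)
    (hg2 : Integrable (fun p : Hn n => g (l • p.1, p.2))) :
    ∫ p : Hn n, g (l • p.1, p.2) = ((l : ℂ)^(2*n))⁻¹ * ∫ p, g p := by
  change ∫ p : (Fin n → ℂ) × ℝ, g (l • p.1, p.2) = ((l : ℂ)^(2*n))⁻¹ * ∫ p : (Fin n → ℂ) × ℝ, g p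
  have e : (volume : Measure ((Fin n → ℂ) × ℝ)) = (volume : Measure (Fin n → ℂ)).prod volume := rfl
  rw [e] at hg hg2 ⊢
  rw [integral_prod_symm _ hg, integral_prod_symm _ hg2, ← integral_const_mul]
  congr 1; funext t
  have := Measure.integral_comp_smul (volume : Measure (Fin n → ℂ)) (fun z => g (z, t)) l
  simp only at this ⊢
  rw [this]
  have fr : Module.finrank ℝ (Fin n → ℂ) = 2 * n := by
    simp [Module.finrank_pi_fintype, Complex.finrank_real_complex, mul_comm]
  rw [fr, abs_of_nonneg (by positivity), Complex.real_smul]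
  push_cast; ring

lemma ww_scale (l : ℝ) (p : Hn n) : ww σ 1 (l • p.1, p.2) = ww σ (l^2) p := by
  unfold ww
  rw [rC_eq, rC_eq]
  have : rho (n := n) (l • p.1, p.2) = l^2 * rho p := by
    unfold rho; simp [Finset.mul_sum, mul_pow]
  rw [this]; push_cast; simp [ct]

lemma FH.comp {φ : Hn n → Hn n} (hf : FH f M) (hφ : ContDiff ℝ ∞ φ) : FH (fun p => f (φ p)) M :=
  ⟨hf.sm.comp hφ, fun _ => hf.bd _⟩

lemma eps_id (hn : 1 ≤ n) (hf : FH f M) (hD : ∀ p, DD f p = 0) (hσ : 0 < σ) {N : ℕ} (hN : 2 * n + 8 ≤ N)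
    {ε : ℝ} (hε : 0 < ε) :
    ((1:ℂ) + ε^2)^n * ∫ p : Hn n, f (ε • p.1, p.2) * (ww σ 1 p)⁻¹ ^ N = 2^n * ∫ p, f p * (ww σ 1 p)⁻¹ ^ N := by
  have hl : 0 < ε⁻¹ := inv_pos.2 hε
  have hs : ContDiff ℝ ∞ (fun p : Hn n => ((ε • p.1, p.2) : Hn n)) := by fun_prop
  have h1 := Bk_const hn hf hD hσ hN ((ε⁻¹)^2) (by positivity)
  have i1 := (hf.comp hs).int (P_int (n := n) hσ one_pos (k := 0) (l := N) (by omega))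
  have i2 := hf.int (P_int (n := n) hσ (pow_pos hl 2) (k := 0) (l := N) (by omega))
  simp only [pow_zero, one_mul, zero_add] at i1 i2
  have e : ∀ p : Hn n, (fun p : Hn n => f (ε • p.1, p.2) * (ww σ 1 p)⁻¹ ^ N) (ε⁻¹ • p.1, p.2) = f p * (ww σ (ε⁻¹^2) p)⁻¹ ^ N := by
    intro p
    simp only [smul_smul, mul_inv_cancel₀ hε.ne', one_smul, ww_scale]
  have h2 := scale_int hl i1 (by simp_rw [e]; exact i2)
  simp_rw [e] at h2
  simp only [Bk, pow_zero, one_mul] at h1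
  rw [h2] at h1
  rw [← h1, ← mul_assoc]
  congr 1
  have : (ε:ℂ) ≠ 0 := by exact_mod_cast hε.ne'
  push_cast
  rw [pow_mul, ← inv_pow, ← mul_pow]
  congr 1
  field_simp

lemma lim_id (hn : 1 ≤ n) (hf : FH f M) (hD : ∀ p, DD f p = 0) (hσ : 0 < σ) {N : ℕ} (hN : 2 * n + 8 ≤ N) :
    2^n * ∫ p, f p * (ww σ 1 p)⁻¹ ^ N = ∫ p : Hn n, f (0, p.2) * (ww σ 1 p)⁻¹ ^ N := by
  have iu := (P_int (n := n) hσ one_pos (k := 0) (l := N) (by omega))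
  simp only [pow_zero, one_mul, zero_add] at iu
  have t1 : Tendsto (fun ε : ℝ => ∫ p : Hn n, f (ε • p.1, p.2) * (ww σ 1 p)⁻¹ ^ N) (𝓝[>] 0)
      (𝓝 (∫ p : Hn n, f (0, p.2) * (ww σ 1 p)⁻¹ ^ N)) := by
    refine tendsto_integral_filter_of_dominated_convergence (fun p => M * ‖(ww σ 1 p)⁻¹ ^ N‖) ?_ ?_ (iu.norm.const_mul _) ?_
    · refine Eventually.of_forall fun ε => ?_
      have hs : ContDiff ℝ ∞ (fun p : Hn n => ((ε • p.1, p.2) : Hn n)) := by fun_prop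
      exact ((hf.comp hs).sm.continuous.mul (contDiff_invpow (contDiff_ww σ 1) (ww_ne hσ zero_le_one) N).continuous).aestronglyMeasurable
    · refine Eventually.of_forall fun ε => Eventually.of_forall fun p => ?_
      rw [norm_mul]
      exact mul_le_mul_of_nonneg_right (hf.bd _) (norm_nonneg _)
    · refine Eventually.of_forall fun p => ?_
      refine Tendsto.mul_const _ ?_
      have c : Continuous (fun ε : ℝ => f (ε • p.1, p.2)) := hf.sm.continuous.comp (by fun_prop)
      have := c.tendsto 0
      simp only [zero_smul] at this
      exact this.mono_left nhdsWithin_le_nhds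
  have t2 : Tendsto (fun ε : ℝ => ((1:ℂ) + ε^2)^n) (𝓝[>] 0) (𝓝 1) := by
    have c : Continuous (fun ε : ℝ => ((1:ℂ) + ε^2)^n) := by fun_prop
    have := c.tendsto 0
    simp only [Complex.ofReal_zero, ne_eq, OfNat.ofNat_ne_zero, not_false_eq_true, zero_pow, add_zero, one_pow] at this
    exact this.mono_left nhdsWithin_le_nhds
  have t3 := t2.mul t1
  rw [one_mul] at t3
  refine tendsto_nhds_unique (tendsto_const_nhds.congr' ?_) t3
  filter_upwards [self_mem_nhdsWithin] with ε hε
  exact (eps_id hn hf hD hσ hN hε).symm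

end

section
variable {n : ℕ}

def Rz (z : Fin n → ℂ) : ℝ := ∑ j, ‖z j‖ ^ 2
def Jn (n N : ℕ) (s : ℂ) : ℂ := ∫ z : Fin n → ℂ, (s + (Rz z : ℂ))⁻¹ ^ N

lemma Rz_nonneg (z : Fin n → ℂ) : 0 ≤ Rz z := Finset.sum_nonneg fun j _ => by positivity
lemma Rz_cont : Continuous (Rz (n := n)) := by unfold Rz; fun_prop
lemma Rz_smul (l : ℝ) (z : Fin n → ℂ) : Rz (l • z) = l^2 * Rz z := by
  unfold Rz; simp [Finset.mul_sum, mul_pow]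

lemma sR_ne {s : ℂ} (hs : 0 < s.re) (z : Fin n → ℂ) : s + (Rz z : ℂ) ≠ 0 := by
  intro h
  have := congrArg Complex.re h
  simp at this
  linarith [Rz_nonneg z]

lemma sR_lower {s : ℂ} {c : ℝ} (hc : 0 < c) (h1 : c ≤ 1) (hs : c ≤ s.re) (z : Fin n → ℂ) :
    c / 2 * (1 + ‖z‖) ≤ ‖s + (Rz z : ℂ)‖ := by
  have a1 : s.re + Rz z ≤ ‖s + (Rz z : ℂ)‖ := by
    have := Complex.re_le_norm (s + (Rz z : ℂ))
    simpa using this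
  have a2 : ‖z‖^2 ≤ Rz z := norm_sq_le z
  nlinarith [sq_nonneg (‖z‖ - 1), norm_nonneg z, Rz_nonneg z]

lemma sR_bd {s : ℂ} {c : ℝ} (hc : 0 < c) (h1 : c ≤ 1) (hs : c ≤ s.re) (N : ℕ) (z : Fin n → ℂ) :
    ‖(s + (Rz z : ℂ))⁻¹ ^ N‖ ≤ (2/c)^N * (1 + ‖z‖) ^ (-(N:ℝ)) := by
  have a0 := sR_lower hc h1 hs z
  have hp : 0 < 1 + ‖z‖ := by positivity
  rw [Real.rpow_neg hp.le, Real.rpow_natCast, norm_pow, norm_inv, ← inv_pow, ← mul_pow]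
  refine pow_le_pow_left₀ (by positivity) ?_ _
  calc ‖s + (Rz z : ℂ)‖⁻¹ ≤ (c / 2 * (1 + ‖z‖))⁻¹ := inv_anti₀ (by positivity) a0
    _ = _ := by field_simp

lemma fr_Cn : Module.finrank ℝ (Fin n → ℂ) = 2 * n := by
  simp [Module.finrank_pi_fintype, Complex.finrank_real_complex, mul_comm]

lemma bd_int {N : ℕ} (hN : 2 * n + 1 ≤ N) (C : ℝ) : Integrable (fun z : Fin n → ℂ => C * (1 + ‖z‖) ^ (-(N:ℝ))) := by
  refine (integrable_one_add_norm ?_).const_mul _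
  rw [fr_Cn]; exact_mod_cast (by omega)

lemma sR_cont {s : ℂ} (hs : 0 < s.re) (N : ℕ) : Continuous (fun z : Fin n → ℂ => (s + (Rz z : ℂ))⁻¹ ^ N) :=
  ((continuous_const.add (Complex.continuous_ofReal.comp Rz_cont)).inv₀ (sR_ne hs)).pow N

lemma sR_int {s : ℂ} (hs : 0 < s.re) {N : ℕ} (hN : 2 * n + 1 ≤ N) :
    Integrable (fun z : Fin n → ℂ => (s + (Rz z : ℂ))⁻¹ ^ N) := by
  refine (bd_int hN _).mono' (sR_cont hs N).aestronglyMeasurable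
    (Eventually.of_forall fun z => sR_bd (c := min 1 s.re) (by simp [hs]) (min_le_left _ _) (min_le_right _ _) N z)

lemma Jn_deriv {s : ℂ} (hs : 0 < s.re) {N : ℕ} (hN : 2 * n + 1 ≤ N) :
    HasDerivAt (Jn n N) (- N * Jn n (N+1) s) s := by
  have hc : 0 < min 1 (s.re/2) := by simp [hs]
  have hb : {x : ℂ | s.re/2 < x.re} ∈ 𝓝 s :=
    (isOpen_lt continuous_const Complex.continuous_re).mem_nhds (by simp [hs])
  have key := hasDerivAt_integral_of_dominated_loc_of_deriv_le (μ := volume) (𝕜 := ℂ)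
    (F := fun (x : ℂ) (z : Fin n → ℂ) => (x + (Rz z : ℂ))⁻¹ ^ N)
    (F' := fun (x : ℂ) (z : Fin n → ℂ) => - N * (x + (Rz z : ℂ))⁻¹ ^ (N+1)) (x₀ := s) (s := {x : ℂ | s.re/2 < x.re})
    (bound := fun z => N * ((2/ min 1 (s.re/2))^(N+1) * (1 + ‖z‖) ^ (-((N+1:ℕ):ℝ)))) hb ?_ (sR_int hs hN) ?_ ?_ ?_ ?_
  · refine key.2.congr_deriv ?_
    unfold Jn
    rw [integral_const_mul]
  · filter_upwards [hb] with x hx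
    exact (sR_cont (lt_trans (half_pos hs) hx) N).aestronglyMeasurable
  · exact (continuous_const.mul (sR_cont hs (N+1))).aestronglyMeasurable
  · refine Eventually.of_forall fun z x hx => ?_
    rw [norm_mul, norm_neg, Complex.norm_natCast]
    exact mul_le_mul_of_nonneg_left (sR_bd hc (min_le_left _ _) ((min_le_right _ _).trans (le_of_lt hx)) _ _) (by positivity)
  · exact (bd_int (by omega) _).const_mul _
  · refine Eventually.of_forall fun z x hx => ?_
    have hx' : 0 < x.re := lt_trans (half_pos hs) hx
    have d1 : HasDerivAt (fun x : ℂ => x + (Rz z : ℂ)) 1 x := (hasDerivAt_id x).add_const _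
    refine ((d1.fun_inv (sR_ne hx' z)).fun_pow N).congr_deriv ?_
    rcases N with _ | N
    · simp
    · simp only [Nat.add_sub_cancel, div_eq_mul_inv, ← inv_pow]; push_cast; ring

lemma Jn_scale {s : ℂ} (N : ℕ) {l : ℝ} (hl : 0 < l) :
    (l:ℂ)^(2*N) * Jn n N ((l:ℂ)^2 * s) = (l:ℂ)^(2*n) * Jn n N s := by
  have h := Measure.integral_comp_smul (volume : Measure (Fin n → ℂ)) (fun z => ((l:ℂ)^2 * s + (Rz z : ℂ))⁻¹ ^ N) l
  rw [fr_Cn, abs_of_nonneg (by positivity), Complex.real_smul] at h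
  have hl' : (l:ℂ) ≠ 0 := by exact_mod_cast hl.ne'
  have e : ∀ z : Fin n → ℂ, ((l:ℂ)^2 * s + (Rz (l • z) : ℂ))⁻¹ ^ N = ((l:ℂ)^(2*N))⁻¹ * (s + (Rz z : ℂ))⁻¹ ^ N := by
    intro z
    rw [Rz_smul, pow_mul, ← inv_pow, ← mul_pow, ← mul_inv]
    push_cast; congr 2; ring
  simp_rw [e] at h
  rw [integral_const_mul] at h
  unfold Jn
  push_cast at h
  have h1 : (l:ℂ)^(2*N) ≠ 0 := pow_ne_zero _ hl'
  have h2 : (l:ℂ)^(2*n) ≠ 0 := pow_ne_zero _ hl'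
  field_simp at h ⊢
  linear_combination -h

lemma Jn_rec {s : ℂ} (hs : 0 < s.re) {N : ℕ} (hN : 2 * n + 1 ≤ N) :
    (N:ℂ) * s * Jn n (N+1) s = ((N:ℂ) - n) * Jn n N s := by
  have d0 : HasDerivAt (fun l : ℝ => (l:ℂ)) 1 (1:ℝ) := by
    have := Complex.ofRealCLM.hasDerivAt (x := (1:ℝ))
    exact this.congr_deriv (by simp)
  have d1 : HasDerivAt (fun l : ℝ => (l:ℂ)^2 * s) (2 * s) (1:ℝ) := by
    refine ((d0.fun_pow 2).mul_const s).congr_deriv ?_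
    simp
  have d2 : HasDerivAt (fun l : ℝ => Jn n N ((l:ℂ)^2 * s)) ((- N * Jn n (N+1) s) * (2*s)) (1:ℝ) :=
    (Jn_deriv hs hN).comp_of_eq (1:ℝ) d1 (by simp)
  have d3 := (d0.fun_pow (2*N)).fun_mul d2
  have d4 := (d0.fun_pow (2*n)).mul_const (Jn n N s)
  have e : (fun l : ℝ => (l:ℂ)^(2*N) * Jn n N ((l:ℂ)^2 * s)) =ᶠ[𝓝 1] fun l : ℝ => (l:ℂ)^(2*n) * Jn n N s := by
    filter_upwards [Ioi_mem_nhds one_pos] with l hl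
    exact Jn_scale N hl
  have := d3.unique (d4.congr_of_eventuallyEq e)
  simp only [Complex.ofReal_one, one_pow, mul_one, one_mul] at this
  push_cast at this
  linear_combination (-1/2) * this

lemma Jn_formula {σ : ℝ} (hσ : 0 < σ) {N : ℕ} (hN : 2 * n + 1 ≤ N) (t : ℝ) :
    Jn n N (σ + Complex.I * t) = ((σ:ℂ)^(N-n) * Jn n N σ) * qk Complex.I σ t ^ (N-n) := by
  have hre : ∀ t : ℝ, 0 < ((σ:ℂ) + Complex.I * t).re := fun t => by simpa using hσ
  have dl : ∀ t : ℝ, HasDerivAt (fun t : ℝ => (σ:ℂ) + Complex.I * t) Complex.I t := by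
    intro t
    simpa using ((Complex.ofRealCLM.hasDerivAt (x := t)).const_mul Complex.I).const_add (σ:ℂ)
  have d : ∀ t : ℝ, HasDerivAt (fun t : ℝ => ((σ:ℂ) + Complex.I * t)^(N-n) * Jn n N (σ + Complex.I * t)) 0 t := by
    intro t
    refine (((dl t).fun_pow (N-n)).fun_mul ((Jn_deriv (hre t) hN).comp_of_eq t (dl t) rfl)).congr_deriv ?_
    have h := Jn_rec (hre t) hN
    obtain ⟨m, hm⟩ : ∃ m, N = n + (m + 1) := ⟨N - n - 1, by omega⟩
    have e1 : N - n = m + 1 := by omega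
    have e2 : (N:ℂ) - n = m + 1 := by rw [hm]; push_cast; ring
    rw [e2] at h
    rw [e1, Nat.add_sub_cancel]
    simp only [Function.comp_apply]
    push_cast
    linear_combination (-Complex.I * ((σ:ℂ) + Complex.I * t)^m) * h
  have hc := is_const_of_deriv_eq_zero (fun t => (d t).differentiableAt) (fun t => (d t).deriv) t 0
  simp only [Complex.ofReal_zero, mul_zero, add_zero] at hc
  rw [← hc, qk, inv_pow]
  have : ((σ:ℂ) + Complex.I * t) ≠ 0 := fun h => by have := hre t; rw [h] at this; simp at this
  field_simp

lemma Jn_ne {σ : ℝ} (hσ : 0 < σ) {N : ℕ} (hN : 2 * n + 1 ≤ N) : Jn n N σ ≠ 0 := by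
  have e : Jn n N σ = ((∫ z : Fin n → ℂ, (σ + Rz z)⁻¹ ^ N : ℝ) : ℂ) := by
    unfold Jn
    rw [← integral_complex_ofReal]
    congr 1; funext z; push_cast; rfl
  have hpos : ∀ z : Fin n → ℂ, 0 < (σ + Rz z)⁻¹ ^ N := fun z => by
    have := Rz_nonneg z; positivity
  have hi : Integrable (fun z : Fin n → ℂ => (σ + Rz z)⁻¹ ^ N) := by
    have := (sR_int (n := n) (s := (σ:ℂ)) (by simpa using hσ) hN).re
    refine this.congr (Eventually.of_forall fun z => ?_)
    have : ((σ:ℂ) + (Rz z : ℂ))⁻¹ ^ N = (((σ + Rz z)⁻¹ ^ N : ℝ) : ℂ) := by push_cast; rfl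
    simp only [this]; exact Complex.ofReal_re _
  rw [e]
  have : 0 < ∫ z : Fin n → ℂ, (σ + Rz z)⁻¹ ^ N := by
    rw [integral_pos_iff_support_of_nonneg (fun z => (hpos z).le) hi]
    have : Function.support (fun z : Fin n → ℂ => (σ + Rz z)⁻¹ ^ N) = univ := by
      ext z; simp only [Function.mem_support, mem_univ, iff_true]; exact (hpos z).ne'
    rw [this]; exact Measure.measure_univ_pos.2 (NeZero.ne _)
  exact_mod_cast this.ne'

lemma int_out {c : ℝ → ℂ} {C σ : ℝ} (hc : BC c C) (hσ : 0 < σ) {N : ℕ} (hN : 2 * n + 8 ≤ N) :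
    ∫ p : Hn n, c p.2 * (ww σ 1 p)⁻¹ ^ N =
      ((σ:ℂ)^(N-n) * Jn n N σ) * gam (N-n-2) Complex.I c σ := by
  have iu := (P_int (n := n) hσ one_pos (k := 0) (l := N) (by omega))
  simp only [pow_zero, one_mul, zero_add] at iu
  have ii : Integrable (fun p : Hn n => c p.2 * (ww σ 1 p)⁻¹ ^ N) :=
    iu.bdd_mul (c := C) (hc.1.comp continuous_snd).aestronglyMeasurable (Eventually.of_forall fun _ => hc.2 _)
  change ∫ p : (Fin n → ℂ) × ℝ, c p.2 * (ww σ 1 p)⁻¹ ^ N = _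
  have e : (volume : Measure ((Fin n → ℂ) × ℝ)) = (volume : Measure (Fin n → ℂ)).prod volume := rfl
  rw [e] at ii ⊢
  rw [integral_prod_symm _ ii]
  unfold gam
  rw [← integral_const_mul]
  congr 1; funext t
  simp only
  rw [integral_const_mul]
  have e1 : ∀ z : Fin n → ℂ, ww σ 1 (z, t) = ((σ:ℂ) + Complex.I * t) + (Rz z : ℂ) := by
    intro z
    unfold ww; rw [rC_eq]; simp only [ct, rho, Rz]; push_cast; ring
  simp_rw [e1]
  have := Jn_formula (n := n) hσ (N := N) (by omega) t
  unfold Jn at this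
  rw [this]
  have e2 : N - n - 2 + 2 = N - n := by omega
  rw [e2]; unfold Jn; ring

end

section
variable {n : ℕ} {f κ : Hn n → ℂ} {M : ℝ} {σ : ℝ}

lemma lmul_fst (w u : Hn n) : (lmul w u).1 = w.1 + u.1 := by simp [lmul, eT]
lemma lmul_snd (w u : Hn n) : (lmul w u).2 = w.2 + u.2 + 2 * ∑ i, (w.1 i * (starRingEnd ℂ) (u.1 i)).im := by
  simp [lmul, eT, cof_apply]

lemma lmul_neg_lmul (w u : Hn n) : lmul (-w) (lmul w u) = u := by
  refine Prod.ext ?_ ?_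
  · rw [lmul_fst, lmul_fst]; simp
  · rw [lmul_snd, lmul_snd, lmul_fst]
    simp only [Prod.snd_neg, Prod.fst_neg, Pi.neg_apply, Pi.add_apply, map_add, mul_add, neg_mul, Complex.add_im,
      Complex.neg_im, Finset.sum_add_distrib, Finset.sum_neg_distrib]
    have : ∀ i, (w.1 i * (starRingEnd ℂ) (w.1 i)).im = 0 := fun i => by simp [Complex.mul_conj]
    simp only [this]; simp; ring

lemma lmul_lmul_neg (w u : Hn n) : lmul w (lmul (-w) u) = u := by
  have := lmul_neg_lmul (-w) u
  rwa [neg_neg] at this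

lemma continuous_lmul2 : Continuous (fun q : Hn n × Hn n => lmul q.1 q.2) := by
  have : (fun q : Hn n × Hn n => lmul q.1 q.2) =
      fun q => ((q.1.1 + q.2.1, q.1.2 + q.2.2 + 2 * ∑ i, (q.1.1 i * (starRingEnd ℂ) (q.2.1 i)).im) : Hn n) := by
    funext q; exact Prod.ext (lmul_fst _ _) (lmul_snd _ _)
  rw [this]
  fun_prop

lemma mp_lmul (w : Hn n) : MeasurePreserving (lmul w) volume volume := by
  have h1 := mp_shear (n := n) (c := fun z => 2 * ∑ i, (w.1 i * (starRingEnd ℂ) (z i)).im) (by fun_prop)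
  have h2 := (measurePreserving_add_left (volume : Measure (Hn n)) w).comp h1
  have : lmul w = (fun x => w + x) ∘ (fun u : Hn n => ((u.1, u.2 + 2 * ∑ i, (w.1 i * (starRingEnd ℂ) (u.1 i)).im) : Hn n)) := by
    funext u
    refine Prod.ext ?_ ?_
    · rw [lmul_fst]; rfl
    · rw [lmul_snd]; simp [add_assoc]
  rw [this]; exact h2

/-- the homeomorphism `(w,p) ↦ (w, w·p)` -/
def PsiH (n : ℕ) : (Hn n × Hn n) ≃ₜ (Hn n × Hn n) where
  toFun q := (q.1, lmul q.1 q.2)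
  invFun q := (q.1, lmul (-q.1) q.2)
  left_inv q := by simp [lmul_neg_lmul]
  right_inv q := by simp [lmul_lmul_neg]
  continuous_toFun := continuous_fst.prodMk continuous_lmul2
  continuous_invFun := continuous_fst.prodMk (continuous_lmul2.comp (continuous_fst.neg.prodMk continuous_snd))

lemma mp_Psi : MeasurePreserving (PsiH n) ((volume : Measure (Hn n)).prod volume) ((volume : Measure (Hn n)).prod volume) := by
  refine MeasurePreserving.skew_product (f := id) (g := fun w p => lmul w p) (MeasurePreserving.id _) ?_ ?_
  · exact continuous_lmul2.measurable
  · exact Eventually.of_forall fun w => (mp_lmul w).map_eq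

def ell (v : Hn n) (w : Hn n) : ℂ := ∑ i, (starRingEnd ℂ) (v.1 i) * (cx i w + Complex.I * cy i w)
def hw (σ : ℝ) (v w : Hn n) : ℂ := ww σ 1 v + (rC w - Complex.I * ct w - 2 * ell v w)

@[fun_prop] lemma contDiff_ell (v : Hn n) : ContDiff ℝ ∞ (ell v) := by unfold ell; fun_prop
@[fun_prop] lemma contDiff_hw (v : Hn n) : ContDiff ℝ ∞ (hw σ v) := by unfold hw; fun_prop

lemma hw_eq (v w : Hn n) : ww σ 1 (lmul (-w) v) = hw σ v w := by
  unfold hw ww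
  have a : rC (lmul (-w) v) = rC v + rC w - 2 * ∑ i, (((w.1 i) * (starRingEnd ℂ) (v.1 i)).re : ℂ) := by
    unfold rC cx cy
    rw [lmul_fst, Finset.mul_sum, ← Finset.sum_add_distrib, ← Finset.sum_sub_distrib]
    refine Finset.sum_congr rfl fun i _ => ?_
    simp; ring
  have b : ct (lmul (-w) v) = ct v - ct w - 2 * ∑ i, (((w.1 i) * (starRingEnd ℂ) (v.1 i)).im : ℂ) := by
    unfold ct; rw [lmul_snd]
    simp only [Prod.snd_neg, Prod.fst_neg, Pi.neg_apply, neg_mul, Complex.neg_im, Finset.sum_neg_distrib]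
    push_cast; ring
  have c : ell v w = ∑ i, (((w.1 i) * (starRingEnd ℂ) (v.1 i)).re : ℂ) + Complex.I * ∑ i, (((w.1 i) * (starRingEnd ℂ) (v.1 i)).im : ℂ) := by
    unfold ell
    rw [Finset.mul_sum, ← Finset.sum_add_distrib]
    refine Finset.sum_congr rfl fun i _ => ?_
    rw [cx, cy, mul_comm Complex.I, Complex.re_add_im, mul_comm Complex.I, Complex.re_add_im]; ring
  rw [a, b, c]; push_cast; ring

lemma LD_ell (u v p : Hn n) : LD u (ell v) p = ∑ i, (starRingEnd ℂ) (v.1 i) * (LD u (cx i) p + Complex.I * LD u (cy i) p) := by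
  unfold ell
  rw [LD_sum _ _ fun i _ => dif (by fun_prop) p]
  refine Finset.sum_congr rfl fun i _ => ?_
  rw [LD_const_mul _ (dif (by fun_prop) p), LD_add _ (dif (by fun_prop) p) (dif (by fun_prop) p), LD_const_mul _ (dif (by fun_prop) p)]

lemma LD_hw (u v p : Hn n) : LD u (hw σ v) p = LD u rC p - Complex.I * LD u ct p - 2 * LD u (ell v) p := by
  unfold hw
  rw [LD_add _ (dif (by fun_prop) p) (dif (by fun_prop) p), LD_const', LD_sub _ (dif (by fun_prop) p) (dif (by fun_prop) p),
    LD_sub _ (dif (by fun_prop) p) (dif (by fun_prop) p), LD_const_mul _ (dif (by fun_prop) p), LD_const_mul _ (dif (by fun_prop) p)]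
  ring

lemma ZC_hw (v p : Hn n) (j : Fin n) : LD (eX n j) (hw σ v) p + Complex.I * LD (eY n j) (hw σ v) p = 0 := by
  rw [LD_hw, LD_hw, LDX_rC, LDY_rC, LDX_ct, LDY_ct, LD_ell, LD_ell]
  simp only [LDX_cx, LDX_cy, LDY_cx, LDY_cy]
  simp only [mul_zero, add_zero, zero_add, mul_ite, mul_one, Finset.sum_ite_eq', Finset.mem_univ, if_true]
  have := Complex.I_sq
  linear_combination (2 * cx j p - 2 * (starRingEnd ℂ) (v.1 j)) * this

lemma inner_zero (hσ : 0 < σ) (hκ : Tst κ) (N : ℕ) (j : Fin n) (v : Hn n) :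
    ∫ w, ZC Complex.I j κ w * (ww σ 1 (lmul (-w) v))⁻¹ ^ N = 0 := by
  have h0 : ∀ w, hw σ v w ≠ 0 := fun w => by rw [← hw_eq]; exact ww_ne hσ zero_le_one _
  simp_rw [hw_eq]
  have sg := contDiff_invpow (contDiff_hw (σ := σ) v) h0 N
  have e : ∀ w, ZC Complex.I j κ w * (hw σ v w)⁻¹ ^ N = (1/2) * ((hw σ v w)⁻¹ ^ N * LD (eX n j) κ w
      + Complex.I * ((hw σ v w)⁻¹ ^ N * LD (eY n j) κ w)) := fun w => by unfold ZC; ring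
  simp_rw [e]
  have i1 := ((hκ.LD (eX n j)).mul_left sg).integrable
  have i2 := ((hκ.LD (eY n j)).mul_left sg).integrable
  have i3 := (hκ.mul_left (contDiff_LD (eX n j) sg)).integrable
  have i4 := (hκ.mul_left (contDiff_LD (eY n j) sg)).integrable
  have b1 := ibp sg hκ (eX n j)
  have b2 := ibp sg hκ (eY n j)
  rw [integral_const_mul, integral_add i1 (i2.const_mul _), integral_const_mul]
  have : (∫ w, LD (eX n j) (fun p => (hw σ v p)⁻¹ ^ N) w * κ w)
      + Complex.I * ∫ w, LD (eY n j) (fun p => (hw σ v p)⁻¹ ^ N) w * κ w = 0 := by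
    rw [← integral_const_mul, ← integral_add i3 (i4.const_mul _)]
    refine integral_eq_zero_of_ae (Eventually.of_forall fun w => ?_)
    simp only [LD_invpow (contDiff_hw (σ := σ) v) h0, Pi.zero_apply]
    linear_combination (-(N:ℂ) * (hw σ v w)⁻¹ ^ (N+1) * κ w) * ZC_hw (σ := σ) v w j
  rw [b1, b2] at this
  linear_combination (-1/2) * this

lemma wwcc_zero (hn : 1 ≤ n) (hf : FH f M) (hD : ∀ p, DD f p = 0) (hσ : 0 < σ) {N : ℕ} (hN : 2 * n + 8 ≤ N)
    (hκ : Tst κ) (j : Fin n) : ∫ p : Hn n, cc f (ZC Complex.I j κ) p.2 * (ww σ 1 p)⁻¹ ^ N = 0 := by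
  have iu := (P_int (n := n) hσ one_pos (k := 0) (l := N) (by omega))
  simp only [pow_zero, one_mul, zero_add] at iu
  have hZ := hκ.ZC Complex.I j
  have ip := hZ.integrable.mul_prod iu
  have hbd : ∀ (φ : Hn n × Hn n → Hn n), Continuous φ →
      Integrable (fun q : Hn n × Hn n => f (φ q) * (ZC Complex.I j κ q.1 * (ww σ 1 q.2)⁻¹ ^ N))
        ((volume : Measure (Hn n)).prod volume) := fun φ hφ =>
    ip.bdd_mul (c := M) (hf.sm.continuous.comp hφ).aestronglyMeasurable (Eventually.of_forall fun _ => hf.bd _)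
  have iG := hbd _ continuous_lmul2
  have iR := hbd (fun q => q.1 + q.2.2 • eT n) (by fun_prop)
  -- pointwise identity
  have key : ∀ w, 2^n * ∫ p, f (lmul w p) * (ww σ 1 p)⁻¹ ^ N = ∫ p : Hn n, f (w + p.2 • eT n) * (ww σ 1 p)⁻¹ ^ N := by
    intro w
    rw [lim_id hn (hf.comp (contDiff_lmul w)) (fun p => by rw [DD_lmul hf.sm]; exact hD _) hσ hN]
    congr 1; funext p; congr 2
    refine Prod.ext ?_ ?_
    · rw [lmul_fst]; simp [eT]
    · rw [lmul_snd]; simp [eT]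
  have e1 : ∫ p : Hn n, cc f (ZC Complex.I j κ) p.2 * (ww σ 1 p)⁻¹ ^ N =
      ∫ q : Hn n × Hn n, f (q.1 + q.2.2 • eT n) * (ZC Complex.I j κ q.1 * (ww σ 1 q.2)⁻¹ ^ N)
        ∂((volume : Measure (Hn n)).prod volume) := by
    rw [integral_prod_symm _ iR]
    congr 1; funext p
    unfold cc
    rw [← integral_mul_const]
    congr 1; funext w; ring
  have e2 : ∫ q : Hn n × Hn n, f (q.1 + q.2.2 • eT n) * (ZC Complex.I j κ q.1 * (ww σ 1 q.2)⁻¹ ^ N)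
        ∂((volume : Measure (Hn n)).prod volume) = 2^n * ∫ q : Hn n × Hn n, f (lmul q.1 q.2) * (ZC Complex.I j κ q.1 * (ww σ 1 q.2)⁻¹ ^ N)
        ∂((volume : Measure (Hn n)).prod volume) := by
    rw [integral_prod _ iR, integral_prod _ iG, ← integral_const_mul]
    congr 1; funext w
    have k1 : ∀ g : Hn n → ℂ, ∫ p, g p * (ZC Complex.I j κ w * (ww σ 1 p)⁻¹ ^ N) = ZC Complex.I j κ w * ∫ p, g p * (ww σ 1 p)⁻¹ ^ N := by
      intro g; rw [← integral_const_mul]; congr 1; funext p; ring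
    have k2 := k1 (fun p => f (w + p.2 • eT n))
    have k3 := k1 (fun p => f (lmul w p))
    simp only at k2 k3 ⊢
    rw [k2, k3, ← key]; ring
  let H : Hn n × Hn n → ℂ := fun q => f q.2 * (ZC Complex.I j κ q.1 * (ww σ 1 (lmul (-q.1) q.2))⁻¹ ^ N)
  have hH : (fun q : Hn n × Hn n => f (lmul q.1 q.2) * (ZC Complex.I j κ q.1 * (ww σ 1 q.2)⁻¹ ^ N)) = H ∘ PsiH n := by
    funext q; simp [H, PsiH, lmul_neg_lmul]
  have emb := (PsiH n).measurableEmbedding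
  have iH : Integrable H ((volume : Measure (Hn n)).prod volume) := by
    rw [hH] at iG
    exact (mp_Psi.integrable_comp_emb emb).1 iG
  have e3 : ∫ q : Hn n × Hn n, f (lmul q.1 q.2) * (ZC Complex.I j κ q.1 * (ww σ 1 q.2)⁻¹ ^ N)
        ∂((volume : Measure (Hn n)).prod volume) = ∫ q, H q ∂((volume : Measure (Hn n)).prod volume) := by
    rw [hH]; exact mp_Psi.integral_comp emb H
  rw [e1, e2, e3, integral_prod_symm _ iH]
  have : ∀ v, ∫ w, H (w, v) = 0 := by
    intro v
    simp only [H]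
    rw [integral_const_mul, inner_zero hσ hκ N j v, mul_zero]
  simp [this]

lemma S1 (hn : 1 ≤ n) (hf : FH f M) (hD : ∀ p, DD f p = 0) : ∀ κ, Tst κ → ∀ j a, 0 < a → gp 0 Complex.I f (ZC Complex.I j κ) a = 0 := by
  intro κ hκ j
  have hB := cc_BC hf (hκ.ZC Complex.I j)
  refine gam_descend_all EI_I hB (2*n+8 - n - 2) fun a ha => ?_
  have h := wwcc_zero hn hf hD ha (N := 2*n+8) le_rfl hκ j
  rw [int_out hB ha le_rfl] at h
  refine (mul_eq_zero.1 h).resolve_left (mul_ne_zero (pow_ne_zero _ ?_) (Jn_ne ha (by omega)))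
  exact_mod_cast ha.ne'

lemma DD_conj (hf : ContDiff ℝ ∞ f) (p : Hn n) : DD (fun p => (starRingEnd ℂ) (f p)) p = (starRingEnd ℂ) (DD f p) := by
  have e : ∀ v, ∀ g : Hn n → ℂ, LD v (fun p => (starRingEnd ℂ) (g p)) = fun p => (starRingEnd ℂ) (LD v g p) :=
    fun v g => funext fun p => LD_conj v
  have e2 : ∀ g : Hn n → ℂ, LL (fun p => (starRingEnd ℂ) (g p)) = fun p => (starRingEnd ℂ) (LL g p) := by
    intro g; funext p; unfold LL; simp only [e]
    have h4 : (starRingEnd ℂ) (4:ℂ) = 4 := Complex.conj_ofNat 4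
    simp [h4]
  unfold DD
  simp only [e, e2]; simp

lemma S2 (hn : 1 ≤ n) (hf : FH f M) (hD : ∀ p, DD f p = 0) : ∀ κ, Tst κ → ∀ j a, 0 < a → gp 0 (-Complex.I) f (ZC (-Complex.I) j κ) a = 0 := by
  intro κ hκ j a ha
  have hf' : FH (fun p => (starRingEnd ℂ) (f p)) M := ⟨Complex.conjCLE.contDiff.comp hf.sm, fun p => by simpa using hf.bd p⟩
  have h := S1 hn hf' (fun p => by rw [DD_conj hf.sm, hD]; simp) _ hκ.conj j a ha
  have e1 : ZC Complex.I j (fun p => (starRingEnd ℂ) (κ p)) = fun p => (starRingEnd ℂ) (ZC (-Complex.I) j κ p) := by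
    funext p; unfold ZC; rw [LD_conj, LD_conj]
    have h4 : (starRingEnd ℂ) (2:ℂ) = 2 := Complex.conj_ofNat 2
    simp [h4]
  have e2 : ∀ s, cc (fun p => (starRingEnd ℂ) (f p)) (fun p => (starRingEnd ℂ) (ZC (-Complex.I) j κ p)) s = (starRingEnd ℂ) (cc f (ZC (-Complex.I) j κ) s) := by
    intro s; unfold cc; rw [← integral_conj]; simp
  unfold gp gam at h ⊢
  rw [e1] at h
  simp_rw [e2] at h
  have e3 : ∀ s : ℝ, qk Complex.I a s ^ (0+2) * (starRingEnd ℂ) (cc f (ZC (-Complex.I) j κ) s) =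
      (starRingEnd ℂ) (qk (-Complex.I) a s ^ (0+2) * cc f (ZC (-Complex.I) j κ) s) := by
    intro s; simp [qk]
  simp_rw [e3] at h
  rw [integral_conj] at h
  simpa using h

end

section
variable {n : ℕ} {F : Sg n → ℂ} {f : Hn n → ℂ} {M C α : ℝ}

lemma norm_IF_le (h : SmU F) (hb : ∀ p : Sg n, 0 < p.2 → ‖F p‖ ≤ C) {χ : Hn n → ℂ} (hχ : Tst χ)
    {a : ℝ} (ha : 0 < a) : ‖IF F χ a‖ ≤ C * ∫ p, ‖χ p‖ := by
  unfold IF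
  rw [← integral_const_mul]
  refine (norm_integral_le_integral_norm _).trans ?_
  refine integral_mono (IF_integrable h hχ ha).norm (hχ.integrable.norm.const_mul C) fun w => ?_
  simp only [norm_mul]
  exact mul_le_mul_of_nonneg_right (hb (w, a) ha) (norm_nonneg _)

lemma KF_main (h : SmU F) (hb : ∀ p : Sg n, 0 < p.2 → ‖F p‖ ≤ C)
    (hF : ∀ p : Sg n, 0 < p.2 → Lalpha n α F p = 0) (hf : FH f M)
    (hbv : IsBoundaryValue n F f)
    (hLL : ∀ χ, Tst χ → ∀ a, 0 < a → Ip f (LL χ) a + n * dIp f χ a = 0) :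
    KF α (fun χ a => IF F χ a - Ip f χ a) (fun χ a => IF (DA n F) χ a - dIp f χ a)
      (fun χ a => IF (DA n (DA n F)) χ a + Ip f (LD (eT n) (LD (eT n) χ)) a) (C + M) where
  lin a ha :=
    { add := fun χ κ hχ hκ => by
        simp only [IF_add_test h hχ hκ ha, Ip_add hf hχ hκ ha]; ring
      smul := fun c χ hχ => by
        simp only [IF_const_mul_test, Ip_const_mul]; ring
      bd := fun χ hχ => by
        have h1 := norm_IF_le h hb hχ ha
        have h2 := norm_Ip_le hf hχ ha
        refine (norm_sub_le _ _).trans ?_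
        linarith }
  d1 χ hχ a ha := (IF_hasDerivAt h hχ ha).sub (Ip_hasDerivAt hf hχ ha)
  d2 χ hχ a ha := by
    have := (IF_hasDerivAt h.DA hχ ha).sub (dIp_hasDerivAt hf hχ ha)
    rw [sub_neg_eq_add] at this
    exact this
  ode χ hχ a ha := by
    have h1 := weak_Lalpha h hF hχ ha
    have h2 := hLL χ hχ a ha
    linear_combination h1 + (α : ℂ) * a * h2
  lim χ hχ := by
    have h1 := hbv χ hχ.integrable
    have h2 := Ip_tendsto hf hχ
    have := h1.sub h2
    rw [sub_self] at this
    exact this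

lemma converse (hn : 1 ≤ n) (hα : 0 < α) (h : SmU F) (hb : ∀ p : Sg n, 0 < p.2 → ‖F p‖ ≤ C)
    (hF : ∀ p : Sg n, 0 < p.2 → Lalpha n α F p = 0) (hf : FH f M)
    (hbv : IsBoundaryValue n F f) (hD : ∀ p, DD f p = 0) : IsPluriharmonic n F := by
  have s1 := S1 hn hf hD
  have s2 := S2 hn hf hD
  have W4 := fun χ (hχ : Tst χ) a (ha : 0 < a) j k =>
    Ip_W4 hf s1 s2 (fun κ h j => lemma_Z hf hD h j) hχ ha j k
  have hK := KF_main h hb hF hf hbv (fun χ hχ a ha => Ip_LL hf W4 hχ ha)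
  have e0 : ∀ χ, Tst χ → ∀ a, 0 < a → IF F χ a = Ip f χ a := fun χ hχ a ha =>
    sub_eq_zero.1 (hK.zero hn hα hχ ha)
  have e1 : ∀ χ, Tst χ → ∀ a, 0 < a → IF (DA n F) χ a = dIp f χ a := by
    intro χ hχ a ha
    refine (IF_hasDerivAt h hχ ha).unique ((Ip_hasDerivAt hf hχ ha).congr_of_eventuallyEq ?_)
    filter_upwards [Ioi_mem_nhds ha] with b hb using e0 χ hχ b hb
  have e2 : ∀ χ, Tst χ → ∀ a, 0 < a →
      IF (DA n (DA n F)) χ a = - Ip f (LD (eT n) (LD (eT n) χ)) a := by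
    intro χ hχ a ha
    refine (IF_hasDerivAt h.DA hχ ha).unique ((dIp_hasDerivAt hf hχ ha).congr_of_eventuallyEq ?_)
    filter_upwards [Ioi_mem_nhds ha] with b hb using e1 χ hχ b hb
  refine pluri_of_weak h ?_ ?_ ?_ ?_
  · intro χ hχ a ha
    rw [e2 χ hχ a ha, e0 _ ((hχ.LD _).LD _) a ha]; ring
  · intro χ hχ a ha j
    rw [e0 _ ((hχ.ZC _ _).LD _) a ha, e1 _ (hχ.ZC _ _) a ha]
    exact Ip_W2 hf s1 hχ ha j
  · intro χ hχ a ha j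
    rw [e0 _ ((hχ.ZC _ _).LD _) a ha, e1 _ (hχ.ZC _ _) a ha]
    exact Ip_W3 hf s2 hχ ha j
  · intro χ hχ a ha j k
    rw [e0 _ ((hχ.ZC _ _).ZC _ _) a ha, e0 _ (hχ.LD _) a ha, e1 _ hχ a ha]
    exact W4 χ hχ a ha j k
end

end

/-- A bounded smooth `L_α`-harmonic function `F` on `S` with smooth bounded
boundary value `f` is pluriharmonic if and only if `(ℒ² + n² T²) f = 0`. -/
theorem stmt3 (n : ℕ) (hn : 1 ≤ n) (α : ℝ) (hα : 0 < α)
    (F : Sg n → ℂ) (hFbdd : ∃ C, ∀ p : Sg n, 0 < p.2 → ‖F p‖ ≤ C)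
    (hFsmooth : ContDiffOn ℝ (⊤ : ℕ∞) F {p : Sg n | 0 < p.2})
    (hFharm : ∀ p : Sg n, 0 < p.2 → Lalpha n α F p = 0)
    (f : Hn n → ℂ) (hfsmooth : ContDiff ℝ (⊤ : ℕ∞) f) (hfbdd : BddFun f)
    (hbv : IsBoundaryValue n F f) :
    IsPluriharmonic n F ↔
      ∀ w : Hn n, LH n 0 (LH n 0 f) w + (n : ℂ) ^ 2 * TH n (TH n f) w = 0 := by
  obtain ⟨C, hC⟩ := hFbdd
  obtain ⟨M, hM⟩ := hfbdd
  refine ⟨fun hp => direct hα hFsmooth hFharm hfsmooth hbv hp, fun hD => ?_⟩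
  refine converse hn hα hFsmooth hC hFharm ⟨hfsmooth, hM⟩ hbv fun p => ?_
  have := hD p
  simp only [LH_zero_eq, TH_eq] at this
  exact this
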